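/- For any n ≥ 2 there exists γ̃ > 0 depending only on n such that: if K is a convex body in ℝⁿ with Santaló point z, then there exists an o-symmetric convex body C in ℝⁿ which has axial rotational symmetry (i.e., C is invariant under all rotations of ℝⁿ fixing some line ℝu through the origin pointwise), and which satisfies δ_BM(C, Bⁿ) ≥ γ̃·δ_BM(K, Bⁿ)² and |C|·|C^o| ≥ |K|·|K^z|. -/

import Mathlib

open MeasureTheory Pointwise

noncomputable section

/-- The polar of a set `K ⊆ ℝⁿ` with respect to a point `z`:
`K^z = {x : ⟨x−z, y−z⟩ ≤ 1 for all y ∈ K}`. -/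
def polarBody {n : ℕ} (K : Set (EuclideanSpace ℝ (Fin n))) (z : EuclideanSpace ℝ (Fin n)) :
    Set (EuclideanSpace ℝ (Fin n)) :=
  {x | ∀ y ∈ K, (inner ℝ (x - z) (y - z) : ℝ) ≤ 1}

/-- The Banach–Mazur distance of `K` and `M`:
`ln min{λ ≥ 1 : K−x ⊆ Φ(M−y) ⊆ λ(K−x) for some Φ ∈ GL(n), x, y ∈ ℝⁿ}`. -/
def BMdist {n : ℕ} (K M : Set (EuclideanSpace ℝ (Fin n))) : ℝ :=
  Real.log (sInf {lam : ℝ | 1 ≤ lam ∧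
    ∃ Φ : EuclideanSpace ℝ (Fin n) ≃ₗ[ℝ] EuclideanSpace ℝ (Fin n),
    ∃ x y : EuclideanSpace ℝ (Fin n),
      (fun v => v - x) '' K ⊆ Φ '' ((fun v => v - y) '' M) ∧
      Φ '' ((fun v => v - y) '' M) ⊆ lam • ((fun v => v - x) '' K)})


/-! part 0 -/

open Set in
lemma rb_amgm {a b : ℝ} (ha : 0 < a) (hb : 0 < b) (hab : a + b = 1) (x y : ENNReal) :
    x ^ a * y ^ b ≤ ENNReal.ofReal a * x + ENNReal.ofReal b * y := by
  have ha' : ENNReal.ofReal a ≠ 0 := by simpa using ha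
  have hb' : ENNReal.ofReal b ≠ 0 := by simpa using hb
  by_cases hx : x = ⊤
  · subst hx; rw [ENNReal.mul_top ha']; simp
  by_cases hy : y = ⊤
  · subst hy; rw [ENNReal.mul_top hb']; simp
  lift x to NNReal using hx
  lift y to NNReal using hy
  have := NNReal.geom_mean_le_arith_mean2_weighted (Real.toNNReal a) (Real.toNNReal b) x y
    (by rw [← Real.toNNReal_add ha.le hb.le, hab, Real.toNNReal_one])
  rw [Real.coe_toNNReal _ ha.le, Real.coe_toNNReal _ hb.le] at this
  rw [← ENNReal.coe_rpow_of_nonneg _ ha.le, ← ENNReal.coe_rpow_of_nonneg _ hb.le]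
  unfold ENNReal.ofReal
  exact_mod_cast this

lemma rb_bm1_compact {a b : ℝ} (ha : 0 < a) (hb : 0 < b) {A B C : Set ℝ}
    (hA : IsCompact A) (hB : IsCompact B) (hAn : A.Nonempty) (hBn : B.Nonempty)
    (h : ∀ x ∈ A, ∀ y ∈ B, a * x + b * y ∈ C) :
    ENNReal.ofReal a * volume A + ENNReal.ofReal b * volume B ≤ volume C := by
  obtain ⟨x0, hx0, hx0'⟩ := hA.exists_isGreatest hAn
  obtain ⟨y0, hy0, hy0'⟩ := hB.exists_isLeast hBn
  set A1 : Set ℝ := (fun x => a * x + b * y0) '' A with hA1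
  set B1 : Set ℝ := (fun y => a * x0 + b * y) '' B with hB1
  have e1 : volume A1 = ENNReal.ofReal a * volume A := by
    have : A1 = (fun z => z + b * y0) '' ((a • ·) '' A) := by
      rw [hA1, Set.image_image]; rfl
    rw [this, Set.image_add_right, measure_preimage_add_right, Set.image_smul,
      Measure.addHaar_smul]
    simp [abs_of_pos ha]
  have e2 : volume B1 = ENNReal.ofReal b * volume B := by
    have : B1 = (fun z => a * x0 + z) '' ((b • ·) '' B) := by
      rw [hB1, Set.image_image]; rfl
    rw [this, Set.image_add_left, measure_preimage_add, Set.image_smul,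
      Measure.addHaar_smul]
    simp [abs_of_pos hb]
  have hB1m : MeasurableSet B1 :=
    (hB.image (by fun_prop)).measurableSet
  have hdis : AEDisjoint volume A1 B1 := by
    refine measure_mono_null (t := {a * x0 + b * y0}) ?_ (by simp)
    rintro z ⟨⟨x, hx, rfl⟩, ⟨y, hy, hxy⟩⟩
    have h1 := hx0' hx
    have h2 := hy0' hy
    simp only [Set.mem_singleton_iff] at *
    nlinarith [mul_le_mul_of_nonneg_left h1 ha.le, mul_le_mul_of_nonneg_left h2 hb.le]
  rw [← e1, ← e2, ← measure_union₀ hB1m.nullMeasurableSet hdis]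
  apply measure_mono
  rintro z (⟨x, hx, rfl⟩ | ⟨y, hy, rfl⟩)
  · exact h x hx y0 hy0
  · exact h x0 hx0 y hy

lemma rb_bm1 {a b : ℝ} (ha : 0 < a) (hb : 0 < b) {A B C : Set ℝ}
    (hA : MeasurableSet A) (hB : MeasurableSet B) (hAn : A.Nonempty) (hBn : B.Nonempty)
    (h : ∀ x ∈ A, ∀ y ∈ B, a * x + b * y ∈ C) :
    ENNReal.ofReal a * volume A + ENNReal.ofReal b * volume B ≤ volume C := by
  obtain ⟨x0, hx0⟩ := hAn
  obtain ⟨y0, hy0⟩ := hBn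
  rw [hA.measure_eq_iSup_isCompact, hB.measure_eq_iSup_isCompact]
  simp only [ENNReal.mul_iSup]
  refine ENNReal.iSup_add_iSup_le fun A' B' => ?_
  by_cases hA' : A' ⊆ A
  swap
  · simp only [hA', iSup_false, bot_eq_zero', zero_add]
    refine iSup_le fun hB' => iSup_le fun hB'' => ?_
    refine le_trans ?_ (rb_bm1_compact ha hb (A := {x0}) (B := insert y0 B') (C := C)
      isCompact_singleton (hB''.insert _) ⟨x0, by simp⟩ ⟨y0, by simp⟩ ?_)
    · simp only [Real.volume_singleton, mul_zero, zero_add]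
      gcongr
      exact Set.subset_insert _ _
    · rintro x rfl y hy
      exact h _ hx0 _ (by rcases hy with rfl | hy; exacts [hy0, hB' hy])
  by_cases hA'' : IsCompact A'
  swap
  · simp only [hA'', iSup_false, bot_eq_zero', zero_add, iSup_const]
    simp
    intro hB' hB''
    refine le_trans ?_ (rb_bm1_compact ha hb (A := {x0}) (B := insert y0 B') (C := C)
      isCompact_singleton (hB''.insert _) ⟨x0, by simp⟩ ⟨y0, by simp⟩ ?_)
    · simp only [Real.volume_singleton, mul_zero, zero_add]
      gcongr
      exact Set.subset_insert _ _
    · rintro x rfl y hy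
      exact h _ hx0 _ (by rcases hy with rfl | hy; exacts [hy0, hB' hy])
  simp only [hA', hA'', iSup_pos]
  by_cases hB' : B' ⊆ B
  swap
  · simp only [hB', iSup_false, bot_eq_zero', add_zero]
    refine le_trans ?_ (rb_bm1_compact ha hb (B := {y0}) (A := insert x0 A') (C := C)
      (hA''.insert _) isCompact_singleton ⟨x0, by simp⟩ ⟨y0, by simp⟩ ?_)
    · simp only [Real.volume_singleton, mul_zero, add_zero]
      gcongr
      exact Set.subset_insert _ _
    · rintro x hx y rfl
      exact h _ (by rcases hx with rfl | hx; exacts [hx0, hA' hx]) _ hy0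
  by_cases hB'' : IsCompact B'
  swap
  · simp only [hB'', iSup_false, bot_eq_zero', iSup_const]
    simp
    refine le_trans ?_ (rb_bm1_compact ha hb (B := {y0}) (A := insert x0 A') (C := C)
      (hA''.insert _) isCompact_singleton ⟨x0, by simp⟩ ⟨y0, by simp⟩ ?_)
    · simp only [Real.volume_singleton, mul_zero, add_zero]
      gcongr
      exact Set.subset_insert _ _
    · rintro x hx y rfl
      exact h _ (by rcases hx with rfl | hx; exacts [hx0, hA' hx]) _ hy0
  simp only [hB', hB'', iSup_pos]
  have := rb_bm1_compact ha hb (A := insert x0 A') (B := insert y0 B') (C := C)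
    (hA''.insert _) (hB''.insert _) ⟨x0, by simp⟩ ⟨y0, by simp⟩ (by
      intro x hx y hy
      apply h
      · rcases hx with rfl | hx; exacts [hx0, hA' hx]
      · rcases hy with rfl | hy; exacts [hy0, hB' hy])
  refine le_trans ?_ this
  gcongr <;> exact Set.subset_insert _ _

lemma rb_layer (f : ℝ → ENNReal) (hf : Measurable f) (h1 : ∀ x, f x ≤ 1) :
    ∫⁻ x, f x = ∫⁻ r in Set.Ioo (0:ℝ) 1, volume {x | ENNReal.ofReal r < f x} := by
  have hfin : ∀ x, f x ≠ ⊤ := fun x => ne_top_of_le_ne_top (by simp) (h1 x)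
  have := lintegral_eq_lintegral_meas_lt (volume : Measure ℝ) (f := fun x => (f x).toReal)
    (Filter.Eventually.of_forall fun x => ENNReal.toReal_nonneg) (by fun_prop)
  simp only [ENNReal.ofReal_toReal (hfin _)] at this
  rw [this]
  have hset : ∀ r : ℝ, 0 < r → {a : ℝ | r < (f a).toReal} = {x | ENNReal.ofReal r < f x} := by
    intro r hr
    ext x
    simp only [Set.mem_setOf_eq]
    rw [ENNReal.ofReal_lt_iff_lt_toReal hr.le (hfin x)]
  rw [setLIntegral_congr_fun measurableSet_Ioi (fun r hr => by rw [hset r hr])]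
  rw [← Set.Ioo_union_Ici_eq_Ioi (show (0:ℝ) < 1 by norm_num)]
  rw [lintegral_union measurableSet_Ici]
  · have : ∫⁻ r in Set.Ici (1:ℝ), volume {x | ENNReal.ofReal r < f x} = 0 := by
      rw [setLIntegral_congr_fun (g := fun _ => 0) measurableSet_Ici]
      · simp
      · intro r hr
        have : {x | ENNReal.ofReal r < f x} = ∅ := by
          ext x
          simp only [Set.mem_setOf_eq, Set.mem_empty_iff_false, iff_false, not_lt]
          refine (h1 x).trans ?_
          simpa using hr
        simp only [this, measure_empty]
    rw [this, add_zero]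
  · exact Set.disjoint_left.2 fun x hx hx' => absurd hx.2 (not_lt.2 hx')

lemma rb_pl1_norm {a b : ℝ} (ha : 0 < a) (hb : 0 < b) (hab : a + b = 1) (f g h : ℝ → ENNReal)
    (hf : Measurable f) (hg : Measurable g) (hh : Measurable h)
    (hf1 : ⨆ x, f x = 1) (hg1 : ⨆ x, g x = 1)
    (H : ∀ x y, f x ^ a * g y ^ b ≤ h (a * x + b * y)) :
    (∫⁻ x, f x) ^ a * (∫⁻ x, g x) ^ b ≤ ∫⁻ x, h x := by
  refine (rb_amgm ha hb hab _ _).trans ?_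
  have h2 : ∫⁻ x, min (h x) 1 ≤ ∫⁻ x, h x := lintegral_mono fun x => min_le_left _ _
  refine le_trans ?_ h2
  have hfle : ∀ x, f x ≤ 1 := fun x => hf1 ▸ le_iSup f x
  have hgle : ∀ x, g x ≤ 1 := fun x => hg1 ▸ le_iSup g x
  rw [rb_layer f hf hfle, rb_layer g hg hgle,
    rb_layer (fun x => min (h x) 1) (hh.min measurable_const) (fun x => min_le_right _ _)]
  have meas : ∀ u : ℝ → ENNReal,
      Measurable fun r : ℝ => volume {x | ENNReal.ofReal r < u x} := by
    intro u
    apply Antitone.measurable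
    intro r s hrs
    apply measure_mono
    intro x hx
    exact lt_of_le_of_lt (ENNReal.ofReal_le_ofReal hrs) hx
  rw [← lintegral_const_mul _ (meas f), ← lintegral_const_mul _ (meas g),
    ← lintegral_add_left ((meas f).const_mul _)]
  refine setLIntegral_mono_ae' measurableSet_Ioo (Filter.Eventually.of_forall fun r hr => ?_)
  have hr1 : ENNReal.ofReal r < 1 := by simpa using hr.2
  apply rb_bm1 ha hb
  · exact measurableSet_lt measurable_const hf
  · exact measurableSet_lt measurable_const hg
  · exact lt_iSup_iff.1 (hf1 ▸ hr1)
  · exact lt_iSup_iff.1 (hg1 ▸ hr1)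
  · intro x hx y hy
    simp only [Set.mem_setOf_eq] at *
    refine lt_min (lt_of_lt_of_le ?_ (H x y)) hr1
    have hr0 : ENNReal.ofReal r ≠ 0 := by simpa using hr.1
    calc ENNReal.ofReal r = ENNReal.ofReal r ^ a * ENNReal.ofReal r ^ b := by
          rw [← ENNReal.rpow_add _ _ hr0 ENNReal.ofReal_ne_top, hab, ENNReal.rpow_one]
      _ < f x ^ a * g y ^ b := by
          apply ENNReal.mul_lt_mul
          · exact ENNReal.rpow_lt_rpow hx ha
          · exact ENNReal.rpow_lt_rpow hy hb

lemma rb_pl1_bdd {a b : ℝ} (ha : 0 < a) (hb : 0 < b) (hab : a + b = 1) (f g h : ℝ → ENNReal)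
    (hf : Measurable f) (hg : Measurable g) (hh : Measurable h)
    (hf1 : ⨆ x, f x ≠ ⊤) (hg1 : ⨆ x, g x ≠ ⊤)
    (H : ∀ x y, f x ^ a * g y ^ b ≤ h (a * x + b * y)) :
    (∫⁻ x, f x) ^ a * (∫⁻ x, g x) ^ b ≤ ∫⁻ x, h x := by
  set M := ⨆ x, f x with hM
  set N := ⨆ x, g x with hN
  by_cases hM0 : M = 0
  · have : ∀ x, f x = 0 := by simpa [hM] using hM0
    simp [this, ha]
  by_cases hN0 : N = 0
  · have : ∀ x, g x = 0 := by simpa [hN] using hN0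
    simp [this, hb]
  have key := rb_pl1_norm ha hb hab (fun x => M⁻¹ * f x) (fun x => N⁻¹ * g x)
    (fun x => (M⁻¹ ^ a * N⁻¹ ^ b) * h x) (hf.const_mul _) (hg.const_mul _) (hh.const_mul _)
    (by rw [← ENNReal.mul_iSup, ← hM, ENNReal.inv_mul_cancel hM0 hf1])
    (by rw [← ENNReal.mul_iSup, ← hN, ENNReal.inv_mul_cancel hN0 hg1])
    (by
      intro x y
      rw [ENNReal.mul_rpow_of_nonneg _ _ ha.le, ENNReal.mul_rpow_of_nonneg _ _ hb.le]
      calc _ = (M⁻¹ ^ a * N⁻¹ ^ b) * (f x ^ a * g y ^ b) := by ring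
        _ ≤ _ := by gcongr; exact H x y)
  rw [lintegral_const_mul _ hf, lintegral_const_mul _ hg, lintegral_const_mul _ hh,
    ENNReal.mul_rpow_of_nonneg _ _ ha.le, ENNReal.mul_rpow_of_nonneg _ _ hb.le] at key
  have hc0 : M⁻¹ ^ a * N⁻¹ ^ b ≠ 0 := by
    apply mul_ne_zero
    · simp [ENNReal.rpow_eq_zero_iff, hf1, ha.le, hM0]
    · simp [ENNReal.rpow_eq_zero_iff, hg1, hb.le, hN0]
  have hct : M⁻¹ ^ a * N⁻¹ ^ b ≠ ⊤ := by
    apply ENNReal.mul_ne_top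
    · simp [hM0, ha.le, hf1]
    · simp [hN0, hb.le, hg1]
  refine (ENNReal.mul_le_mul_iff_right hc0 hct).1 ?_
  calc _ = _ := by ring
    _ ≤ _ := key

/-- one-dimensional Prekopa-Leindler -/
lemma rb_pl1 {a b : ℝ} (ha : 0 < a) (hb : 0 < b) (hab : a + b = 1) (f g h : ℝ → ENNReal)
    (hf : Measurable f) (hg : Measurable g) (hh : Measurable h)
    (H : ∀ x y, f x ^ a * g y ^ b ≤ h (a * x + b * y)) :
    (∫⁻ x, f x) ^ a * (∫⁻ x, g x) ^ b ≤ ∫⁻ x, h x := by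
  have trunc : ∀ u : ℝ → ENNReal, Measurable u →
      Filter.Tendsto (fun k : ℕ => ∫⁻ x, min (u x) k) Filter.atTop (nhds (∫⁻ x, u x)) := by
    intro u hu
    apply lintegral_tendsto_of_tendsto_of_monotone
    · intro k; exact (hu.min measurable_const).aemeasurable
    · refine Filter.Eventually.of_forall fun x k l hkl => ?_
      exact min_le_min le_rfl (by exact_mod_cast hkl)
    · refine Filter.Eventually.of_forall fun x => ?_
      have : Filter.Tendsto (fun k : ℕ => min (u x) (k : ENNReal)) Filter.atTop
          (nhds (min (u x) ⊤)) := tendsto_const_nhds.min ENNReal.tendsto_nat_nhds_top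
      simpa using this
  have step : ∀ k l : ℕ, (∫⁻ x, min (f x) k) ^ a * (∫⁻ x, min (g x) l) ^ b ≤ ∫⁻ x, h x := by
    intro k l
    apply rb_pl1_bdd ha hb hab _ _ _ (hf.min measurable_const) (hg.min measurable_const) hh
    · refine ne_top_of_le_ne_top (ENNReal.natCast_ne_top k) (iSup_le fun x => min_le_right _ _)
    · refine ne_top_of_le_ne_top (ENNReal.natCast_ne_top l) (iSup_le fun x => min_le_right _ _)
    · intro x y
      refine le_trans ?_ (H x y)
      gcongr <;> exact min_le_left _ _
  by_cases hf0 : ∫⁻ x, f x = 0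
  · simp [hf0, ha]
  by_cases hg0 : ∫⁻ x, g x = 0
  · simp [hg0, hb]
  have t1 := ((trunc f hf).ennrpow_const a)
  have t2 := ((trunc g hg).ennrpow_const b)
  refine le_of_tendsto (ENNReal.Tendsto.mul t1 (Or.inl ?_) t2 (Or.inl ?_))
    (Filter.Eventually.of_forall fun k => step k k)
  · simp [ENNReal.rpow_eq_zero_iff, hf0, ha.le]
  · simp [ENNReal.rpow_eq_zero_iff, hg0, hb.le]

/-! part 1 -/

/-- A measure satisfies the Prekopa-Leindler property for the mean `c` on `D`. -/
def rb_PL {X : Type*} [MeasurableSpace X] (μ : Measure X) (D : Set X) (c : X → X → X)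
    (a b : ℝ) : Prop :=
  ∀ f g h : X → ENNReal, Measurable f → Measurable g → Measurable h →
    (∀ x ∈ D, ∀ y ∈ D, f x ^ a * g y ^ b ≤ h (c x y)) →
    (∫⁻ x, f x ∂μ) ^ a * (∫⁻ x, g x ∂μ) ^ b ≤ ∫⁻ x, h x ∂μ

lemma rb_PL_prod {X Y : Type*} [MeasurableSpace X] [MeasurableSpace Y] {μ : Measure X}
    {ν : Measure Y} [SFinite μ] [SFinite ν] {D : Set X} {D' : Set Y} {c : X → X → X}
    {c' : Y → Y → Y} {a b : ℝ} (h1 : rb_PL μ D c a b) (h2 : rb_PL ν D' c' a b) :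
    rb_PL (μ.prod ν) (D ×ˢ D') (fun p q => (c p.1 q.1, c' p.2 q.2)) a b := by
  intro f g h hf hg hh H
  rw [lintegral_prod _ hf.aemeasurable, lintegral_prod _ hg.aemeasurable,
    lintegral_prod _ hh.aemeasurable]
  apply h1 _ _ _ hf.lintegral_prod_right' hg.lintegral_prod_right' hh.lintegral_prod_right'
  intro x hx y hy
  apply h2 _ _ _ (hf.comp measurable_prodMk_left) (hg.comp measurable_prodMk_left)
    (hh.comp measurable_prodMk_left)
  intro x' hx' y' hy'
  exact H (x, x') ⟨hx, hx'⟩ (y, y') ⟨hy, hy'⟩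

lemma rb_PL_equiv {X Y : Type*} [MeasurableSpace X] [MeasurableSpace Y] {μ : Measure X}
    {ν : Measure Y} {D : Set X} {D' : Set Y} {c : X → X → X}
    {c' : Y → Y → Y} {a b : ℝ} (h1 : rb_PL μ D c a b) (e : Y ≃ᵐ X)
    (he : MeasurePreserving e ν μ) (hD : ∀ y, y ∈ D' ↔ e y ∈ D)
    (hc : ∀ x y, e (c' x y) = c (e x) (e y)) : rb_PL ν D' c' a b := by
  intro f g h hf hg hh H
  have key := h1 (f ∘ e.symm) (g ∘ e.symm) (h ∘ e.symm) (hf.comp e.symm.measurable)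
    (hg.comp e.symm.measurable) (hh.comp e.symm.measurable) (by
      intro x hx y hy
      have := H (e.symm x) ((hD _).2 (by simpa)) (e.symm y) ((hD _).2 (by simpa))
      have h3 : e.symm (c x y) = c' (e.symm x) (e.symm y) := by
        rw [e.symm_apply_eq, hc]; simp
      simpa [h3] using this)
  rw [← he.lintegral_comp (hf.comp e.symm.measurable),
    ← he.lintegral_comp (hg.comp e.symm.measurable),
    ← he.lintegral_comp (hh.comp e.symm.measurable)] at key
  simpa using key

lemma rb_PL_pi {μ : Measure ℝ} [SigmaFinite μ] {D : Set ℝ} {c : ℝ → ℝ → ℝ} {a b : ℝ}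
    (h1 : rb_PL μ D c a b) (hab : a + b = 1) (ha : 0 < a) (hb : 0 < b) (m : ℕ) :
    rb_PL (Measure.pi (fun _ : Fin m => μ)) (Set.pi Set.univ fun _ => D)
      (fun x y i => c (x i) (y i)) a b := by
  induction m with
  | zero =>
    intro f g h hf hg hh H
    rw [Measure.pi_of_empty (fun _ : Fin 0 => μ), lintegral_dirac, lintegral_dirac,
      lintegral_dirac]
    have := H (fun a => isEmptyElim a) (by simp) (fun a => isEmptyElim a) (by simp)
    convert this using 2
  | succ m ih =>
    refine rb_PL_equiv (rb_PL_prod h1 ih) (MeasurableEquiv.piFinSuccAbove (fun _ => ℝ) 0)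
      (measurePreserving_piFinSuccAbove (fun _ => μ) 0) ?_ ?_
    · intro y
      simp only [Set.mem_pi, Set.mem_univ, true_imp_iff, Set.mem_prod, Fin.forall_fin_succ]
      simp [MeasurableEquiv.piFinSuccAbove, Fin.insertNthEquiv]
      intro _
      rfl
    · intro x y
      rfl

lemma rb_PL_add {a b : ℝ} (ha : 0 < a) (hb : 0 < b) (hab : a + b = 1) (m : ℕ) :
    rb_PL (volume : Measure (Fin m → ℝ)) Set.univ (fun x y => a • x + b • y) a b := by
  have h1 : rb_PL (volume : Measure ℝ) Set.univ (fun x y => a * x + b * y) a b := by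
    intro f g h hf hg hh H
    exact rb_pl1 ha hb hab f g h hf hg hh (fun x y => H x trivial y trivial)
  have := rb_PL_pi h1 hab ha hb m
  rw [Set.pi_univ] at this
  exact this

lemma rb_exp_lintegral (f : ℝ → ENNReal) :
    ∫⁻ x in Set.Ioi 0, f x = ∫⁻ u, ENNReal.ofReal (Real.exp u) * f (Real.exp u) := by
  have := lintegral_image_eq_lintegral_abs_deriv_mul (s := Set.univ) (f := Real.exp)
    (f' := Real.exp) MeasurableSet.univ (fun x _ => (Real.hasDerivAt_exp x).hasDerivWithinAt)
    Real.exp_injective.injOn f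
  rw [Set.image_univ, Real.range_exp] at this
  rw [this]
  simp [abs_of_pos (Real.exp_pos _)]

lemma rb_PL_mul1 : rb_PL (volume.restrict (Set.Ioi (0:ℝ))) (Set.Ioi 0)
    (fun x y => Real.sqrt (x * y)) (1/2) (1/2) := by
  intro f g h hf hg hh H
  rw [rb_exp_lintegral, rb_exp_lintegral, rb_exp_lintegral]
  apply rb_pl1 (by norm_num) (by norm_num) (by norm_num)
  · fun_prop
  · fun_prop
  · fun_prop
  · intro x y
    have h1 := H (Real.exp x) (Real.exp_pos x) (Real.exp y) (Real.exp_pos y)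
    have e1 : Real.sqrt (Real.exp x * Real.exp y) = Real.exp (1/2*x+1/2*y) := by
      rw [← Real.exp_add, Real.sqrt_eq_rpow, ← Real.exp_mul]; congr 1; ring
    simp only [e1] at h1
    rw [ENNReal.mul_rpow_of_nonneg _ _ (by norm_num), ENNReal.mul_rpow_of_nonneg _ _ (by norm_num)]
    calc _ = (ENNReal.ofReal (Real.exp x) ^ (1/2:ℝ) * ENNReal.ofReal (Real.exp y) ^ (1/2:ℝ)) *
          (f (Real.exp x) ^ (1/2:ℝ) * g (Real.exp y) ^ (1/2:ℝ)) := by ring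
      _ ≤ _ := by
        gcongr
        apply le_of_eq
        rw [ENNReal.ofReal_rpow_of_nonneg (Real.exp_pos _).le (by norm_num),
          ENNReal.ofReal_rpow_of_nonneg (Real.exp_pos _).le (by norm_num),
          ← ENNReal.ofReal_mul (by positivity), ← Real.exp_mul, ← Real.exp_mul, ← Real.exp_add]
        congr 2; ring

/-- multiplicative Prekopa-Leindler on the positive orthant -/
lemma rb_PL_mul (m : ℕ) : rb_PL ((volume : Measure (Fin m → ℝ)).restrict
    (Set.pi Set.univ fun _ => Set.Ioi (0:ℝ))) (Set.pi Set.univ fun _ => Set.Ioi (0:ℝ))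
    (fun x y i => Real.sqrt (x i * y i)) (1/2) (1/2) := by
  have := rb_PL_pi rb_PL_mul1 (by norm_num) (by norm_num) (by norm_num) m
  rw [volume_pi, Measure.restrict_pi_pi]
  exact this

/-- Brunn-Minkowski (multiplicative form) on sets. -/
lemma rb_bm_set {a b : ℝ} (ha : 0 < a) (hb : 0 < b) (hab : a + b = 1) {m : ℕ}
    {A B C : Set (Fin m → ℝ)} (hA : MeasurableSet A) (hB : MeasurableSet B)
    (hC : MeasurableSet C) (H : ∀ x ∈ A, ∀ y ∈ B, a • x + b • y ∈ C) :
    volume A ^ a * volume B ^ b ≤ volume C := by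
  have := rb_PL_add ha hb hab m (A.indicator 1) (B.indicator 1) (C.indicator 1)
    (measurable_one.indicator hA) (measurable_one.indicator hB) (measurable_one.indicator hC) (by
      intro x _ y _
      by_cases hx : x ∈ A
      · by_cases hy : y ∈ B
        · simp [hx, hy, H x hx y hy]
        · simp [hy, hb]
      · simp [hx, ha])
  simpa [lintegral_indicator_one, hA, hB, hC] using this

/-! part 2 -/

open Set in
/-- transport lemma -/
lemma rb_transport {f : ℝ → ℝ} {b : ℝ} (hb : 0 < b) (hc : ContinuousOn f (Ioo 0 b))
    (hp : ∀ x ∈ Ioo 0 b, 0 < f x) (hi : IntervalIntegrable f volume 0 b) :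
    0 < (∫ x in (0:ℝ)..b, f x) ∧
    ∃ t : ℝ → ℝ, (∀ θ ∈ Ioo (0:ℝ) 1, t θ ∈ Ioo 0 b ∧
      (∫ x in (0:ℝ)..(t θ), f x) = θ * ∫ x in (0:ℝ)..b, f x) ∧
      (∀ θ ∈ Ioo (0:ℝ) 1, HasDerivAt t ((∫ x in (0:ℝ)..b, f x) / f (t θ)) θ) ∧
      StrictMonoOn t (Ioo 0 1) ∧ t '' Ioo 0 1 = Ioo 0 b := by
  set Φ : ℝ → ℝ := fun x => ∫ y in (0:ℝ)..x, f y with hΦ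
  have hii : ∀ x ∈ Icc 0 b, ∀ y ∈ Icc 0 b, IntervalIntegrable f volume x y := by
    intro x hx y hy
    apply hi.mono_set
    rw [uIcc_of_le hb.le]
    exact uIcc_subset_Icc hx hy
  have hmono : StrictMonoOn Φ (Icc 0 b) := by
    intro x hx y hy hxy
    have h1 : Φ y - Φ x = ∫ z in x..y, f z := by
      rw [hΦ]
      exact intervalIntegral.integral_interval_sub_left (hii 0 ⟨le_rfl, hb.le⟩ y hy)
        (hii 0 ⟨le_rfl, hb.le⟩ x hx)
    have h2 : 0 < ∫ z in x..y, f z := by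
      apply intervalIntegral.intervalIntegral_pos_of_pos_on (hii x hx y hy) _ hxy
      intro z hz
      exact hp z ⟨hx.1.trans_lt hz.1, hz.2.trans_le hy.2⟩
    linarith
  have hcont : ContinuousOn Φ (Icc 0 b) := by
    have := intervalIntegral.continuousOn_primitive_interval' hi (a := 0) (by simp)
    rwa [uIcc_of_le hb.le] at this
  have hΦ0 : Φ 0 = 0 := by simp [hΦ]
  have hF : 0 < Φ b := by
    have := hmono ⟨le_rfl, hb.le⟩ ⟨hb.le, le_rfl⟩ hb
    rwa [hΦ0] at this
  refine ⟨hF, ?_⟩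
  have hex : ∀ θ ∈ Ioo (0:ℝ) 1, ∃ x ∈ Ioo 0 b, Φ x = θ * Φ b := by
    intro θ hθ
    have := intermediate_value_Ioo hb.le hcont
    rw [hΦ0] at this
    exact this ⟨mul_pos hθ.1 hF, by nlinarith [hθ.2]⟩
  classical
  let t : ℝ → ℝ := fun θ => if h : θ ∈ Ioo (0:ℝ) 1 then (hex θ h).choose else 0
  have ht : ∀ θ ∈ Ioo (0:ℝ) 1, t θ ∈ Ioo 0 b ∧ Φ (t θ) = θ * Φ b := by
    intro θ hθ
    simp only [t, hθ, dif_pos]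
    exact (hex θ hθ).choose_spec
  have htm : StrictMonoOn t (Ioo 0 1) := by
    intro x hx y hy hxy
    have h1 := ht x hx
    have h2 := ht y hy
    rw [← hmono.lt_iff_lt (Ioo_subset_Icc_self h1.1) (Ioo_subset_Icc_self h2.1), h1.2, h2.2]
    nlinarith
  have him : t '' Ioo 0 1 = Ioo 0 b := by
    apply Subset.antisymm
    · rintro _ ⟨θ, hθ, rfl⟩; exact (ht θ hθ).1
    · intro x hx
      have hx1 : Φ x / Φ b ∈ Ioo (0:ℝ) 1 := by
        have h1 := hmono ⟨le_rfl, hb.le⟩ (Ioo_subset_Icc_self hx) hx.1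
        have h2 := hmono (Ioo_subset_Icc_self hx) ⟨hb.le, le_rfl⟩ hx.2
        rw [hΦ0] at h1
        exact ⟨div_pos h1 hF, (div_lt_one hF).2 h2⟩
      refine ⟨_, hx1, ?_⟩
      have h3 := ht _ hx1
      apply hmono.injOn (Ioo_subset_Icc_self h3.1) (Ioo_subset_Icc_self hx)
      rw [h3.2]; field_simp
  refine ⟨t, ht, ?_, htm, him⟩
  intro θ hθ
  have h1 := ht θ hθ
  have hct : ContinuousAt t θ := by
    apply htm.continuousAt_of_image_mem_nhds (Ioo_mem_nhds hθ.1 hθ.2)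
    rw [him]; exact Ioo_mem_nhds h1.1.1 h1.1.2
  have hd : HasDerivAt Φ (f (t θ)) (t θ) := by
    apply intervalIntegral.integral_hasDerivAt_right (hii _ ⟨le_rfl, hb.le⟩ _ (Ioo_subset_Icc_self h1.1))
    · exact hc.stronglyMeasurableAtFilter isOpen_Ioo _ h1.1
    · exact hc.continuousAt (Ioo_mem_nhds h1.1.1 h1.1.2)
  have hd2 : HasDerivAt (fun x => Φ x / Φ b) (f (t θ) / Φ b) (t θ) := hd.div_const _
  have hpos := hp _ h1.1
  have := HasDerivAt.of_local_left_inverse hct hd2 (by positivity) (by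
    filter_upwards [Ioo_mem_nhds hθ.1 hθ.2] with y hy
    rw [(ht y hy).2]; field_simp)
  rwa [inv_div] at this

/-- slice volume -/
def rb_sl {m : ℕ} (L : Set (ℝ × (Fin m → ℝ))) (s : ℝ) : ENNReal := volume {y | (s, y) ∈ L}

lemma rb_sl_logconcave {m : ℕ} {L : Set (ℝ × (Fin m → ℝ))} (hL : Convex ℝ L)
    (hm : MeasurableSet L) {a b : ℝ} (ha : 0 < a) (hb : 0 < b) (hab : a + b = 1) (s s' : ℝ) :
    rb_sl L s ^ a * rb_sl L s' ^ b ≤ rb_sl L (a * s + b * s') := by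
  apply rb_bm_set ha hb hab
  · exact measurable_prodMk_left hm
  · exact measurable_prodMk_left hm
  · exact measurable_prodMk_left hm
  · intro x hx y hy
    have := hL hx hy ha.le hb.le hab
    simpa using this

lemma rb_sl_lt_top {m : ℕ} {L : Set (ℝ × (Fin m → ℝ))} (hL : IsCompact L) (s : ℝ) :
    rb_sl L s < ⊤ := by
  have : {y | (s, y) ∈ L} ⊆ Prod.snd '' L := fun y hy => ⟨_, hy, rfl⟩
  exact (measure_mono this).trans_lt (hL.image continuous_snd).measure_lt_top

lemma rb_sl_pos {m : ℕ} {L : Set (ℝ × (Fin m → ℝ))} {p : ℝ × (Fin m → ℝ)}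
    (hp : p ∈ interior L) : 0 < rb_sl L p.1 := by
  have ho : IsOpen {y | (p.1, y) ∈ interior L} :=
    isOpen_interior.preimage (by fun_prop : Continuous fun y => (p.1, y))
  have := ho.measure_pos volume ⟨p.2, hp⟩
  exact this.trans_le (measure_mono fun y hy => interior_subset (s := L) hy)

open Set in
lemma rb_half {m : ℕ} {L : Set (ℝ × (Fin m → ℝ))} (hL : IsCompact L) (hconv : Convex ℝ L)
    (h0 : 0 ∈ interior L) : ∃ b : ℝ, 0 < b ∧
      ContinuousOn (fun s => (rb_sl L s).toReal) (Ioo 0 b) ∧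
      (∀ s ∈ Ioo 0 b, 0 < (rb_sl L s).toReal) ∧
      IntervalIntegrable (fun s => (rb_sl L s).toReal) volume 0 b ∧
      (∃ y, (b, y) ∈ L) ∧ (∀ p ∈ L, p.1 ≤ b) ∧
      ENNReal.ofReal (∫ s in (0:ℝ)..b, (rb_sl L s).toReal) = volume (L ∩ {p | 0 < p.1}) := by
  have h0L : 0 ∈ L := interior_subset h0
  obtain ⟨q, hq, hmax⟩ := hL.exists_isMaxOn ⟨0, h0L⟩ continuous_fst.continuousOn
  have hmeas := hL.measurableSet
  have hbpos : 0 < q.1 := by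
    have ho : IsOpen {s : ℝ | (s, (0 : Fin m → ℝ)) ∈ interior L} :=
      isOpen_interior.preimage (by fun_prop : Continuous fun s : ℝ => (s, (0 : Fin m → ℝ)))
    have : ∀ᶠ s : ℝ in nhds 0, (s, (0 : Fin m → ℝ)) ∈ interior L := ho.mem_nhds h0
    have h2 : ∃ᶠ s : ℝ in nhds 0, 0 < s := by
      have : ∀ᶠ s : ℝ in nhdsWithin 0 (Ioi 0), 0 < s := self_mem_nhdsWithin
      exact this.frequently.filter_mono nhdsWithin_le_nhds
    obtain ⟨s, hs, hs'⟩ := (h2.and_eventually this).exists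
    exact hs.trans_le (hmax (interior_subset hs'))
  have hinn : ∀ s ∈ Ioo 0 q.1, ∃ y, (s, y) ∈ interior L := by
    intro s hs
    have := hconv.combo_interior_closure_mem_interior h0 (subset_closure hq)
      (a := 1 - s / q.1) (b := s / q.1) (by
        have : s / q.1 < 1 := (div_lt_one hbpos).2 hs.2
        linarith) (div_pos hs.1 hbpos).le (by ring)
    refine ⟨(s / q.1) • q.2, ?_⟩
    convert this using 1
    ext
    · simp; field_simp
    · simp
  have hpos : ∀ s ∈ Ioo 0 q.1, 0 < (rb_sl L s).toReal := by
    intro s hs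
    obtain ⟨y, hy⟩ := hinn s hs
    exact ENNReal.toReal_pos (rb_sl_pos hy).ne' (rb_sl_lt_top hL s).ne
  have hconc : ConcaveOn ℝ (Ioo 0 q.1) (fun s => Real.log (rb_sl L s).toReal) := by
    refine concaveOn_iff_forall_pos.2 ⟨convex_Ioo _ _, ?_⟩
    intro x hx y hy a b ha hb hab
    have h1 := rb_sl_logconcave hconv hmeas ha hb hab x y
    have h2 := ENNReal.toReal_mono (rb_sl_lt_top hL _).ne h1
    rw [ENNReal.toReal_mul, ← ENNReal.toReal_rpow, ← ENNReal.toReal_rpow] at h2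
    have px := hpos x hx
    have py := hpos y hy
    have h3 := Real.log_le_log (by positivity) h2
    rw [Real.log_mul (by positivity) (by positivity), Real.log_rpow px, Real.log_rpow py] at h3
    simpa using h3
  have hcontlog := hconc.continuousOn isOpen_Ioo
  have hcont : ContinuousOn (fun s => (rb_sl L s).toReal) (Ioo 0 q.1) := by
    refine (Real.continuous_exp.comp_continuousOn hcontlog).congr ?_
    intro s hs
    simp [Real.exp_log (hpos s hs)]
  have hmsl : Measurable (rb_sl L) := measurable_measure_prodMk_left hmeas
  have hle : ∀ p ∈ L, p.1 ≤ q.1 := fun p hp => hmax hp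
  have hvol : volume (L ∩ {p | 0 < p.1}) = ∫⁻ s in Ioc 0 q.1, rb_sl L s := by
    have hm2 : MeasurableSet (L ∩ {p : ℝ × (Fin m → ℝ) | 0 < p.1}) :=
      hmeas.inter (measurableSet_lt measurable_const measurable_fst)
    rw [Measure.volume_eq_prod, Measure.prod_apply hm2, ← lintegral_indicator measurableSet_Ioc]
    congr 1
    ext s
    by_cases hs : s ∈ Ioc 0 q.1
    · rw [indicator_of_mem hs]
      unfold rb_sl
      congr 1
      ext y
      simp [hs.1]
    · rw [indicator_of_notMem hs]
      convert measure_empty (μ := (volume : Measure (Fin m → ℝ)))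
      ext y
      simp only [mem_preimage, mem_inter_iff, mem_setOf_eq, mem_empty_iff_false, iff_false]
      rintro ⟨h1, h2⟩
      exact hs ⟨h2, hle _ h1⟩
  have hfin : ∫⁻ s in Ioc 0 q.1, rb_sl L s ≠ ⊤ := by
    rw [← hvol]
    exact ((measure_mono inter_subset_left).trans_lt hL.measure_lt_top).ne
  have hint1 : IntegrableOn (fun s => (rb_sl L s).toReal) (Ioc 0 q.1) :=
    integrable_toReal_of_lintegral_ne_top hmsl.aemeasurable hfin
  refine ⟨q.1, hbpos, hcont, hpos, ?_, ⟨q.2, hq⟩, hle, ?_⟩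
  · rw [intervalIntegrable_iff_integrableOn_Ioc_of_le hbpos.le]; exact hint1
  · rw [intervalIntegral.integral_of_le hbpos.le, hvol, integral_toReal hmsl.aemeasurable
      (Filter.Eventually.of_forall fun s => rb_sl_lt_top hL s), ENNReal.ofReal_toReal hfin]

/-! part 3 -/

lemma rb_amgm_half {f g α β : ℝ} (hf : 0 < f) (hg : 0 < g) (hα : 0 < α) (hβ : 0 < β)
    (hab : α + β = 1) : 1 / 2 ≤ f ^ α * g ^ β * (α ^ 2 / f + β ^ 2 / g) := by
  have h1 := Real.geom_mean_le_arith_mean2_weighted hα.le hβ.le (p₁ := α / f) (p₂ := β / g)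
    (by positivity) (by positivity) hab
  have h2 := Real.geom_mean_le_arith_mean2_weighted hα.le hβ.le (p₁ := 1 / α) (p₂ := 1 / β)
    (by positivity) (by positivity) hab
  rw [Real.div_rpow hα.le hf.le, Real.div_rpow hβ.le hg.le] at h1
  rw [Real.div_rpow zero_le_one hα.le, Real.div_rpow zero_le_one hβ.le, Real.one_rpow,
    Real.one_rpow] at h2
  have pf : 0 < f ^ α := Real.rpow_pos_of_pos hf _
  have pg : 0 < g ^ β := Real.rpow_pos_of_pos hg _
  have pa : 0 < α ^ α := Real.rpow_pos_of_pos hα _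
  have pb : 0 < β ^ β := Real.rpow_pos_of_pos hβ _
  have h3 : 1 / 2 ≤ α ^ α * β ^ β := by
    have : α * (1 / α) + β * (1 / β) = 2 := by field_simp; norm_num
    rw [this] at h2
    have h4 : 1 / α ^ α * (1 / β ^ β) = 1 / (α ^ α * β ^ β) := by field_simp
    rw [h4, div_le_iff₀ (by positivity)] at h2
    linarith
  calc 1 / 2 ≤ α ^ α * β ^ β := h3
    _ = f ^ α * g ^ β * (α ^ α / f ^ α * (β ^ β / g ^ β)) := by field_simp
    _ ≤ f ^ α * g ^ β * (α * (α / f) + β * (β / g)) := by gcongr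
    _ = _ := by ring

/-- the pairing on ℝ × ℝ^m -/
def rb_ip {m : ℕ} (p q : ℝ × (Fin m → ℝ)) : ℝ := p.1 * q.1 + p.2 ⬝ᵥ q.2

lemma rb_ip_add_left {m : ℕ} (p q r : ℝ × (Fin m → ℝ)) :
    rb_ip (p + q) r = rb_ip p r + rb_ip q r := by
  simp [rb_ip, add_dotProduct]; ring
lemma rb_ip_add_right {m : ℕ} (p q r : ℝ × (Fin m → ℝ)) :
    rb_ip r (p + q) = rb_ip r p + rb_ip r q := by
  simp [rb_ip, dotProduct_add]; ring
lemma rb_ip_smul_left {m : ℕ} (c : ℝ) (p r : ℝ × (Fin m → ℝ)) :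
    rb_ip (c • p) r = c * rb_ip p r := by
  simp [rb_ip, smul_dotProduct]; ring
lemma rb_ip_smul_right {m : ℕ} (c : ℝ) (p r : ℝ × (Fin m → ℝ)) :
    rb_ip r (c • p) = c * rb_ip r p := by
  simp [rb_ip, dotProduct_smul]; ring
lemma rb_ip_cont {m : ℕ} : Continuous fun x : (ℝ × (Fin m → ℝ)) × (ℝ × (Fin m → ℝ)) =>
    rb_ip x.1 x.2 := by
  unfold rb_ip dotProduct; fun_prop

/-- the polar with respect to the point (τ, 0), translated to the origin -/
def rb_polt {m : ℕ} (K : Set (ℝ × (Fin m → ℝ))) (τ : ℝ) : Set (ℝ × (Fin m → ℝ)) :=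
  {u | ∀ y ∈ K, rb_ip u y - τ * u.1 ≤ 1}

lemma rb_polt_convex {m : ℕ} (K : Set (ℝ × (Fin m → ℝ))) (τ : ℝ) :
    Convex ℝ (rb_polt K τ) := by
  intro u hu v hv a b ha hb hab y hy
  have h1 := hu y hy
  have h2 := hv y hy
  rw [rb_ip_add_left, rb_ip_smul_left, rb_ip_smul_left]
  simp only [Prod.fst_add, Prod.smul_fst, smul_eq_mul]
  nlinarith [mul_le_mul_of_nonneg_left h1 ha, mul_le_mul_of_nonneg_left h2 hb]

lemma rb_polt_closed {m : ℕ} (K : Set (ℝ × (Fin m → ℝ))) (τ : ℝ) :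
    IsClosed (rb_polt K τ) := by
  have : rb_polt K τ = ⋂ y ∈ K, {u | rb_ip u y - τ * u.1 ≤ 1} := by
    ext u; simp [rb_polt]
  rw [this]
  refine isClosed_biInter fun y _ => isClosed_le ?_ continuous_const
  have : Continuous fun u : ℝ × (Fin m → ℝ) => rb_ip u y :=
    rb_ip_cont.comp (by fun_prop : Continuous fun u => (u, y))
  fun_prop

lemma rb_polt_zero_mem {m : ℕ} {K : Set (ℝ × (Fin m → ℝ))} (hK : IsCompact K) (τ : ℝ) {c : ℝ}
    (hc : 0 < c) :
    ∀ᶠ u in nhds (0 : ℝ × (Fin m → ℝ)), ∀ y ∈ K, rb_ip u y - τ * u.1 < c := by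
  apply hK.eventually_forall_of_forall_eventually
  intro y _
  have hcont : Continuous fun z : (ℝ × (Fin m → ℝ)) × (ℝ × (Fin m → ℝ)) =>
      rb_ip z.1 z.2 - τ * z.1.1 := by
    have := rb_ip_cont (m := m)
    fun_prop
  apply hcont.continuousAt.eventually_lt continuousAt_const
  simpa [rb_ip] using hc

lemma rb_polt_int {m : ℕ} {K : Set (ℝ × (Fin m → ℝ))} (hK : IsCompact K) (τ : ℝ) :
    0 ∈ interior (rb_polt K τ) := by
  rw [mem_interior_iff_mem_nhds]
  filter_upwards [rb_polt_zero_mem hK τ one_pos] with u hu y hy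
  exact (hu y hy).le

lemma rb_polt_compact {m : ℕ} {K : Set (ℝ × (Fin m → ℝ))} {τ : ℝ}
    (hτ : ((τ, 0) : ℝ × (Fin m → ℝ)) ∈ interior K) : IsCompact (rb_polt K τ) := by
  obtain ⟨r, hr, hball⟩ := Metric.isOpen_iff.1 isOpen_interior _ hτ
  have hin : ∀ q : ℝ × (Fin m → ℝ), ‖q‖ < r → (τ, 0) + q ∈ K := by
    intro q hq
    apply interior_subset (hball _)
    simpa [dist_eq_norm] using hq
  apply Metric.isCompact_of_isClosed_isBounded (rb_polt_closed K τ)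
  refine (Metric.isBounded_closedBall (x := (0 : ℝ × (Fin m → ℝ))) (r := 2 / r)).subset ?_
  intro u hu
  have key : ∀ q : ℝ × (Fin m → ℝ), ‖q‖ < r → rb_ip u q ≤ 1 := by
    intro q hq
    have := hu _ (hin q hq)
    rw [rb_ip_add_right] at this
    simp [rb_ip] at this ⊢
    linarith
  have h2 : |r| / 2 < r := by rw [abs_of_pos (by positivity)]; linarith
  have h3 : ∀ (j : Fin m) (c : ℝ), ‖(Pi.single j c : Fin m → ℝ)‖ = |c| := by
    intro j c
    rw [← Real.norm_eq_abs]
    exact Pi.norm_single ..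
  rw [mem_closedBall_zero_iff, Prod.norm_def, sup_le_iff]
  constructor
  · have a1 := key (r / 2, 0) (by simpa [Prod.norm_def, hr, h3, abs_div] using h2)
    have a2 := key (-(r / 2), 0) (by simpa [Prod.norm_def, hr, h3, abs_div] using h2)
    simp only [rb_ip, dotProduct_zero, add_zero] at a1 a2
    rw [Real.norm_eq_abs, abs_le, le_div_iff₀ hr]
    constructor
    · rw [neg_le, ← neg_le, neg_le_iff_add_nonneg, ← sub_nonneg]
      have : (0:ℝ) ≤ (u.1 * r + 2) / r := div_nonneg (by linarith) hr.le
      calc (0:ℝ) ≤ _ := this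
        _ = _ := by field_simp; ring
    · linarith
  · rw [pi_norm_le_iff_of_nonneg (by positivity)]
    intro j
    have a1 := key (0, Pi.single j (r / 2)) (by simpa [Prod.norm_def, hr, h3, abs_div] using h2)
    have a2 := key (0, Pi.single j (-(r / 2))) (by simpa [Prod.norm_def, hr, h3, abs_div] using h2)
    simp only [rb_ip, mul_zero, zero_add, dotProduct_single] at a1 a2
    rw [Real.norm_eq_abs, abs_le, le_div_iff₀ hr]
    constructor
    · rw [neg_le, ← neg_le, neg_le_iff_add_nonneg, ← sub_nonneg]
      have : (0:ℝ) ≤ (u.2 j * r + 2) / r := div_nonneg (by linarith) hr.le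
      calc (0:ℝ) ≤ _ := this
        _ = _ := by field_simp; ring
    · linarith

/-- Steiner symmetral in the first coordinate -/
def rb_St {m : ℕ} (K : Set (ℝ × (Fin m → ℝ))) : Set (ℝ × (Fin m → ℝ)) :=
  {p | ∃ P Q : ℝ, (P, p.2) ∈ K ∧ (Q, p.2) ∈ K ∧ p.1 = (P - Q) / 2}

/-- reflection of the first coordinate -/
def rb_refl {m : ℕ} : (ℝ × (Fin m → ℝ)) → (ℝ × (Fin m → ℝ)) := fun p => (-p.1, p.2)

lemma rb_refl_mp {m : ℕ} : MeasurePreserving (rb_refl (m := m)) volume volume := by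
  have := (Measure.measurePreserving_neg (volume : Measure ℝ)).prod
    (MeasurePreserving.id (volume : Measure (Fin m → ℝ)))
  exact this

lemma rb_refl_refl {m : ℕ} (p : ℝ × (Fin m → ℝ)) : rb_refl (rb_refl p) = p := by
  simp [rb_refl]

lemma rb_refl_cont {m : ℕ} : Continuous (rb_refl (m := m)) := by unfold rb_refl; fun_prop

/-- the reflection as a homeomorphism -/
def rb_reflH {m : ℕ} : (ℝ × (Fin m → ℝ)) ≃ₜ (ℝ × (Fin m → ℝ)) where
  toFun := rb_refl
  invFun := rb_refl
  left_inv := rb_refl_refl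
  right_inv := rb_refl_refl
  continuous_toFun := rb_refl_cont
  continuous_invFun := rb_refl_cont

lemma rb_polt_refl {m : ℕ} (K : Set (ℝ × (Fin m → ℝ))) (τ : ℝ) :
    rb_polt (rb_refl ⁻¹' K) (-τ) = rb_refl ⁻¹' (rb_polt K τ) := by
  ext u
  constructor
  · intro h y hy
    have := h (rb_refl y) (by simpa [rb_refl_refl] using hy)
    simp [rb_ip, rb_refl] at this ⊢
    linarith
  · intro h y hy
    have := h (rb_refl y) hy
    simp [rb_ip, rb_refl] at this ⊢
    linarith

/-! part 4 -/

instance rb_haar {m : ℕ} : (volume : Measure (ℝ × (Fin m → ℝ))).IsAddHaarMeasure := by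
  rw [Measure.volume_eq_prod]; infer_instance

/-- upper half of the polar -/
def rb_up {m : ℕ} (K : Set (ℝ × (Fin m → ℝ))) (τ : ℝ) : Set (ℝ × (Fin m → ℝ)) :=
  rb_polt K τ ∩ {u | 0 < u.1}

lemma rb_halfspace_meas {m : ℕ} : MeasurableSet {u : ℝ × (Fin m → ℝ) | 0 < u.1} :=
  measurableSet_lt measurable_const measurable_fst

lemma rb_up_meas {m : ℕ} (K : Set (ℝ × (Fin m → ℝ))) (τ : ℝ) : MeasurableSet (rb_up K τ) :=
  (rb_polt_closed K τ).measurableSet.inter rb_halfspace_meas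

lemma rb_up_mono {m : ℕ} (K : Set (ℝ × (Fin m → ℝ))) {τ τ' : ℝ} (h : τ ≤ τ') :
    rb_up K τ ⊆ rb_up K τ' := by
  rintro u ⟨hu, hu0⟩
  refine ⟨fun y hy => ?_, hu0⟩
  have := hu y hy
  have : τ * u.1 ≤ τ' * u.1 := mul_le_mul_of_nonneg_right h (le_of_lt hu0)
  linarith [hu y hy]

open Set in
lemma rb_up_cont {m : ℕ} {K : Set (ℝ × (Fin m → ℝ))} (hK : IsCompact K) {τ : ℝ}
    (hτ : ((τ, 0) : ℝ × (Fin m → ℝ)) ∈ interior K) :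
    ContinuousAt (fun τ => (volume (rb_up K τ)).toReal) τ := by
  have hopen : IsOpen {τ : ℝ | ((τ, 0) : ℝ × (Fin m → ℝ)) ∈ interior K} :=
    isOpen_interior.preimage (by fun_prop : Continuous fun τ : ℝ => (τ, (0 : Fin m → ℝ)))
  obtain ⟨r, hr, hball⟩ := Metric.isOpen_iff.1 hopen τ hτ
  have hτ2 : ((τ + r / 2, 0) : ℝ × (Fin m → ℝ)) ∈ interior K := by
    apply hball
    rw [Metric.mem_ball, Real.dist_eq]
    rw [show τ + r / 2 - τ = r / 2 by ring, abs_of_pos (by positivity)]; linarith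
  have hfin : volume (rb_up K (τ + r / 2)) < ⊤ :=
    (measure_mono inter_subset_left).trans_lt (rb_polt_compact hτ2).measure_lt_top
  have e : (fun τ => (volume (rb_up K τ)).toReal) =
      fun τ => ∫ u, (rb_up K τ).indicator (1 : ℝ × (Fin m → ℝ) → ℝ) u := by
    ext x
    rw [integral_indicator_one (rb_up_meas K x)]; rfl
  rw [e]
  apply continuousAt_of_dominated (bound := (rb_up K (τ + r / 2)).indicator 1)
  · refine Filter.Eventually.of_forall fun x => ?_
    exact (measurable_one.indicator (rb_up_meas K x)).aestronglyMeasurable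
  · filter_upwards [Iio_mem_nhds (show τ < τ + r / 2 by linarith)] with x hx
    refine Filter.Eventually.of_forall fun u => ?_
    by_cases hu : u ∈ rb_up K x
    · rw [indicator_of_mem hu, indicator_of_mem (rb_up_mono K (le_of_lt hx) hu)]; simp
    · rw [indicator_of_notMem hu, norm_zero]
      exact indicator_nonneg (fun _ _ => zero_le_one) _
  · rw [integrable_indicator_iff (rb_up_meas K _)]
    exact integrableOn_const hfin.ne
  · have hnull : volume (frontier (rb_polt K τ)) = 0 := (rb_polt_convex K τ).addHaar_frontier _
    have : ∀ᵐ u ∂(volume : Measure (ℝ × (Fin m → ℝ))), u ∉ frontier (rb_polt K τ) := by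
      rw [ae_iff]; simpa using hnull
    filter_upwards [this] with u hu
    by_cases hu0 : 0 < u.1
    swap
    · have : (fun x => (rb_up K x).indicator (1 : ℝ × (Fin m → ℝ) → ℝ) u) = fun _ => 0 := by
        ext x
        exact indicator_of_notMem (fun h => hu0 h.2) _
      rw [this]; exact continuousAt_const
    by_cases hin : u ∈ rb_polt K τ
    · have hinn : u ∈ interior (rb_polt K τ) := by
        by_contra h
        exact hu ⟨subset_closure hin, h⟩
      have hsm : ∀ᶠ c : ℝ in nhds 1, c • u ∈ interior (rb_polt K τ) := by
        have hcont : Continuous fun c : ℝ => c • u := by fun_prop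
        apply hcont.continuousAt.eventually
        simpa using isOpen_interior.mem_nhds hinn
      have h2 : ∃ᶠ c : ℝ in nhds 1, 1 < c := by
        have : ∀ᶠ s : ℝ in nhdsWithin 1 (Ioi 1), 1 < s := self_mem_nhdsWithin
        exact this.frequently.filter_mono nhdsWithin_le_nhds
      obtain ⟨c, hc1, hc⟩ := (h2.and_eventually hsm).exists
      have hev : ∀ᶠ x in nhds τ, (rb_up K x).indicator (1 : ℝ × (Fin m → ℝ) → ℝ) u = 1 := by
        have hx : ∀ᶠ x in nhds τ, (τ - x) * u.1 < 1 - 1 / c := by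
          have hcc : Continuous fun x : ℝ => (τ - x) * u.1 := by fun_prop
          apply hcc.continuousAt.eventually_lt continuousAt_const
          have : 1 / c < 1 := by rw [div_lt_one (by linarith)]; exact hc1
          simp only [sub_self, zero_mul]; linarith
        filter_upwards [hx] with x hx
        rw [indicator_of_mem]
        · rfl
        refine ⟨fun y hy => ?_, hu0⟩
        have h3 := interior_subset hc y hy
        rw [rb_ip_smul_left] at h3
        simp only [Prod.smul_fst, smul_eq_mul] at h3
        have h4 : c * (rb_ip u y - τ * u.1) ≤ 1 := by linarith
        rw [← le_div_iff₀' (by linarith)] at h4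
        linarith
      have := (continuousAt_const (y := (1:ℝ)) (x := τ)).congr (f := fun _ => (1:ℝ))
        (g := fun x => (rb_up K x).indicator (1 : ℝ × (Fin m → ℝ) → ℝ) u) (by
          filter_upwards [hev] with x hx; exact hx.symm)
      exact this
    · simp only [rb_polt, mem_setOf_eq, not_forall, not_le] at hin
      obtain ⟨y, hy, hin⟩ := hin
      have hev : ∀ᶠ x in nhds τ, (rb_up K x).indicator (1 : ℝ × (Fin m → ℝ) → ℝ) u = 0 := by
        have hx : ∀ᶠ x in nhds τ, 1 < rb_ip u y - x * u.1 := by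
          have hcc : Continuous fun x : ℝ => rb_ip u y - x * u.1 := by fun_prop
          exact continuousAt_const.eventually_lt hcc.continuousAt hin
        filter_upwards [hx] with x hx
        exact indicator_of_notMem (fun h => absurd (h.1 y hy) (not_le.2 hx)) _
      have := (continuousAt_const (y := (0:ℝ)) (x := τ)).congr (f := fun _ => (0:ℝ))
        (g := fun x => (rb_up K x).indicator (1 : ℝ × (Fin m → ℝ) → ℝ) u) (by
          filter_upwards [hev] with x hx; exact hx.symm)
      exact this

lemma rb_dual_repr {m : ℕ} (f : (ℝ × (Fin m → ℝ)) →ₗ[ℝ] ℝ) :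
    ∃ p : ℝ × (Fin m → ℝ), ∀ y, f y = rb_ip p y := by
  refine ⟨(f (1, 0), fun j => f (0, Pi.single j 1)), fun y => ?_⟩
  have : y = y.1 • ((1, 0) : ℝ × (Fin m → ℝ)) + ∑ j, y.2 j • ((0, Pi.single j 1) : ℝ × (Fin m → ℝ)) := by
    ext j
    · simp [Prod.fst_sum]
    · simp [Prod.snd_sum, Finset.sum_apply, Pi.single_apply]
  conv_lhs => rw [this]
  rw [map_add, map_sum]
  simp only [map_smul, smul_eq_mul, rb_ip, dotProduct]
  congr 1
  · ring
  · exact Finset.sum_congr rfl fun j _ => by ring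

open Set in
lemma rb_up_blowup {m : ℕ} {K : Set (ℝ × (Fin m → ℝ))} (hK : IsCompact K) (hconv : Convex ℝ K)
    {τ0 : ℝ} (hτ : ((τ0, 0) : ℝ × (Fin m → ℝ)) ∈ interior K) (M : ENNReal) (hM : M ≠ ⊤) :
    ∃ τ, τ0 ≤ τ ∧ ((τ, 0) : ℝ × (Fin m → ℝ)) ∈ interior K ∧ M ≤ volume (rb_up K τ) := by
  set I : Set ℝ := {τ : ℝ | ((τ, 0) : ℝ × (Fin m → ℝ)) ∈ interior K} with hI
  have hopen : IsOpen I :=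
    isOpen_interior.preimage (by fun_prop : Continuous fun τ : ℝ => (τ, (0 : Fin m → ℝ)))
  have hbdd : BddAbove I := by
    obtain ⟨B, hB⟩ := (hK.image continuous_fst).bddAbove
    exact ⟨B, fun τ hτ => hB ⟨_, interior_subset hτ, rfl⟩⟩
  have hne : I.Nonempty := ⟨τ0, hτ⟩
  set T := sSup I with hT
  have hlt : ∀ τ ∈ I, τ < T := by
    intro τ hτ
    obtain ⟨r, hr, hball⟩ := Metric.isOpen_iff.1 hopen τ hτ
    have : τ + r / 2 ∈ I := by
      apply hball
      rw [Metric.mem_ball, Real.dist_eq]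
      rw [show τ + r / 2 - τ = r / 2 by ring, abs_of_pos (by positivity)]; linarith
    have := le_csSup hbdd this
    linarith
  have hTn : ((T, 0) : ℝ × (Fin m → ℝ)) ∉ interior K := fun h => lt_irrefl _ (hlt T h)
  have hcI : Convex ℝ I := by
    intro x hx y hy a b ha hb hab
    have := hconv.interior hx hy ha hb hab
    simpa [hI] using this
  have hmemI : ∀ τ, τ0 ≤ τ → τ < T → τ ∈ I := by
    intro τ h1 h2
    obtain ⟨τ', hτ', h3⟩ := exists_lt_of_lt_csSup hne h2
    exact hcI.ordConnected.out hτ hτ' ⟨h1, h3.le⟩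
  obtain ⟨f, hf⟩ := geometric_hahn_banach_open_point hconv.interior isOpen_interior hTn
  obtain ⟨p, hp⟩ := rb_dual_repr f.toLinearMap
  have hp' : ∀ y, f y = rb_ip p y := hp
  have hsup : ∀ y ∈ K, rb_ip p y ≤ T * p.1 := by
    intro y hy
    have hcl : y ∈ closure (interior K) := by
      rw [hconv.closure_interior_eq_closure_of_nonempty_interior ⟨_, hτ⟩]
      exact subset_closure hy
    have : y ∈ {y | f y ≤ f (T, 0)} := by
      refine closure_minimal (fun a ha => (hf a ha).le) ?_ hcl
      exact isClosed_le f.continuous continuous_const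
    have : f y ≤ f (T, 0) := this
    rw [hp', hp'] at this
    simp [rb_ip] at this ⊢
    linarith
  have hp1 : 0 < p.1 := by
    have := hf _ hτ
    rw [hp', hp'] at this
    simp [rb_ip] at this
    have h2 := hlt _ hτ
    by_contra hcon
    nlinarith
  set A : Set (ℝ × (Fin m → ℝ)) := {u | 0 < u.1 ∧ ∀ y ∈ K, rb_ip u y - T * u.1 ≤ 1 / 2} with hA
  have hAsub : ∀ u ∈ A, ∃ τ, τ0 ≤ τ ∧ τ < T ∧ u ∈ rb_up K τ := by
    rintro u ⟨hu0, hu⟩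
    have hT0 := hlt _ hτ
    refine ⟨max τ0 (T - 1 / (2 * u.1)), le_max_left _ _, max_lt hT0 ?_, ?_, hu0⟩
    · have : 0 < 1 / (2 * u.1) := by positivity
      linarith
    · intro y hy
      have h1 := hu y hy
      have h2 : (T - 1 / (2 * u.1)) * u.1 ≤ max τ0 (T - 1 / (2 * u.1)) * u.1 :=
        mul_le_mul_of_nonneg_right (le_max_right _ _) hu0.le
      have h3 : (T - 1 / (2 * u.1)) * u.1 = T * u.1 - 1 / 2 := by field_simp
      linarith
  -- A has infinite volume
  have hAm : MeasurableSet A := by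
    have : A = {u | 0 < u.1} ∩ ⋂ y ∈ K, {u | rb_ip u y - T * u.1 ≤ 1 / 2} := by
      ext u; simp [hA]
    rw [this]
    apply rb_halfspace_meas.inter
    refine (isClosed_biInter fun y _ => isClosed_le ?_ continuous_const).measurableSet
    have : Continuous fun u : ℝ × (Fin m → ℝ) => rb_ip u y :=
      rb_ip_cont.comp (by fun_prop : Continuous fun u => (u, y))
    fun_prop
  have hAinf : volume A = ⊤ := by
    by_contra hfin
    obtain ⟨r, hr, hball⟩ := Metric.eventually_nhds_iff_ball.1
      (rb_polt_zero_mem hK T (c := 1 / 2) (by norm_num))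
    set c := r / p.1 with hc
    have hcp : c * p.1 = r := by rw [hc]; field_simp
    have hc0 : 0 < c := by positivity
    set S : Set (ℝ × (Fin m → ℝ)) := Metric.ball 0 r ∩ {u | 0 < u.1} with hS
    have hSopen : IsOpen S := Metric.isOpen_ball.inter (isOpen_lt continuous_const continuous_fst)
    have hSpos : 0 < volume S := by
      apply hSopen.measure_pos volume
      refine ⟨(r / 2, 0), ?_, ?_⟩
      · rw [mem_ball_zero_iff]; simp [Prod.norm_def, hr, abs_of_pos hr]
      · simp [hr]
    have hSA : S ⊆ A := fun u hu => ⟨hu.2, fun y hy => (hball u hu.1 y hy).le⟩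
    have htr : (fun u => c • p + u) '' A ⊆ A \ S := by
      rintro _ ⟨u, ⟨hu0, hu⟩, rfl⟩
      refine ⟨⟨?_, ?_⟩, ?_⟩
      · simp; rw [hcp]; positivity
      · intro y hy
        rw [rb_ip_add_left, rb_ip_smul_left]
        simp only [Prod.fst_add, Prod.smul_fst, smul_eq_mul]
        have h1 := hu y hy
        have h2 := mul_le_mul_of_nonneg_left (hsup y hy) hc0.le
        linarith
      · rintro ⟨h1, -⟩
        rw [mem_ball_zero_iff, Prod.norm_def, sup_lt_iff] at h1
        have h2 := h1.1
        simp only [Prod.fst_add, Prod.smul_fst, smul_eq_mul, hcp, Real.norm_eq_abs] at h2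
        have := le_abs_self (r + u.1)
        linarith
    have h1 := measure_mono (μ := volume) htr
    rw [image_add_left, measure_preimage_add, measure_diff hSA hSopen.measurableSet.nullMeasurableSet
      ((measure_mono hSA).trans_lt (lt_top_iff_ne_top.2 hfin)).ne] at h1
    have h3 : volume A ≠ 0 := (hSpos.trans_le (measure_mono hSA)).ne'
    exact absurd h1 (not_le.2 (ENNReal.sub_lt_self hfin h3 hSpos.ne'))
  -- exhaust
  have hT0 := hlt _ hτ
  set tk : ℕ → ℝ := fun k => T - (T - τ0) / (k + 1) with htk
  have htk0 : ∀ k, τ0 ≤ tk k := by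
    intro k
    have : (T - τ0) / (k + 1) ≤ T - τ0 := div_le_self (by linarith) (by linarith [Nat.cast_nonneg (α := ℝ) k])
    simp only [htk]; linarith
  have htk1 : ∀ k, tk k < T := by
    intro k
    have : 0 < (T - τ0) / ((k:ℝ) + 1) := div_pos (by linarith) (by positivity)
    simp only [htk]; linarith
  have hmono : Monotone fun k => rb_up K (tk k) := by
    intro k l hkl
    apply rb_up_mono
    simp only [htk]
    have : (k:ℝ) ≤ l := by exact_mod_cast hkl
    have : (T - τ0) / ((l:ℝ) + 1) ≤ (T - τ0) / (k + 1) :=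
      div_le_div_of_nonneg_left (by linarith) (by positivity) (by linarith)
    linarith
  have hcover : A ⊆ ⋃ k, rb_up K (tk k) := by
    intro u hu
    obtain ⟨τ, h1, h2, h3⟩ := hAsub u hu
    obtain ⟨k, hk⟩ := exists_nat_gt ((T - τ0) / (T - τ))
    refine mem_iUnion.2 ⟨k, rb_up_mono K ?_ h3⟩
    have h4 : 0 < T - τ := by linarith
    rw [div_lt_iff₀ h4] at hk
    have h5 : (T - τ0) / ((k:ℝ) + 1) ≤ T - τ := by
      rw [div_le_iff₀ (by positivity)]; nlinarith
    simp only [htk]; linarith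
  have htend := tendsto_measure_iUnion_atTop (μ := volume) hmono
  have htop : volume (⋃ k, rb_up K (tk k)) = ⊤ := top_le_iff.1 (hAinf ▸ measure_mono hcover)
  rw [htop] at htend
  obtain ⟨k, hk⟩ := (htend.eventually (lt_mem_nhds (lt_top_iff_ne_top.2 hM))).exists
  exact ⟨tk k, htk0 k, hmemI _ (htk0 k) (htk1 k), hk.le⟩

/-! part 5 -/

lemma rb_refl_vol {m : ℕ} (A : Set (ℝ × (Fin m → ℝ))) (hA : MeasurableSet A) :
    volume (rb_refl ⁻¹' A) = volume A :=
  rb_refl_mp.measure_preimage hA.nullMeasurableSet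

lemma rb_refl_int {m : ℕ} {K : Set (ℝ × (Fin m → ℝ))} {τ : ℝ} :
    ((-τ, 0) : ℝ × (Fin m → ℝ)) ∈ interior (rb_refl ⁻¹' K) ↔
    ((τ, 0) : ℝ × (Fin m → ℝ)) ∈ interior K := by
  have : interior (rb_refl ⁻¹' K) = rb_refl ⁻¹' (interior K) :=
    ((rb_reflH (m := m)).preimage_interior K).symm
  rw [this]; simp [rb_refl]

lemma rb_refl_convex {m : ℕ} {K : Set (ℝ × (Fin m → ℝ))} (h : Convex ℝ K) :
    Convex ℝ (rb_refl ⁻¹' K) := by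
  intro x hx y hy a b ha hb hab
  have := h hx hy ha hb hab
  simp only [Set.mem_preimage]
  convert this using 1
  simp [rb_refl]; ring

lemma rb_refl_compact {m : ℕ} {K : Set (ℝ × (Fin m → ℝ))} (h : IsCompact K) :
    IsCompact (rb_refl ⁻¹' K) := (rb_reflH (m := m)).isCompact_preimage.2 h

lemma rb_balance {m : ℕ} {K : Set (ℝ × (Fin m → ℝ))} (hK : IsCompact K) (hconv : Convex ℝ K)
    {τ0 : ℝ} (hτ : ((τ0, 0) : ℝ × (Fin m → ℝ)) ∈ interior K) :
    ∃ τ, ((τ, 0) : ℝ × (Fin m → ℝ)) ∈ interior K ∧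
      volume (rb_up K τ) = volume (rb_up (rb_refl ⁻¹' K) (-τ)) := by
  set K' := rb_refl ⁻¹' K with hK'
  have fin : ∀ {L : Set (ℝ × (Fin m → ℝ))} {τ : ℝ}, ((τ, 0) : ℝ × (Fin m → ℝ)) ∈ interior L →
      volume (rb_up L τ) ≠ ⊤ := fun h =>
    ((measure_mono Set.inter_subset_left).trans_lt (rb_polt_compact h).measure_lt_top).ne
  have hI : IsPreconnected {τ : ℝ | ((τ, 0) : ℝ × (Fin m → ℝ)) ∈ interior K} := by
    apply Convex.isPreconnected
    intro x hx y hy a b ha hb hab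
    have := hconv.interior hx hy ha hb hab
    simpa using this
  have hcont : ContinuousOn (fun τ => (volume (rb_up K τ)).toReal -
      (volume (rb_up K' (-τ))).toReal) {τ : ℝ | ((τ, 0) : ℝ × (Fin m → ℝ)) ∈ interior K} := by
    intro τ hτ
    apply ContinuousAt.continuousWithinAt
    refine (rb_up_cont hK hτ).sub ?_
    exact (rb_up_cont (rb_refl_compact hK) (rb_refl_int.2 hτ)).comp continuousAt_neg
  obtain ⟨τ1, h1, hi1, hv1⟩ := rb_up_blowup hK hconv hτ (volume (rb_up K' (-τ0)))
    (fin (rb_refl_int.2 hτ))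
  obtain ⟨τ2, h2, hi2, hv2⟩ := rb_up_blowup (rb_refl_compact hK) (rb_refl_convex hconv)
    (rb_refl_int.2 hτ) (volume (rb_up K τ0)) (fin hτ)
  have hi2' : ((-τ2, 0) : ℝ × (Fin m → ℝ)) ∈ interior K := by
    rw [← rb_refl_int, neg_neg]; exact hi2
  have := hI.intermediate_value hi2' hi1 hcont
  obtain ⟨τ, hτI, hτ0⟩ := this (show (0:ℝ) ∈ Set.Icc _ _ by
    constructor
    · simp only [neg_neg, sub_nonpos]
      apply ENNReal.toReal_mono (fin hi2)
      exact (measure_mono (rb_up_mono K (by linarith))).trans hv2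
    · simp only [sub_nonneg]
      apply ENNReal.toReal_mono (fin hi1)
      exact (measure_mono (rb_up_mono K' (by linarith))).trans hv1)
  refine ⟨τ, hτI, ?_⟩
  simp only [sub_eq_zero] at hτ0
  exact (ENNReal.toReal_eq_toReal_iff' (fin hτI) (fin (rb_refl_int.2 hτI))).1 hτ0

lemma rb_vol_split {m : ℕ} (L : Set (ℝ × (Fin m → ℝ))) (hL : MeasurableSet L) :
    volume L = volume (L ∩ {u | 0 < u.1}) + volume (rb_refl ⁻¹' L ∩ {u | 0 < u.1}) := by
  have h1 : rb_refl ⁻¹' L ∩ {u | 0 < u.1} = rb_refl ⁻¹' (L ∩ {u | u.1 < 0}) := by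
    ext u; simp [rb_refl]
  have hm : MeasurableSet {u : ℝ × (Fin m → ℝ) | u.1 < 0} :=
    measurableSet_lt measurable_fst measurable_const
  rw [h1, rb_refl_vol _ (hL.inter hm), ← measure_inter_add_diff L (rb_halfspace_meas (m := m))]
  congr 1
  have hnull : volume {u : ℝ × (Fin m → ℝ) | u.1 = 0} = 0 := by
    have : {u : ℝ × (Fin m → ℝ) | u.1 = 0} = ({0} : Set ℝ) ×ˢ Set.univ := by
      ext u; simp
    rw [this, Measure.volume_eq_prod, Measure.prod_prod]; simp
  apply measure_congr
  have : ∀ᵐ u ∂(volume : Measure (ℝ × (Fin m → ℝ))), u.1 ≠ 0 := by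
    rw [ae_iff]; simpa using hnull
  filter_upwards [this] with u hu
  apply propext
  show (u ∈ L ∧ ¬ 0 < u.1) ↔ (u ∈ L ∧ u.1 < 0)
  constructor
  · rintro ⟨a, b⟩; exact ⟨a, lt_of_le_of_ne (not_lt.1 b) hu⟩
  · rintro ⟨a, b⟩; exact ⟨a, not_lt.2 b.le⟩

lemma rb_up_refl {m : ℕ} (K : Set (ℝ × (Fin m → ℝ))) (τ : ℝ) :
    rb_up (rb_refl ⁻¹' K) (-τ) = rb_refl ⁻¹' (rb_polt K τ) ∩ {u | 0 < u.1} := by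
  rw [rb_up, rb_polt_refl]

lemma rb_St_polt_refl {m : ℕ} (K : Set (ℝ × (Fin m → ℝ))) :
    rb_refl ⁻¹' (rb_polt (rb_St K) 0) = rb_polt (rb_St K) 0 := by
  have h : rb_refl ⁻¹' (rb_St K) = rb_St K := by
    ext p
    constructor
    · rintro ⟨P, Q, hP, hQ, h⟩
      refine ⟨Q, P, hQ, hP, ?_⟩
      simp [rb_refl] at h; linarith
    · rintro ⟨P, Q, hP, hQ, h⟩
      refine ⟨Q, P, hQ, hP, ?_⟩
      simp [rb_refl]; linarith
  rw [← rb_polt_refl, h, neg_zero]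

lemma rb_St_incl {m : ℕ} {K : Set (ℝ × (Fin m → ℝ))} {τ s s' : ℝ} (hs : 0 < s) (hs' : 0 < s')
    {u u' : Fin m → ℝ} (hu : (s, u) ∈ rb_polt K τ) (hu' : (-s', u') ∈ rb_polt K τ) :
    (2 * s * s' / (s + s'), (s' / (s + s')) • u + (s / (s + s')) • u') ∈ rb_polt (rb_St K) 0 := by
  rintro ⟨p, y⟩ ⟨P, Q, hP, hQ, hp⟩
  have h1 := hu _ hP
  have h2 := hu' _ hQ
  simp only [rb_ip, add_dotProduct, smul_dotProduct, smul_eq_mul, zero_mul, sub_zero] at *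
  subst hp
  have h3 : 0 < s + s' := by linarith
  have e : 2 * s * s' / (s + s') * ((P - Q) / 2) +
      (s' / (s + s') * (u ⬝ᵥ y) + s / (s + s') * (u' ⬝ᵥ y)) =
      (s' * (s * P + u ⬝ᵥ y) + s * (-s' * Q + u' ⬝ᵥ y)) / (s + s') := by
    field_simp; ring
  rw [e, div_le_one h3]
  nlinarith [mul_le_mul_of_nonneg_left h1 hs'.le, mul_le_mul_of_nonneg_left h2 hs.le]

open Set in
lemma rb_St_vol {m : ℕ} {K : Set (ℝ × (Fin m → ℝ))} (hK : IsCompact K) {τ : ℝ}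
    (hτ : ((τ, 0) : ℝ × (Fin m → ℝ)) ∈ interior K)
    (hbal : volume (rb_up K τ) = volume (rb_up (rb_refl ⁻¹' K) (-τ))) :
    volume (rb_polt K τ) ≤ volume (rb_polt (rb_St K) 0) := by
  set L := rb_polt K τ with hL
  set L' := rb_polt (rb_refl ⁻¹' K) (-τ) with hL'
  set M := rb_polt (rb_St K) 0 with hM
  have hMm : MeasurableSet M := (rb_polt_closed _ _).measurableSet
  have hLm : MeasurableSet L := (rb_polt_closed _ _).measurableSet
  rw [rb_vol_split L hLm, rb_vol_split M hMm, rb_St_polt_refl, hL, ← rb_up_refl, ← rb_up, ← hbal]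
  suffices h : volume (rb_up K τ) ≤ volume (M ∩ {u | 0 < u.1}) by gcongr
  have hLc : IsCompact L := rb_polt_compact hτ
  have hLc' : IsCompact L' := rb_polt_compact (rb_refl_int.2 hτ)
  obtain ⟨b, hb, hc, hp, hi, -, -, hv⟩ := rb_half hLc (rb_polt_convex _ _) (rb_polt_int hK τ)
  obtain ⟨b', hb', hc', hp', hi', -, -, hv'⟩ := rb_half hLc' (rb_polt_convex _ _)
    (rb_polt_int (rb_refl_compact hK) (-τ))
  obtain ⟨hF, t, ht, htd, htm, -⟩ := rb_transport hb hc hp hi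
  obtain ⟨hF', t', ht', htd', htm', -⟩ := rb_transport hb' hc' hp' hi'
  set F := ∫ x in (0:ℝ)..b, (rb_sl L x).toReal with hFdef
  have hFF : (∫ x in (0:ℝ)..b', (rb_sl L' x).toReal) = F := by
    have : ENNReal.ofReal (∫ x in (0:ℝ)..b', (rb_sl L' x).toReal) = ENNReal.ofReal F := by
      rw [hv', hv]; exact hbal.symm
    exact (ENNReal.ofReal_eq_ofReal_iff hF'.le hF.le).1 this
  rw [hFF] at htd' ht' hF'
  have hup : volume (rb_up K τ) = ENNReal.ofReal F := hv.symm
  rw [hup]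
  have hMvol : volume (M ∩ {u | 0 < u.1}) = ∫⁻ s in Ioi 0, rb_sl M s := by
    rw [Measure.volume_eq_prod, Measure.prod_apply (hMm.inter rb_halfspace_meas),
      ← lintegral_indicator measurableSet_Ioi]
    congr 1
    ext s
    by_cases hs : s ∈ Ioi (0:ℝ)
    · rw [indicator_of_mem hs]
      unfold rb_sl
      congr 1
      ext y
      simp only [mem_preimage, mem_inter_iff, mem_setOf_eq]
      exact and_iff_left hs
    · rw [indicator_of_notMem hs]
      convert measure_empty (μ := (volume : Measure (Fin m → ℝ)))
      ext y
      simp only [mem_preimage, mem_inter_iff, mem_setOf_eq, mem_empty_iff_false, iff_false]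
      rintro ⟨h1, h2⟩
      exact hs h2
  rw [hMvol]
  set σ : ℝ → ℝ := fun θ => 2 * t θ * t' θ / (t θ + t' θ) with hσ
  set σ' : ℝ → ℝ := fun θ => 2 * ((t' θ / (t θ + t' θ)) ^ 2 * (F / (rb_sl L (t θ)).toReal) +
    (t θ / (t θ + t' θ)) ^ 2 * (F / (rb_sl L' (t' θ)).toReal)) with hσ'
  have hder : ∀ θ ∈ Ioo (0:ℝ) 1, HasDerivWithinAt σ (σ' θ) (Ioo 0 1) θ := by
    intro θ hθ
    have p1 := (ht θ hθ).1.1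
    have p2 := (ht' θ hθ).1.1
    have h1 := htd θ hθ
    have h2 := htd' θ hθ
    have h3 := ((h1.const_mul 2).mul h2).div (h1.add h2) (by simp only [Pi.add_apply]; positivity)
    refine (h3.congr_deriv ?_).hasDerivWithinAt
    simp only [hσ', Pi.add_apply, Pi.mul_apply]
    field_simp
    ring
  have hmonoσ : StrictMonoOn σ (Ioo 0 1) := by
    intro x hx y hy hxy
    have a1 := (ht x hx).1.1
    have a2 := (ht' x hx).1.1
    have a3 := (ht y hy).1.1
    have a4 := (ht' y hy).1.1
    have l1 := htm hx hy hxy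
    have l2 := htm' hx hy hxy
    simp only [hσ]
    rw [div_lt_div_iff₀ (by positivity) (by positivity)]
    have e1 : t x * t' x * (t y) < t x * t y * t' y := by
      have : t' x * t y < t' y * t y := by nlinarith
      nlinarith
    have e2 : t x * t' x * (t' y) < t y * t' y * t' x := by
      have : t x * t' x < t y * t' x := by nlinarith
      nlinarith
    nlinarith
  have hcov := lintegral_image_eq_lintegral_abs_deriv_mul measurableSet_Ioo hder hmonoσ.injOn
    (rb_sl M)
  have hsub : σ '' Ioo 0 1 ⊆ Ioi 0 := by
    rintro _ ⟨θ, hθ, rfl⟩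
    have p1 := (ht θ hθ).1.1
    have p2 := (ht' θ hθ).1.1
    simp only [hσ, mem_Ioi]; positivity
  calc ENNReal.ofReal F = ∫⁻ θ in Ioo (0:ℝ) 1, ENNReal.ofReal F := by
        simp
    _ ≤ ∫⁻ θ in Ioo (0:ℝ) 1, ENNReal.ofReal |σ' θ| * rb_sl M (σ θ) := by
        refine setLIntegral_mono_ae' measurableSet_Ioo (Filter.Eventually.of_forall fun θ hθ => ?_)
        have p1 := (ht θ hθ).1.1
        have p2 := (ht' θ hθ).1.1
        have f1 := hp _ (ht θ hθ).1
        have f2 := hp' _ (ht' θ hθ).1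
        set α := t' θ / (t θ + t' θ) with hα
        set β := t θ / (t θ + t' θ) with hβ
        have hα0 : 0 < α := by positivity
        have hβ0 : 0 < β := by positivity
        have hαβ : α + β = 1 := by rw [hα, hβ]; field_simp; ring
        have hbm : rb_sl L (t θ) ^ α * rb_sl L' (t' θ) ^ β ≤ rb_sl M (σ θ) := by
          apply rb_bm_set hα0 hβ0 hαβ
          · exact measurable_prodMk_left hLm
          · exact measurable_prodMk_left (rb_polt_closed _ _).measurableSet
          · exact measurable_prodMk_left hMm
          · intro x hx y hy
            apply rb_St_incl p1 p2 hx
            rw [mem_setOf_eq, hL', rb_polt_refl] at hy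
            exact hy
        refine le_trans ?_ (mul_le_mul_right hbm _)
        have ha := rb_amgm_half f1 f2 hα0 hβ0 hαβ
        rw [← ENNReal.ofReal_toReal (rb_sl_lt_top hLc (t θ)).ne,
          ← ENNReal.ofReal_toReal (rb_sl_lt_top hLc' (t' θ)).ne,
          ENNReal.ofReal_rpow_of_pos f1, ENNReal.ofReal_rpow_of_pos f2,
          ← ENNReal.ofReal_mul (by positivity), ← ENNReal.ofReal_mul (by positivity)]
        apply ENNReal.ofReal_le_ofReal
        refine le_trans ?_ (mul_le_mul_of_nonneg_right (le_abs_self _) (by positivity))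
        simp only [hσ']
        calc F = 2 * F * (1 / 2) := by ring
          _ ≤ 2 * F * _ := mul_le_mul_of_nonneg_left ha (by positivity)
          _ = _ := by rw [← hα, ← hβ]; ring
    _ = ∫⁻ s in σ '' Ioo 0 1, rb_sl M s := hcov.symm
    _ ≤ _ := lintegral_mono_set hsub

lemma rb_ST {m : ℕ} {K : Set (ℝ × (Fin m → ℝ))} (hK : IsCompact K) (hconv : Convex ℝ K)
    {τ0 : ℝ} (hτ : ((τ0, 0) : ℝ × (Fin m → ℝ)) ∈ interior K) :
    ∃ τ, ((τ, 0) : ℝ × (Fin m → ℝ)) ∈ interior K ∧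
      volume (rb_polt K τ) ≤ volume (rb_polt (rb_St K) 0) := by
  obtain ⟨τ, h1, h2⟩ := rb_balance hK hconv hτ
  exact ⟨τ, h1, rb_St_vol hK h1 h2⟩

/-! part 6 -/

lemma rb_St_compact {m : ℕ} {K : Set (ℝ × (Fin m → ℝ))} (hK : IsCompact K) :
    IsCompact (rb_St K) := by
  have h1 : IsCompact ((K ×ˢ K) ∩ {x : (ℝ × (Fin m → ℝ)) × (ℝ × (Fin m → ℝ)) | x.1.2 = x.2.2}) :=
    (hK.prod hK).inter_right (isClosed_eq (by fun_prop) (by fun_prop))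
  have h2 := h1.image (f := fun x : (ℝ × (Fin m → ℝ)) × (ℝ × (Fin m → ℝ)) =>
    ((x.1.1 - x.2.1) / 2, x.1.2)) (by fun_prop)
  convert h2 using 1
  ext p
  constructor
  · rintro ⟨P, Q, hP, hQ, h⟩
    exact ⟨((P, p.2), (Q, p.2)), ⟨⟨hP, hQ⟩, rfl⟩, by ext <;> simp [h]⟩
  · rintro ⟨⟨⟨P, y⟩, ⟨Q, y'⟩⟩, ⟨⟨hP, hQ⟩, h⟩, rfl⟩
    simp only [Set.mem_setOf_eq] at h
    subst h
    exact ⟨P, Q, hP, hQ, rfl⟩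

lemma rb_St_convex {m : ℕ} {K : Set (ℝ × (Fin m → ℝ))} (hK : Convex ℝ K) :
    Convex ℝ (rb_St K) := by
  rintro p ⟨P, Q, hP, hQ, h⟩ p' ⟨P', Q', hP', hQ', h'⟩ a b ha hb hab
  refine ⟨a * P + b * P', a * Q + b * Q', ?_, ?_, ?_⟩
  · simpa using hK hP hP' ha hb hab
  · simpa using hK hQ hQ' ha hb hab
  · simp [h, h']; ring

lemma rb_fibre_eq {m : ℕ} {K : Set (ℝ × (Fin m → ℝ))} (hK : IsCompact K) (hconv : Convex ℝ K)
    (y : Fin m → ℝ) : volume {s : ℝ | (s, y) ∈ rb_St K} = volume {s : ℝ | (s, y) ∈ K} := by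
  set I : Set ℝ := {s : ℝ | (s, y) ∈ K} with hI
  have hIcl : IsClosed I := hK.isClosed.preimage (by fun_prop : Continuous fun s : ℝ => (s, y))
  have hIc : IsCompact I := by
    apply (hK.image continuous_fst).of_isClosed_subset hIcl
    intro s hs; exact ⟨_, hs, rfl⟩
  have hIconv : Convex ℝ I := by
    intro s hs t ht a b ha hb hab
    have := hconv hs ht ha hb hab
    have e : a • (s, y) + b • (t, y) = (a • s + b • t, y) := by
      ext
      · simp
      · simp [← add_mul, hab]
    rw [e] at this; exact this
  by_cases hne : I.Nonempty
  · obtain ⟨x0, hx0, hx0'⟩ := hIc.exists_isGreatest hne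
    obtain ⟨y0, hy0, hy0'⟩ := hIc.exists_isLeast hne
    have hIcc : I = Set.Icc y0 x0 := by
      apply Set.Subset.antisymm
      · intro s hs; exact ⟨hy0' hs, hx0' hs⟩
      · exact hIconv.ordConnected.out hy0 hx0
    have hS : {s : ℝ | (s, y) ∈ rb_St K} = Set.Icc (-((x0 - y0) / 2)) ((x0 - y0) / 2) := by
      ext s
      constructor
      · rintro ⟨P, Q, hP, hQ, h⟩
        have hP' : P ∈ I := hP
        have hQ' : Q ∈ I := hQ
        rw [hIcc] at hP' hQ'
        simp only at h
        constructor <;> linarith [hP'.1, hP'.2, hQ'.1, hQ'.2]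
      · rintro ⟨h1, h2⟩
        have hP : (x0 + y0) / 2 + s ∈ I := by
          rw [hIcc]; constructor <;> linarith
        have hQ : (x0 + y0) / 2 - s ∈ I := by
          rw [hIcc]; constructor <;> linarith
        exact ⟨_, _, hP, hQ, by simp⟩
    rw [hS, hIcc, Real.volume_Icc, Real.volume_Icc]
    congr 1; ring
  · rw [Set.not_nonempty_iff_eq_empty] at hne
    have : {s : ℝ | (s, y) ∈ rb_St K} = ∅ := by
      ext s
      simp only [Set.mem_setOf_eq, Set.mem_empty_iff_false, iff_false]
      rintro ⟨P, Q, hP, hQ, h⟩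
      have : P ∈ I := hP
      rw [hne] at this; exact this
    rw [this, hne]

lemma rb_St_marg {m : ℕ} {K : Set (ℝ × (Fin m → ℝ))} (hK : IsCompact K) (hconv : Convex ℝ K)
    {A : Set (Fin m → ℝ)} (hA : MeasurableSet A) :
    volume (rb_St K ∩ {p | p.2 ∈ A}) = volume (K ∩ {p | p.2 ∈ A}) := by
  have hAm : MeasurableSet {p : ℝ × (Fin m → ℝ) | p.2 ∈ A} := measurable_snd hA
  rw [Measure.volume_eq_prod, Measure.prod_apply_symm ((rb_St_compact hK).measurableSet.inter hAm),
    Measure.prod_apply_symm (hK.measurableSet.inter hAm)]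
  congr 1
  ext y
  by_cases hy : y ∈ A
  · have := rb_fibre_eq hK hconv y
    convert this using 2 <;> (ext s; simp [hy])
  · congr 1
    ext s; simp [hy]

lemma rb_St_int {m : ℕ} {K : Set (ℝ × (Fin m → ℝ))} (hK : IsCompact K) (hconv : Convex ℝ K)
    (hne : (interior K).Nonempty) : (interior (rb_St K)).Nonempty := by
  have h1 := rb_St_marg hK hconv (MeasurableSet.univ (α := Fin m → ℝ))
  simp only [Set.mem_univ, Set.setOf_true, Set.inter_univ] at h1
  have h2 : 0 < volume K :=
    (isOpen_interior.measure_pos volume hne).trans_le (measure_mono interior_subset)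
  by_contra hcon
  rw [Set.not_nonempty_iff_eq_empty] at hcon
  have h3 := (rb_St_convex hconv).addHaar_frontier (volume : Measure (ℝ × (Fin m → ℝ)))
  rw [frontier, hcon, Set.diff_empty, (rb_St_compact hK).isClosed.closure_eq, h1] at h3
  exact h2.ne' h3

/-- polar w.r.t. point z (translated) in the product -/
def rb_polp {m : ℕ} (K : Set (ℝ × (Fin m → ℝ))) (z : ℝ × (Fin m → ℝ)) :
    Set (ℝ × (Fin m → ℝ)) := {u | ∀ y ∈ K, rb_ip u (y - z) ≤ 1}

lemma rb_interior_translate {m : ℕ} {K : Set (ℝ × (Fin m → ℝ))} (c p : ℝ × (Fin m → ℝ)) :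
    p ∈ interior ((fun q => q + c) ⁻¹' K) ↔ p + c ∈ interior K := by
  have := ((Homeomorph.addRight c).preimage_interior K)
  have h2 : interior ((fun q => q + c) ⁻¹' K) = (fun q => q + c) ⁻¹' interior K := this.symm
  rw [h2]; rfl

lemma rb_ST' {m : ℕ} {K : Set (ℝ × (Fin m → ℝ))} (hK : IsCompact K) (hconv : Convex ℝ K)
    (hne : (interior K).Nonempty) (y' : Fin m → ℝ)
    (hy : ((0, y') : ℝ × (Fin m → ℝ)) ∈ interior (rb_St K)) :
    ∃ τ, ((τ, y') : ℝ × (Fin m → ℝ)) ∈ interior K ∧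
      volume (rb_polp K (τ, y')) ≤ volume (rb_polp (rb_St K) (0, y')) := by
  set c : ℝ × (Fin m → ℝ) := (0, y') with hc
  set K2 := (fun q => q + c) ⁻¹' K with hK2
  have hK2c : IsCompact K2 := (Homeomorph.addRight c).isCompact_preimage.2 hK
  have hK2v : Convex ℝ K2 := hconv.translate_preimage_left c
  have hSt : rb_St K2 = (fun q => q + c) ⁻¹' rb_St K := by
    ext p
    constructor
    · rintro ⟨P, Q, hP, hQ, h⟩
      refine ⟨P, Q, ?_, ?_, ?_⟩
      · simpa [hK2, hc] using hP
      · simpa [hK2, hc] using hQ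
      · simp [h, hc]
    · rintro ⟨P, Q, hP, hQ, h⟩
      refine ⟨P, Q, ?_, ?_, ?_⟩
      · simpa [hK2, hc] using hP
      · simpa [hK2, hc] using hQ
      · simpa [hc] using h
  -- an interior point in the fibre
  have hex : ∃ τ0 : ℝ, ((τ0, 0) : ℝ × (Fin m → ℝ)) ∈ interior K2 := by
    obtain ⟨q, hq⟩ := hne
    have hq2 : q - c ∈ interior K2 := by
      rw [hK2, rb_interior_translate]; simpa using hq
    have h0 : (0 : ℝ × (Fin m → ℝ)) ∈ interior (rb_St K2) := by
      rw [hSt, rb_interior_translate]; simpa using hy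
    have hev : ∀ᶠ ε : ℝ in nhds 0, (0, -ε • (q - c).2) ∈ interior (rb_St K2) := by
      have hcont : Continuous fun ε : ℝ => ((0 : ℝ), -ε • (q - c).2) := by fun_prop
      apply hcont.continuousAt.eventually
      have e0 : ((0 : ℝ), -(0:ℝ) • (q - c).2) = 0 := by simp
      have e1 := isOpen_interior.mem_nhds h0
      rw [← e0] at e1; exact e1
    have h2 : ∃ᶠ ε : ℝ in nhds 0, 0 < ε := by
      have : ∀ᶠ s : ℝ in nhdsWithin 0 (Set.Ioi 0), 0 < s := self_mem_nhdsWithin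
      exact this.frequently.filter_mono nhdsWithin_le_nhds
    obtain ⟨ε, hε, hmem⟩ := (h2.and_eventually hev).exists
    obtain ⟨P, Q, hP, -, -⟩ := interior_subset hmem
    have := hK2v.combo_interior_closure_mem_interior hq2 (subset_closure hP)
      (a := ε / (1 + ε)) (b := 1 / (1 + ε)) (by positivity) (by positivity) (by field_simp; ring)
    refine ⟨ε / (1 + ε) * (q - c).1 + 1 / (1 + ε) * P, ?_⟩
    convert this using 1
    ext j
    · simp
    · simp; field_simp; ring
  obtain ⟨τ0, hτ0⟩ := hex
  obtain ⟨τ, hτ, hv⟩ := rb_ST hK2c hK2v hτ0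
  refine ⟨τ, ?_, ?_⟩
  · rw [hK2, rb_interior_translate] at hτ
    simpa [hc] using hτ
  · have e1 : rb_polp K (τ, y') = rb_polt K2 τ := by
      ext u
      constructor
      · intro h y hy
        have := h _ hy
        simp [rb_ip, hc] at this ⊢
        linarith
      · intro h y hy
        have := h (y - c) (by simpa [hK2] using hy)
        simp [rb_ip, hc] at this ⊢
        linarith
    have e2 : rb_polp (rb_St K) c = rb_polt (rb_St K2) 0 := by
      rw [hSt]
      ext u
      constructor
      · intro h y hy
        have := h _ hy
        simp [rb_ip, hc] at this ⊢
        linarith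
      · intro h y hy
        have := h (y - c) (by simpa using hy)
        simp [rb_ip, hc] at this ⊢
        linarith
    rw [e1, e2]; exact hv

/-- splitting off coordinate i -/
def rb_e {m : ℕ} (i : Fin (m + 1)) : (Fin (m + 1) → ℝ) ≃ₜ ℝ × (Fin m → ℝ) where
  toFun x := (x i, fun j => x (i.succAbove j))
  invFun p := i.insertNth p.1 p.2
  left_inv x := Fin.insertNth_self_removeNth i x
  right_inv p := by ext <;> simp
  continuous_toFun := by fun_prop
  continuous_invFun := by
    refine continuous_pi fun j => ?_
    refine Fin.succAboveCases i ?_ (fun k => ?_) j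
    · simp; fun_prop
    · simp; fun_prop

lemma rb_e_fst {m : ℕ} (i : Fin (m + 1)) (x : Fin (m + 1) → ℝ) : (rb_e i x).1 = x i := rfl

lemma rb_e_snd {m : ℕ} (i : Fin (m + 1)) (x : Fin (m + 1) → ℝ) (j : Fin m) :
    (rb_e i x).2 j = x (i.succAbove j) := rfl

lemma rb_e_mp {m : ℕ} (i : Fin (m + 1)) : MeasurePreserving (rb_e (m := m) i) volume volume :=
  volume_preserving_piFinSuccAbove (fun _ => ℝ) i

lemma rb_e_ip {m : ℕ} (i : Fin (m + 1)) (x y : Fin (m + 1) → ℝ) :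
    rb_ip (rb_e i x) (rb_e i y) = x ⬝ᵥ y := by
  simp [rb_ip, rb_e_fst, rb_e_snd, dotProduct, Fin.sum_univ_succAbove _ i]

lemma rb_e_symm {m : ℕ} (i : Fin (m + 1)) (x : Fin (m + 1) → ℝ) (P : ℝ) :
    (rb_e i).symm (P, (rb_e i x).2) = Function.update x i P := by
  have h := Fin.insertNth_removeNth (α := fun _ => ℝ) i P x
  exact h

lemma rb_e_vol {m : ℕ} (i : Fin (m + 1)) (A : Set (ℝ × (Fin m → ℝ))) :
    volume (rb_e i ⁻¹' A) = volume A :=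
  (rb_e_mp i).measure_preimage_equiv (f := (rb_e i).toMeasurableEquiv) A

/-- Steiner symmetral in coordinate i -/
def rb_Stv {m : ℕ} (i : Fin (m + 1)) (K : Set (Fin (m + 1) → ℝ)) : Set (Fin (m + 1) → ℝ) :=
  {x | ∃ P Q : ℝ, Function.update x i P ∈ K ∧ Function.update x i Q ∈ K ∧ x i = (P - Q) / 2}

lemma rb_Stv_eq {m : ℕ} (i : Fin (m + 1)) (K : Set (Fin (m + 1) → ℝ)) :
    rb_Stv i K = rb_e i ⁻¹' (rb_St ((rb_e i).symm ⁻¹' K)) := by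
  ext x
  simp only [rb_Stv, rb_St, Set.mem_preimage, Set.mem_setOf_eq, rb_e_symm]
  rfl

/-- translated polar -/
def rb_pol {n : ℕ} (K : Set (Fin n → ℝ)) (z : Fin n → ℝ) : Set (Fin n → ℝ) :=
  {u | ∀ y ∈ K, u ⬝ᵥ (y - z) ≤ 1}

lemma rb_e_sub {m : ℕ} (i : Fin (m + 1)) (x y : Fin (m + 1) → ℝ) :
    rb_e i (x - y) = rb_e i x - rb_e i y := rfl

lemma rb_pol_eq {m : ℕ} (i : Fin (m + 1)) (K : Set (Fin (m + 1) → ℝ)) (z : Fin (m + 1) → ℝ) :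
    rb_pol K z = rb_e i ⁻¹' (rb_polp ((rb_e i).symm ⁻¹' K) (rb_e i z)) := by
  ext u
  constructor
  · intro h y hy
    have := h _ hy
    rw [← rb_e_ip i, rb_e_sub, Homeomorph.apply_symm_apply] at this
    exact this
  · intro h y hy
    have := h (rb_e i y) (by simpa using hy)
    rw [← rb_e_ip i, rb_e_sub]; exact this

lemma rb_e_convex {m : ℕ} (i : Fin (m + 1)) {K : Set (Fin (m + 1) → ℝ)} (h : Convex ℝ K) :
    Convex ℝ ((rb_e i).symm ⁻¹' K) := by
  intro x hx y hy a b ha hb hab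
  have := h hx hy ha hb hab
  simp only [Set.mem_preimage] at *
  convert this using 1
  rw [Homeomorph.symm_apply_eq]
  have e : rb_e i (a • (rb_e i).symm x + b • (rb_e i).symm y) =
    a • rb_e i ((rb_e i).symm x) + b • rb_e i ((rb_e i).symm y) := rfl
  rw [e]; simp

lemma rb_e_convex' {m : ℕ} (i : Fin (m + 1)) {K : Set (ℝ × (Fin m → ℝ))} (h : Convex ℝ K) :
    Convex ℝ (rb_e i ⁻¹' K) := by
  intro x hx y hy a b ha hb hab
  exact h hx hy ha hb hab

/-- Iterated symmetrization. -/
lemma rb_iterate {m : ℕ} {K : Set (Fin (m + 1) → ℝ)} (hK : IsCompact K) (hconv : Convex ℝ K)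
    (hne : (interior K).Nonempty) (S : Finset (Fin (m + 1))) (hS : (0 : Fin (m + 1)) ∉ S) :
    ∃ K1 : Set (Fin (m + 1) → ℝ), IsCompact K1 ∧ Convex ℝ K1 ∧ (interior K1).Nonempty ∧
      (∀ i ∈ S, ∀ x ∈ K1, Function.update x i (-x i) ∈ K1) ∧
      (∀ A : Set ℝ, MeasurableSet A → volume (K1 ∩ {x | x 0 ∈ A}) = volume (K ∩ {x | x 0 ∈ A})) ∧
      (∀ t : ℝ, (∃ x ∈ K1, x 0 = t) ↔ ∃ x ∈ K, x 0 = t) ∧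
      (∀ z' ∈ interior K1, (∀ i ∈ S, z' i = 0) →
        ∃ z ∈ interior K, volume (rb_pol K z) ≤ volume (rb_pol K1 z')) := by
  induction S using Finset.induction_on with
  | empty =>
    exact ⟨K, hK, hconv, hne, by simp, fun A _ => rfl, fun t => Iff.rfl,
      fun z' hz _ => ⟨z', hz, le_rfl⟩⟩
  | insert i S hi ih =>
    obtain ⟨K2, h1, h2, h3, h4, h5, h6, h7⟩ := ih (fun h => hS (Finset.mem_insert_of_mem h))
    have hi0 : i ≠ 0 := by rintro rfl; exact hS (Finset.mem_insert_self _ _)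
    set L := (rb_e i).symm ⁻¹' K2 with hL
    have hLc : IsCompact L := (rb_e i).symm.isCompact_preimage.2 h1
    have hLv : Convex ℝ L := rb_e_convex i h2
    have hLi : interior L = (rb_e i).symm ⁻¹' (interior K2) := ((rb_e i).symm.preimage_interior K2).symm
    have hLne : (interior L).Nonempty := by
      rw [hLi]
      obtain ⟨x, hx⟩ := h3
      exact ⟨rb_e i x, by simpa using hx⟩
    have hSti : interior (rb_Stv i K2) = rb_e i ⁻¹' (interior (rb_St L)) := by
      rw [rb_Stv_eq, ← hL]; exact ((rb_e i).preimage_interior _).symm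
    refine ⟨rb_Stv i K2, ?_, ?_, ?_, ?_, ?_, ?_, ?_⟩
    · rw [rb_Stv_eq]; exact (rb_e i).isCompact_preimage.2 (rb_St_compact hLc)
    · rw [rb_Stv_eq]; exact rb_e_convex' i (rb_St_convex hLv)
    · rw [hSti]
      obtain ⟨x, hx⟩ := rb_St_int hLc hLv hLne
      exact ⟨(rb_e i).symm x, by simpa using hx⟩
    · intro k hk x hx
      obtain ⟨P, Q, hP, hQ, hx⟩ := hx
      rcases Finset.mem_insert.1 hk with rfl | hk2
      · exact ⟨Q, P, by simpa using hQ, by simpa using hP, by simp; linarith⟩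
      · have hki : k ≠ i := by rintro rfl; exact hi hk2
        refine ⟨P, Q, ?_, ?_, ?_⟩
        · have := h4 k hk2 _ hP
          rw [Function.update_comm hki] 
          simpa [hki] using this
        · have := h4 k hk2 _ hQ
          rw [Function.update_comm hki] 
          simpa [hki] using this
        · rw [Function.update_of_ne hki.symm]; exact hx
    · intro A hA
      rw [← h5 A hA]
      obtain ⟨j, hj⟩ := Fin.exists_succAbove_eq hi0.symm
      have e1 : rb_Stv i K2 ∩ {x | x 0 ∈ A} = rb_e i ⁻¹' (rb_St L ∩ {p | p.2 ∈ {y | y j ∈ A}}) := by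
        rw [rb_Stv_eq]
        ext x
        simp [rb_e_snd, hj, hL]
      have e2 : K2 ∩ {x | x 0 ∈ A} = rb_e i ⁻¹' (L ∩ {p | p.2 ∈ {y | y j ∈ A}}) := by
        ext x
        simp [hL]
        intro _
        simp [rb_e_snd, hj]
      rw [e1, e2, rb_e_vol, rb_e_vol, rb_St_marg hLc hLv]
      exact (measurable_pi_apply j) hA
    · intro t
      rw [← h6 t]
      constructor
      · rintro ⟨x, ⟨P, Q, hP, hQ, hx⟩, rfl⟩
        exact ⟨_, hP, by rw [Function.update_of_ne hi0.symm]⟩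
      · rintro ⟨x, hx, rfl⟩
        refine ⟨Function.update x i 0, ⟨x i, x i, ?_, ?_, ?_⟩, ?_⟩
        · simpa using hx
        · simpa using hx
        · simp
        · rw [Function.update_of_ne hi0.symm]
    · intro z' hz' hz0
      rw [hSti] at hz'
      have hzi : z' i = 0 := hz0 i (Finset.mem_insert_self _ _)
      have hze : rb_e i z' = (0, (rb_e i z').2) := by
        ext
        · simp [rb_e_fst, hzi]
        · rfl
      have hz'' : rb_e i z' ∈ interior (rb_St L) := hz'
      rw [hze] at hz''
      obtain ⟨τ, hτ, hv⟩ := rb_ST' hLc hLv hLne _ hz''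
      have hz2 : Function.update z' i τ ∈ interior K2 := by
        rw [hLi] at hτ
        rw [← rb_e_symm]; exact hτ
      obtain ⟨z, hz, hv2⟩ := h7 _ hz2 (by
        intro k hk
        have hki : k ≠ i := by rintro rfl; exact hi hk
        rw [Function.update_of_ne hki]
        exact hz0 k (Finset.mem_insert_of_mem hk))
      refine ⟨z, hz, hv2.trans ?_⟩
      rw [rb_pol_eq i K2, rb_pol_eq i (rb_Stv i K2), rb_e_vol, rb_e_vol]
      have e3 : (rb_e i).symm ⁻¹' (rb_Stv i K2) = rb_St L := by
        rw [rb_Stv_eq]; ext p; simp [hL]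
      have e4 : rb_e i (Function.update z' i τ) = (τ, (rb_e i z').2) := by
        rw [← rb_e_symm]; simp
      rw [e3, e4, hze]
      exact hv

/-! part 7 -/

/-- sign flip of one coordinate as a measure preserving map -/
lemma rb_flip_mp {m : ℕ} (i : Fin m) :
    MeasurePreserving (fun x : Fin m → ℝ => Function.update x i (-x i)) volume volume := by
  have h := volume_preserving_pi (α' := fun _ : Fin m => ℝ) (β' := fun _ : Fin m => ℝ)
    (f := fun j => if j = i then (fun x : ℝ => -x) else id) (by
    intro j
    split_ifs
    · exact Measure.measurePreserving_neg volume
    · exact MeasurePreserving.id volume)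
  have e : (fun x : Fin m → ℝ => Function.update x i (-x i)) =
      fun a j => (if j = i then (fun x : ℝ => -x) else id) (a j) := by
    ext x j
    by_cases hj : j = i
    · subst hj; simp
    · simp [hj]
  rw [e]; exact h

lemma rb_coord_null {m : ℕ} (i : Fin m) : volume {x : Fin m → ℝ | x i = 0} = 0 := by
  have := (volume_pi : (volume : Measure (Fin m → ℝ)) = _)
  rw [this]
  exact Measure.pi_hyperplane (fun _ => (volume : Measure ℝ)) i 0

lemma rb_uncond_vol {m : ℕ} {A : Set (Fin m → ℝ)} (hA : MeasurableSet A)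
    (hu : ∀ i, ∀ x ∈ A, Function.update x i (-x i) ∈ A) (S : Finset (Fin m)) :
    volume A = 2 ^ S.card * volume (A ∩ {x | ∀ i ∈ S, 0 < x i}) := by
  induction S using Finset.induction_on with
  | empty => simp
  | insert i S hi ih =>
    rw [ih, Finset.card_insert_of_notMem hi, pow_succ, mul_assoc]
    congr 1
    set B := A ∩ {x | ∀ i ∈ S, 0 < x i} with hB
    have hmS : MeasurableSet {x : Fin m → ℝ | ∀ i ∈ S, 0 < x i} := by
      have : {x : Fin m → ℝ | ∀ i ∈ S, 0 < x i} = ⋂ i ∈ S, {x | 0 < x i} := by ext x; simp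
      rw [this]
      exact Finset.measurableSet_biInter _ fun j _ =>
        measurableSet_lt measurable_const (measurable_pi_apply j)
    have hBm : MeasurableSet B := hA.inter hmS
    have hP : MeasurableSet {x : Fin m → ℝ | 0 < x i} :=
      measurableSet_lt measurable_const (measurable_pi_apply i)
    have e0 : A ∩ {x | ∀ j ∈ insert i S, 0 < x j} = B ∩ {x | 0 < x i} := by
      ext x; simp [hB]; tauto
    rw [e0, ← measure_inter_add_diff B hP, two_mul]
    congr 1
    have e1 : volume (B \ {x | 0 < x i}) = volume (B ∩ {x | x i < 0}) := by
      apply measure_congr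
      have : ∀ᵐ x : Fin m → ℝ, x i ≠ 0 := by
        rw [ae_iff]; simpa using rb_coord_null i
      filter_upwards [this] with x hx
      apply propext
      constructor
      · rintro ⟨h1, h2⟩
        refine ⟨h1, lt_of_le_of_ne (not_lt.1 h2) hx⟩
      · rintro ⟨h1, h2⟩
        exact ⟨h1, fun h3 => lt_asymm (α := ℝ) h2 h3⟩
    rw [e1, ← (rb_flip_mp i).measure_preimage (hBm.inter hP).nullMeasurableSet]
    congr 1
    ext x
    have key : Function.update x i (-x i) ∈ A ↔ x ∈ A := by
      constructor
      · intro h; simpa using hu i _ h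
      · exact hu i x
    simp only [hB, Set.mem_inter_iff, Set.mem_setOf_eq, Set.mem_preimage, key, Function.update_self,
      Left.neg_pos_iff]
    have : (∀ j ∈ S, 0 < Function.update x i (-x i) j) ↔ ∀ j ∈ S, 0 < x j := by
      refine forall₂_congr fun j hj => ?_
      rw [Function.update_of_ne (by rintro rfl; exact hi hj)]
    rw [this]

/-- Euclidean ball of squared radius `x` -/
def rb_ball (m : ℕ) (x : ℝ) : Set (Fin m → ℝ) := {z | z ⬝ᵥ z ≤ x}

def rb_om (m : ℕ) : ℝ := (volume (rb_ball m 1)).toReal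

lemma rb_ball_closed (m : ℕ) (x : ℝ) : IsClosed (rb_ball m x) :=
  isClosed_le (by simp only [dotProduct]; fun_prop) continuous_const

lemma rb_ball_compact (m : ℕ) (x : ℝ) : IsCompact (rb_ball m x) := by
  refine Metric.isCompact_of_isClosed_isBounded (rb_ball_closed m x) ?_
  refine (Metric.isBounded_closedBall (x := (0 : Fin m → ℝ)) (r := Real.sqrt x)).subset ?_
  intro z hz
  simp only [mem_closedBall_zero_iff]
  rw [pi_norm_le_iff_of_nonneg (Real.sqrt_nonneg _)]
  intro i
  apply Real.le_sqrt_of_sq_le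
  have h1 : z i * z i ≤ z ⬝ᵥ z := by
    simp only [dotProduct]
    exact Finset.single_le_sum (f := fun i => z i * z i) (fun j _ => mul_self_nonneg _) (Finset.mem_univ i)
  have : z ⬝ᵥ z ≤ x := hz
  rw [Real.norm_eq_abs, sq_abs]; nlinarith

lemma rb_ball_pos (m : ℕ) {x : ℝ} (hx : 0 < x) : 0 < volume (rb_ball m x) := by
  have ho : IsOpen {z : Fin m → ℝ | z ⬝ᵥ z < x} :=
    isOpen_lt (by simp only [dotProduct]; fun_prop) continuous_const
  refine (ho.measure_pos volume ⟨0, by simpa using hx⟩).trans_le (measure_mono fun z hz => ?_)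
  exact le_of_lt (α := ℝ) hz

lemma rb_om_pos (m : ℕ) : 0 < rb_om m :=
  ENNReal.toReal_pos (rb_ball_pos m one_pos).ne' (rb_ball_compact m 1).measure_lt_top.ne

lemma rb_ball_vol {m : ℕ} (hm : 1 ≤ m) (x : ℝ) :
    volume (rb_ball m x) = ENNReal.ofReal (rb_om m * Real.sqrt x ^ m) := by
  rcases le_or_gt x 0 with hx | hx
  · rw [Real.sqrt_eq_zero_of_nonpos hx, zero_pow (by omega), mul_zero, ENNReal.ofReal_zero]
    refine measure_mono_null (fun z hz => ?_) (rb_coord_null (⟨0, hm⟩ : Fin m))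
    have h1 : z ⟨0, hm⟩ * z ⟨0, hm⟩ ≤ z ⬝ᵥ z := by
      simp only [dotProduct]
      exact Finset.single_le_sum (f := fun i => z i * z i) (fun j _ => mul_self_nonneg _)
        (Finset.mem_univ _)
    have : z ⬝ᵥ z ≤ x := hz
    have h2 : z ⟨0, hm⟩ * z ⟨0, hm⟩ ≤ 0 := by linarith
    exact mul_self_eq_zero.1 (le_antisymm h2 (mul_self_nonneg _))
  · have hs : 0 < Real.sqrt x := Real.sqrt_pos.2 hx
    have e : rb_ball m x = Real.sqrt x • rb_ball m 1 := by
      ext z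
      rw [Set.mem_smul_set_iff_inv_smul_mem₀ hs.ne']
      simp only [rb_ball, Set.mem_setOf_eq, smul_dotProduct, dotProduct_smul, smul_eq_mul]
      rw [← mul_assoc, ← mul_inv, Real.mul_self_sqrt hx.le, inv_mul_le_iff₀ hx, mul_one]
    rw [e, Measure.addHaar_smul, mul_comm (rb_om m), ENNReal.ofReal_mul (by positivity), rb_om,
      ENNReal.ofReal_toReal (rb_ball_compact m 1).measure_lt_top.ne]
    simp [abs_of_pos hs]

lemma rb_ip_flip {m : ℕ} (i : Fin m) (x y : Fin m → ℝ) :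
    Function.update x i (-x i) ⬝ᵥ y = x ⬝ᵥ Function.update y i (-y i) := by
  simp only [dotProduct]
  refine Finset.sum_congr rfl fun j _ => ?_
  by_cases hj : j = i
  · subst hj; simp
  · simp [hj]

/-- S2: slice inequality -/
lemma rb_slice_ineq {m : ℕ} (hm : 1 ≤ m) {L : Set (ℝ × (Fin m → ℝ))} (hL : IsCompact L)
    (h0 : 0 ∈ interior L)
    (hu : ∀ i, ∀ p ∈ L, (p.1, Function.update p.2 i (-p.2 i)) ∈ L) (t s : ℝ) :
    rb_sl L t * rb_sl (rb_polt L 0) s ≤ ENNReal.ofReal (rb_om m * Real.sqrt (1 - t * s) ^ m) ^ 2 := by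
  set M := rb_polt L 0 with hM
  have hMc : IsCompact M := rb_polt_compact (by exact h0)
  have huM : ∀ i, ∀ p ∈ M, (p.1, Function.update p.2 i (-p.2 i)) ∈ M := by
    intro i p hp y hy
    have := hp _ (hu i y hy)
    simp only [rb_ip] at this ⊢
    rw [rb_ip_flip]; linarith
  have hA : MeasurableSet {y | (t, y) ∈ L} := measurable_prodMk_left hL.measurableSet
  have hB : MeasurableSet {y | (s, y) ∈ M} := measurable_prodMk_left hMc.measurableSet
  have hC : MeasurableSet (rb_ball m (1 - t * s)) := (rb_ball_closed _ _).measurableSet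
  have huC : ∀ i, ∀ x ∈ rb_ball m (1 - t * s), Function.update x i (-x i) ∈ rb_ball m (1 - t * s) := by
    intro i x hx
    simp only [rb_ball, Set.mem_setOf_eq] at hx ⊢
    rw [rb_ip_flip]; simpa using hx
  have vA := rb_uncond_vol hA (fun i x hx => hu i _ hx) Finset.univ
  have vB := rb_uncond_vol hB (fun i x hx => huM i _ hx) Finset.univ
  have vC := rb_uncond_vol hC huC Finset.univ
  have pl := rb_PL_mul m ({y | (t, y) ∈ L}.indicator 1) ({y | (s, y) ∈ M}.indicator 1)
    ((rb_ball m (1 - t * s)).indicator 1) (measurable_one.indicator hA)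
    (measurable_one.indicator hB) (measurable_one.indicator hC) (by
      intro x hx y hy
      by_cases h1 : (t, x) ∈ L
      · by_cases h2 : (s, y) ∈ M
        · have h3 := h2 _ h1
          have : (fun i => Real.sqrt (x i * y i)) ∈ rb_ball m (1 - t * s) := by
            simp only [rb_ip] at h3
            simp only [rb_ball, Set.mem_setOf_eq, dotProduct]
            have e : ∀ i, Real.sqrt (x i * y i) * Real.sqrt (x i * y i) = y i * x i := by
              intro i
              have := hx i (Set.mem_univ _)
              have := hy i (Set.mem_univ _)
              simp only [Set.mem_Ioi] at *
              rw [Real.mul_self_sqrt (by positivity)]; ring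
            simp only [e]
            simp only [dotProduct] at h3
            linarith
          simp [Set.indicator, h1, h2, this]
        · simp [Set.indicator, h2]
      · simp [Set.indicator, h1])
  have hO : (Set.pi Set.univ fun _ => Set.Ioi (0:ℝ)) = {x : Fin m → ℝ | ∀ i ∈ Finset.univ, 0 < x i} := by
    ext x; simp
  rw [lintegral_indicator_one hA, lintegral_indicator_one hB, lintegral_indicator_one hC,
    Measure.restrict_apply hA, Measure.restrict_apply hB, Measure.restrict_apply hC, hO] at pl
  rw [← rb_ball_vol hm, rb_sl, rb_sl, vA, vB, vC]
  have pl2 := ENNReal.rpow_le_rpow pl (by norm_num : (0:ℝ) ≤ 2)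
  rw [ENNReal.mul_rpow_of_nonneg _ _ (by norm_num), ← ENNReal.rpow_mul, ← ENNReal.rpow_mul] at pl2
  norm_num at pl2
  calc _ = (2 ^ (Finset.univ : Finset (Fin m)).card) ^ 2 *
        (volume ({y | (t, y) ∈ L} ∩ {x | ∀ i ∈ Finset.univ, 0 < x i}) *
        volume ({y | (s, y) ∈ M} ∩ {x | ∀ i ∈ Finset.univ, 0 < x i})) := by ring
    _ ≤ (2 ^ (Finset.univ : Finset (Fin m)).card) ^ 2 *
      (volume (rb_ball m (1 - t * s) ∩ {x | ∀ i ∈ Finset.univ, 0 < x i})) ^ 2 := by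
        gcongr; simpa using pl2
    _ = _ := by ring

/-! part 8 -/

def rb_J (m : ℕ) : ℝ := ∫ x in (0:ℝ)..1, Real.sqrt (1 - x ^ 2) ^ m

def rb_kap (m : ℕ) (x : ℝ) : ℝ := Real.sqrt (1 - x ^ 2) ^ m / rb_J m

def rb_w (m : ℕ) (r : ℝ) : ℝ := ∫ x in (0:ℝ)..r, rb_kap m x

lemma rb_J_pos (m : ℕ) : 0 < rb_J m := by
  apply intervalIntegral.intervalIntegral_pos_of_pos_on
  · apply Continuous.intervalIntegrable; fun_prop
  · intro x hx
    have : 0 < 1 - x ^ 2 := by nlinarith [hx.1, hx.2]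
    positivity
  · norm_num

lemma rb_kap_cont (m : ℕ) : Continuous (rb_kap m) := by unfold rb_kap; fun_prop

lemma rb_kap_nonneg (m : ℕ) (x : ℝ) : 0 ≤ rb_kap m x :=
  div_nonneg (by positivity) (rb_J_pos m).le

lemma rb_kap_le (m : ℕ) (x : ℝ) : rb_kap m x ≤ 1 / rb_J m := by
  unfold rb_kap
  have := rb_J_pos m
  gcongr
  apply pow_le_one₀ (Real.sqrt_nonneg _)
  rw [Real.sqrt_le_one]; nlinarith [sq_nonneg x]

lemma rb_w_deriv (m : ℕ) (r : ℝ) : HasDerivAt (rb_w m) (rb_kap m r) r :=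
  intervalIntegral.integral_hasDerivAt_right ((rb_kap_cont m).intervalIntegrable _ _)
    ((rb_kap_cont m).stronglyMeasurableAtFilter _ _) (rb_kap_cont m).continuousAt

lemma rb_w_mono (m : ℕ) : Monotone (rb_w m) :=
  monotone_of_hasDerivAt_nonneg (rb_w_deriv m) (fun x => rb_kap_nonneg m x)

lemma rb_w_zero (m : ℕ) : rb_w m 0 = 0 := by simp [rb_w]

lemma rb_w_one (m : ℕ) : rb_w m 1 = 1 := by
  unfold rb_w rb_kap
  rw [intervalIntegral.integral_div]
  exact div_self (rb_J_pos m).ne'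

lemma rb_w_nonneg {m : ℕ} {r : ℝ} (hr : 0 ≤ r) : 0 ≤ rb_w m r := by
  rw [← rb_w_zero m]; exact rb_w_mono m hr

lemma rb_w_lip {m : ℕ} {x y : ℝ} (h : x ≤ y) : rb_w m y - rb_w m x ≤ 1 / rb_J m * (y - x) := by
  have e : rb_w m y - rb_w m x = ∫ u in x..y, rb_kap m u :=
    intervalIntegral.integral_interval_sub_left ((rb_kap_cont m).intervalIntegrable _ _)
      ((rb_kap_cont m).intervalIntegrable _ _)
  rw [e]
  calc _ ≤ ∫ u in x..y, 1 / rb_J m := intervalIntegral.integral_mono_on h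
        ((rb_kap_cont m).intervalIntegrable _ _) (by simp) (fun u _ => rb_kap_le m u)
    _ = _ := by simp [mul_comm]

lemma rb_w_one_of_ge {m : ℕ} (hm : 1 ≤ m) {r : ℝ} (hr : 1 ≤ r) : rb_w m r = 1 := by
  have e : rb_w m r - rb_w m 1 = ∫ u in (1:ℝ)..r, rb_kap m u :=
    intervalIntegral.integral_interval_sub_left ((rb_kap_cont m).intervalIntegrable _ _)
      ((rb_kap_cont m).intervalIntegrable _ _)
  have e2 : ∫ u in (1:ℝ)..r, rb_kap m u = ∫ u in (1:ℝ)..r, 0 := by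
    apply intervalIntegral.integral_congr
    intro u hu
    rw [Set.uIcc_of_le hr] at hu
    simp only [rb_kap]
    rw [Real.sqrt_eq_zero_of_nonpos (by nlinarith [hu.1]), zero_pow (by omega), zero_div]
  rw [rb_w_one, e2] at e
  simp at e; linarith

lemma rb_w_le_one {m : ℕ} (hm : 1 ≤ m) (r : ℝ) : rb_w m r ≤ 1 := by
  rcases le_total r 1 with h | h
  · rw [← rb_w_one m]; exact rb_w_mono m h
  · rw [rb_w_one_of_ge hm h]

/-- the transport estimate -/
lemma rb_H {m : ℕ} (hm : 1 ≤ m) {t s t' s' : ℝ → ℝ} {E : ℝ} (hE : 0 < E)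
    (ht : ∀ θ ∈ Set.Ioo (0:ℝ) 1, 0 < t θ ∧ HasDerivAt t (t' θ) θ ∧ 0 < t' θ)
    (hs : ∀ θ ∈ Set.Ioo (0:ℝ) 1, 0 < s θ ∧ HasDerivAt s (s' θ) θ ∧ 0 < s' θ)
    (hk : ∀ θ ∈ Set.Ioo (0:ℝ) 1,
      E ≤ Real.sqrt (t' θ * s' θ) * rb_kap m (Real.sqrt (t θ * s θ))) :
    (∀ θ ∈ Set.Ioo (0:ℝ) 1, E * θ ≤ rb_w m (Real.sqrt (t θ * s θ)) ∧
      rb_w m (Real.sqrt (t θ * s θ)) ≤ 1 - E * (1 - θ)) ∧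
    ∀ θ₁ ∈ Set.Ioo (0:ℝ) 1, ∀ θ₂ ∈ Set.Ioo (0:ℝ) 1, θ₁ ≤ θ₂ → ∀ S l : ℝ, 0 < S → 0 < l →
      (∀ θ ∈ Set.Icc θ₁ θ₂, 1 ≤ S * (Real.sqrt (t θ * s θ) * rb_kap m (Real.sqrt (t θ * s θ)))) →
      |(Real.log (t θ₂) - Real.log (s θ₂)) - (Real.log (t θ₁) - Real.log (s θ₁))| ≤
        S * ((1 - E) / l + 2 * l) := by
  set r : ℝ → ℝ := fun θ => Real.sqrt (t θ * s θ) with hr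
  set Y : ℝ → ℝ := fun θ => rb_w m (r θ) with hY
  set Y' : ℝ → ℝ := fun θ => rb_kap m (r θ) * ((t' θ * s θ + t θ * s' θ) / (2 * r θ)) with hY'
  have hrpos : ∀ θ ∈ Set.Ioo (0:ℝ) 1, 0 < r θ := fun θ hθ =>
    Real.sqrt_pos.2 (mul_pos (ht θ hθ).1 (hs θ hθ).1)
  have hrsq : ∀ θ ∈ Set.Ioo (0:ℝ) 1, r θ ^ 2 = t θ * s θ := fun θ hθ =>
    Real.sq_sqrt (mul_pos (ht θ hθ).1 (hs θ hθ).1).le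
  have hYd : ∀ θ ∈ Set.Ioo (0:ℝ) 1, HasDerivAt Y (Y' θ) θ := by
    intro θ hθ
    have h1 := ((ht θ hθ).2.1.mul (hs θ hθ).2.1).sqrt (mul_pos (ht θ hθ).1 (hs θ hθ).1).ne'
    exact (rb_w_deriv m (r θ)).comp θ h1
  -- the key quadratic inequality
  have hkey : ∀ θ ∈ Set.Ioo (0:ℝ) 1,
      (r θ * rb_kap m (r θ) / 2 * (t' θ / t θ - s' θ / s θ)) ^ 2 ≤ Y' θ ^ 2 - E ^ 2 := by
    intro θ hθ
    obtain ⟨h1, -, h2⟩ := ht θ hθ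
    obtain ⟨h3, -, h4⟩ := hs θ hθ
    have h5 := hk θ hθ
    have h6 : E ^ 2 ≤ t' θ * s' θ * rb_kap m (r θ) ^ 2 := by
      calc E ^ 2 ≤ (Real.sqrt (t' θ * s' θ) * rb_kap m (r θ)) ^ 2 := by gcongr
        _ = _ := by rw [mul_pow, Real.sq_sqrt (by positivity)]
    have h7 := hrsq θ hθ
    have h8 := hrpos θ hθ
    have e1 : (r θ * rb_kap m (r θ) / 2 * (t' θ / t θ - s' θ / s θ)) ^ 2 =
        Y' θ ^ 2 - t' θ * s' θ * rb_kap m (r θ) ^ 2 := by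
      have e2 : (r θ * rb_kap m (r θ) / 2 * (t' θ / t θ - s' θ / s θ)) ^ 2 =
        (t θ * s θ) * rb_kap m (r θ) ^ 2 / 4 * (t' θ / t θ - s' θ / s θ) ^ 2 := by
        rw [← h7]; ring
      have e3 : Y' θ ^ 2 = rb_kap m (r θ) ^ 2 * (t' θ * s θ + t θ * s' θ) ^ 2 / (4 * (t θ * s θ)) := by
        rw [← h7, hY']; field_simp; ring
      rw [e2, e3]; field_simp; ring
    rw [e1]; linarith
  have hY'nn : ∀ θ ∈ Set.Ioo (0:ℝ) 1, 0 ≤ Y' θ := by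
    intro θ hθ
    obtain ⟨h1, -, h2⟩ := ht θ hθ
    obtain ⟨h3, -, h4⟩ := hs θ hθ
    have := hrpos θ hθ
    have := rb_kap_nonneg m (r θ)
    simp only [hY']; positivity
  have hYE : ∀ θ ∈ Set.Ioo (0:ℝ) 1, E ≤ Y' θ := by
    intro θ hθ
    apply le_of_sq_le_sq _ (hY'nn θ hθ)
    nlinarith [hkey θ hθ, sq_nonneg (r θ * rb_kap m (r θ) / 2 * (t' θ / t θ - s' θ / s θ))]
  have hmonoG : ∀ (g g' : ℝ → ℝ) (a b : ℝ), a ∈ Set.Ioo (0:ℝ) 1 → b ∈ Set.Ioo (0:ℝ) 1 → a ≤ b →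
      (∀ θ ∈ Set.Icc a b, HasDerivAt g (g' θ) θ) → (∀ θ ∈ Set.Icc a b, 0 ≤ g' θ) → g a ≤ g b := by
    intro g g' a b ha hb hab hd hn
    have := monotoneOn_of_hasDerivWithinAt_nonneg (convex_Icc a b)
      (fun x hx => (hd x hx).continuousAt.continuousWithinAt)
      (fun x hx => (hd x (interior_subset hx)).hasDerivWithinAt)
      (fun x hx => hn x (interior_subset hx))
    exact this (Set.left_mem_Icc.2 hab) (Set.right_mem_Icc.2 hab) hab
  have hX : ∀ a ∈ Set.Ioo (0:ℝ) 1, ∀ b ∈ Set.Ioo (0:ℝ) 1, a ≤ b → Y a - E * a ≤ Y b - E * b := by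
    intro a ha b hb hab
    refine hmonoG (fun θ => Y θ - E * θ) (fun θ => Y' θ - E) a b ha hb hab ?_ ?_
    · intro θ hθ
      have hθ' : θ ∈ Set.Ioo (0:ℝ) 1 := ⟨ha.1.trans_le hθ.1, hθ.2.trans_lt hb.2⟩
      have h1 : HasDerivAt (fun θ => E * θ) E θ := by simpa using (hasDerivAt_id θ).const_mul E
      exact (hYd θ hθ').sub h1
    · intro θ hθ
      have := hYE θ ⟨ha.1.trans_le hθ.1, hθ.2.trans_lt hb.2⟩
      linarith
  have hP1 : ∀ θ ∈ Set.Ioo (0:ℝ) 1, E * θ ≤ Y θ ∧ Y θ ≤ 1 - E * (1 - θ) := by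
    intro θ hθ
    constructor
    · refine le_of_forall_pos_le_add fun ε hε => ?_
      have hp : 0 < min (θ / 2) (ε / E) := lt_min (by linarith [hθ.1]) (by positivity)
      have hlt : min (θ / 2) (ε / E) < θ := (min_le_left _ _).trans_lt (by linarith [hθ.1])
      have h1 := hX _ ⟨hp, hlt.trans hθ.2⟩ θ hθ hlt.le
      have h2 : 0 ≤ Y (min (θ / 2) (ε / E)) := rb_w_nonneg (Real.sqrt_nonneg _)
      have h3 : E * min (θ / 2) (ε / E) ≤ ε := by
        calc _ ≤ E * (ε / E) := by gcongr; exact min_le_right _ _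
          _ = ε := by field_simp
      linarith
    · refine le_of_forall_pos_le_add fun ε hε => ?_
      have hp : 0 < min ((1 - θ) / 2) (ε / E) := lt_min (by linarith [hθ.2]) (by positivity)
      have hlt : min ((1 - θ) / 2) (ε / E) < 1 - θ := (min_le_left _ _).trans_lt (by linarith [hθ.2])
      have h1 := hX θ hθ (1 - min ((1 - θ) / 2) (ε / E)) ⟨by linarith [hθ.1], by linarith⟩ (by linarith)
      have h2 : Y (1 - min ((1 - θ) / 2) (ε / E)) ≤ 1 := rb_w_le_one hm _
      have h3 : E * min ((1 - θ) / 2) (ε / E) ≤ ε := by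
        calc _ ≤ E * (ε / E) := by gcongr; exact min_le_right _ _
          _ = ε := by field_simp
      linarith
  refine ⟨hP1, ?_⟩
  intro a ha b hb hab S l hS hl hSr
  have hq : ∀ θ ∈ Set.Icc a b, HasDerivAt (fun θ => Real.log (t θ) - Real.log (s θ))
      (t' θ / t θ - s' θ / s θ) θ := by
    intro θ hθ
    have hθ' : θ ∈ Set.Ioo (0:ℝ) 1 := ⟨ha.1.trans_le hθ.1, hθ.2.trans_lt hb.2⟩
    exact ((ht θ hθ').2.1.log (ht θ hθ').1.ne').sub ((hs θ hθ').2.1.log (hs θ hθ').1.ne')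
  have hZ : ∀ θ ∈ Set.Icc a b, HasDerivAt (fun θ => S * ((Y θ - E * θ) / l + l * (Y θ + E * θ)))
      (S * ((Y' θ - E) / l + l * (Y' θ + E))) θ := by
    intro θ hθ
    have hθ' : θ ∈ Set.Ioo (0:ℝ) 1 := ⟨ha.1.trans_le hθ.1, hθ.2.trans_lt hb.2⟩
    have h1 : HasDerivAt (fun θ => E * θ) E θ := by simpa using (hasDerivAt_id θ).const_mul E
    exact ((((hYd θ hθ').sub h1).div_const l).add (((hYd θ hθ').add h1).const_mul l)).const_mul S
  have hbd : ∀ θ ∈ Set.Icc a b, |t' θ / t θ - s' θ / s θ| ≤ S * ((Y' θ - E) / l + l * (Y' θ + E)) := by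
    intro θ hθ
    have hθ' : θ ∈ Set.Ioo (0:ℝ) 1 := ⟨ha.1.trans_le hθ.1, hθ.2.trans_lt hb.2⟩
    have h1 := hkey θ hθ'
    have h2 := hYE θ hθ'
    set D := t' θ / t θ - s' θ / s θ
    set ρ := r θ * rb_kap m (r θ) with hρ
    have h3 : 1 ≤ S * ρ := hSr θ hθ
    have h4 : 0 < ρ := by by_contra h; push Not at h; nlinarith
    have h5 : |ρ * D| ≤ (Y' θ - E) / l + l * (Y' θ + E) := by
      have hnn : 0 ≤ (Y' θ - E) / l + l * (Y' θ + E) := by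
        have : 0 ≤ Y' θ - E := by linarith
        have : 0 ≤ Y' θ + E := by linarith
        positivity
      apply abs_le_of_sq_le_sq _ hnn
      have e : ((Y' θ - E) / l + l * (Y' θ + E)) ^ 2 = ((Y' θ - E) / l - l * (Y' θ + E)) ^ 2 +
        4 * (Y' θ ^ 2 - E ^ 2) := by field_simp; ring
      rw [e]
      nlinarith [sq_nonneg ((Y' θ - E) / l - l * (Y' θ + E))]
    rw [abs_mul, abs_of_pos h4] at h5
    calc |D| ≤ (S * ρ) * |D| := by nlinarith [abs_nonneg D]
      _ = S * (ρ * |D|) := by ring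
      _ ≤ _ := by gcongr
  have m1 := hmonoG _ _ a b ha hb hab (fun θ hθ => (hZ θ hθ).sub (hq θ hθ)) (fun θ hθ => by
    linarith [(abs_le.1 (hbd θ hθ)).2])
  have m2 := hmonoG _ _ a b ha hb hab (fun θ hθ => (hZ θ hθ).add (hq θ hθ)) (fun θ hθ => by
    linarith [(abs_le.1 (hbd θ hθ)).1])
  simp only [Pi.sub_apply, Pi.add_apply] at m1 m2
  have hE1 : E ≤ 1 := by have := hP1 a ha; linarith
  have h6 : S * ((Y b - E * b) / l + l * (Y b + E * b)) - S * ((Y a - E * a) / l + l * (Y a + E * a)) ≤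
      S * ((1 - E) / l + 2 * l) := by
    rw [← mul_sub]
    apply mul_le_mul_of_nonneg_left _ hS.le
    have b1 : (Y b - E * b) / l - (Y a - E * a) / l ≤ (1 - E) / l := by
      rw [← sub_div]
      apply div_le_div_of_nonneg_right _ hl.le
      have := (hP1 b hb).2; have := (hP1 a ha).1
      linarith
    have b2 : l * (Y b + E * b) - l * (Y a + E * a) ≤ 2 * l := by
      have h7 : Y b + E * b - (Y a + E * a) ≤ 2 := by
        have := (hP1 b hb).2; have h8 := (hP1 a ha).1
        have : E * b ≤ 1 := by nlinarith [hb.2, hb.1]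
        nlinarith [ha.1, hb.2]
      nlinarith
    linarith
  rw [abs_le]
  constructor <;> linarith

/-! part 9 -/

lemma rb_J_le_one (m : ℕ) : rb_J m ≤ 1 := by
  have : rb_J m ≤ ∫ x in (0:ℝ)..1, 1 := by
    apply intervalIntegral.integral_mono_on (by norm_num)
    · apply Continuous.intervalIntegrable; fun_prop
    · simp
    · intro x _
      apply pow_le_one₀ (Real.sqrt_nonneg _)
      rw [Real.sqrt_le_one]; nlinarith [sq_nonneg x]
  simpa using this

/-- lower bound for `r * kap r` on the window -/
lemma rb_S_bound {m : ℕ} (hm : 1 ≤ m) {τ r : ℝ} (hτ : 0 < τ) (hτ1 : τ ≤ 1/4)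
    (h1 : Real.sqrt τ ≤ r) (h2 : r ≤ 1 - τ) :
    1 ≤ (2 ^ m * rb_J m / Real.sqrt τ ^ m) * (r * rb_kap m r) := by
  have hs : 0 < Real.sqrt τ := Real.sqrt_pos.2 hτ
  have hs1 : Real.sqrt τ ≤ 1 := by rw [Real.sqrt_le_one]; linarith
  have hJ := rb_J_pos m
  have key : Real.sqrt τ ^ m ≤ 2 ^ m * (r * Real.sqrt (1 - r ^ 2) ^ m) := by
    rcases le_total r (1/2) with h | h
    · have h3 : (1/2 : ℝ) ≤ Real.sqrt (1 - r ^ 2) := by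
        apply Real.le_sqrt_of_sq_le; nlinarith
      have h4 : 1 ≤ (2 * Real.sqrt (1 - r ^ 2)) ^ m := one_le_pow₀ (by linarith)
      calc Real.sqrt τ ^ m ≤ Real.sqrt τ := pow_le_of_le_one hs.le hs1 (by omega)
        _ ≤ r * 1 := by linarith
        _ ≤ r * (2 * Real.sqrt (1 - r ^ 2)) ^ m := by gcongr; linarith
        _ = _ := by rw [mul_pow]; ring
    · have h3 : Real.sqrt τ ≤ Real.sqrt (1 - r ^ 2) := Real.sqrt_le_sqrt (by nlinarith)
      have h4 : (2:ℝ) ≤ 2 ^ m := by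
        calc (2:ℝ) = 2 ^ 1 := by norm_num
          _ ≤ 2 ^ m := pow_le_pow_right₀ (by norm_num) hm
      calc Real.sqrt τ ^ m = 1 * Real.sqrt τ ^ m := by ring
        _ ≤ (2 ^ m * r) * Real.sqrt (1 - r ^ 2) ^ m := by
          gcongr; nlinarith
        _ = _ := by ring
  unfold rb_kap
  rw [div_mul_eq_mul_div, one_le_div (by positivity)]
  calc _ ≤ _ := key
    _ = _ := by field_simp

/-- lower bound of the tail of w -/
lemma rb_tail_lower {m : ℕ} {x : ℝ} (hx : 0 ≤ x) (hx1 : x ≤ 1) :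
    x / 2 * Real.sqrt (x / 2) ^ m / rb_J m ≤ 1 - rb_w m (1 - x) := by
  have hJ := rb_J_pos m
  have e : rb_w m (1 - x / 2) - rb_w m (1 - x) = ∫ u in (1-x)..(1 - x / 2), rb_kap m u :=
    intervalIntegral.integral_interval_sub_left ((rb_kap_cont m).intervalIntegrable _ _)
      ((rb_kap_cont m).intervalIntegrable _ _)
  have h1 : rb_w m (1 - x / 2) ≤ 1 :=
    (rb_w_mono m (by linarith : 1 - x / 2 ≤ 1)).trans_eq (rb_w_one m)
  have h2 : ∫ u in (1-x)..(1 - x / 2), Real.sqrt (x / 2) ^ m / rb_J m ≤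
      ∫ u in (1-x)..(1 - x / 2), rb_kap m u := by
    apply intervalIntegral.integral_mono_on (by linarith) (by simp)
      ((rb_kap_cont m).intervalIntegrable _ _)
    intro u hu
    unfold rb_kap
    gcongr
    nlinarith [hu.1, hu.2]
  rw [intervalIntegral.integral_const, smul_eq_mul] at h2
  calc _ = (1 - x / 2 - (1 - x)) * (Real.sqrt (x / 2) ^ m / rb_J m) := by ring
    _ ≤ _ := by linarith

lemma rb_tail_upper {m : ℕ} {x : ℝ} (hx : 0 ≤ x) :
    1 - rb_w m (1 - x) ≤ x * Real.sqrt (2 * x) ^ m / rb_J m := by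
  have hJ := rb_J_pos m
  have e : rb_w m 1 - rb_w m (1 - x) = ∫ u in (1-x)..1, rb_kap m u :=
    intervalIntegral.integral_interval_sub_left ((rb_kap_cont m).intervalIntegrable _ _)
      ((rb_kap_cont m).intervalIntegrable _ _)
  rw [rb_w_one] at e
  have h2 : ∫ u in (1-x)..1, rb_kap m u ≤ ∫ u in (1-x)..1, Real.sqrt (2 * x) ^ m / rb_J m := by
    apply intervalIntegral.integral_mono_on (by linarith) ((rb_kap_cont m).intervalIntegrable _ _)
      (by simp)
    intro u hu
    unfold rb_kap
    gcongr
    nlinarith [hu.1, hu.2, sq_nonneg (1 - u)]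
  rw [intervalIntegral.integral_const, smul_eq_mul] at h2
  calc _ ≤ (1 - (1 - x)) * (Real.sqrt (2 * x) ^ m / rb_J m) := by linarith
    _ = _ := by ring

/-- bounds for w near zero -/
lemma rb_w_lower {m : ℕ} {x : ℝ} (hx : 0 ≤ x) (hx1 : x ≤ 1/2) : x / 2 ^ m / rb_J m ≤ rb_w m x := by
  have hJ := rb_J_pos m
  have h2 : ∫ u in (0:ℝ)..x, 1 / 2 ^ m / rb_J m ≤ ∫ u in (0:ℝ)..x, rb_kap m u := by
    apply intervalIntegral.integral_mono_on hx (by simp) ((rb_kap_cont m).intervalIntegrable _ _)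
    intro u hu
    unfold rb_kap
    gcongr
    rw [← one_div_pow]
    gcongr
    apply Real.le_sqrt_of_sq_le; nlinarith [hu.1, hu.2]
  rw [intervalIntegral.integral_const, smul_eq_mul] at h2
  calc _ = (x - 0) * (1 / 2 ^ m / rb_J m) := by ring
    _ ≤ _ := h2

set_option maxHeartbeats 2000000 in
lemma rb_core {m : ℕ} (hm : 1 ≤ m) {f g : ℝ → ℝ} {b b' τ e ω : ℝ} (hω : 0 < ω) (hb : 0 < b) (hb' : 0 < b')
    (hfc : ContinuousOn f (Set.Ioo 0 b)) (hfp : ∀ x ∈ Set.Ioo 0 b, 0 < f x)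
    (hfi : IntervalIntegrable f volume 0 b)
    (hgc : ContinuousOn g (Set.Ioo 0 b')) (hgp : ∀ x ∈ Set.Ioo 0 b', 0 < g x)
    (hgi : IntervalIntegrable g volume 0 b')
    (hfg : ∀ t ∈ Set.Ioo 0 b, ∀ s ∈ Set.Ioo 0 b', f t * g s ≤ (ω * Real.sqrt (1 - t * s) ^ m) ^ 2) :
    0 < (∫ x in (0:ℝ)..b, f x) ∧ 0 < (∫ x in (0:ℝ)..b', g x) ∧ 
    (∫ x in (0:ℝ)..b, f x) * (∫ x in (0:ℝ)..b', g x) ≤ (ω * rb_J m) ^ 2 ∧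
    (0 < τ → τ ≤ 1/4 → e ≤ τ ^ (m + 2) / (36 * 4 ^ m) →
    ((1 - e) * (ω * rb_J m)) ^ 2 ≤ (∫ x in (0:ℝ)..b, f x) * (∫ x in (0:ℝ)..b', g x) →
    ∃ A : ℝ, 0 < A ∧ A * (1 - 2 * τ) < b ∧ ∀ x, 2 * A * Real.sqrt τ ≤ x → x ≤ A * (1 - 2 * τ) →
      rb_w m (x / A * (1 - τ)) - e ≤ (∫ u in (0:ℝ)..x, f u) / (∫ x in (0:ℝ)..b, f x) ∧
      (∫ u in (0:ℝ)..x, f u) / (∫ x in (0:ℝ)..b, f x) ≤ rb_w m (x / A * (1 + τ)) + e) := by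
  obtain ⟨hF, t, ht1, ht2, ht3, ht4⟩ := rb_transport hb hfc hfp hfi
  obtain ⟨hG, s, hs1, hs2, hs3, hs4⟩ := rb_transport hb' hgc hgp hgi
  set F := ∫ x in (0:ℝ)..b, f x
  set G := ∫ x in (0:ℝ)..b', g x
  have hJ := rb_J_pos m
  have hJ1 := rb_J_le_one m
  set E := Real.sqrt (F * G) / (ω * rb_J m) with hE
  have hEpos : 0 < E := by positivity
  have hk : ∀ θ ∈ Set.Ioo (0:ℝ) 1, E ≤ Real.sqrt (F / f (t θ) * (G / g (s θ))) *
      rb_kap m (Real.sqrt (t θ * s θ)) := by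
    intro θ hθ
    have h1 := (ht1 θ hθ).1
    have h2 := (hs1 θ hθ).1
    have h3 := hfp _ h1
    have h4 := hgp _ h2
    have h5 := hfg _ h1 _ h2
    set c := ω * Real.sqrt (1 - t θ * s θ) ^ m with hc
    have hc0 : 0 ≤ c := by positivity
    have hcpos : 0 < c := by
      rcases hc0.lt_or_eq with h | h
      · exact h
      · rw [← h] at h5; have := mul_pos h3 h4; norm_num at h5; linarith
    unfold rb_kap
    rw [Real.sq_sqrt (by have := h1.1; have := h2.1; positivity)]
    have h6 : Real.sqrt (F * G) / c ≤ Real.sqrt (F / f (t θ) * (G / g (s θ))) := by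
      rw [div_mul_div_comm, Real.sqrt_div (by positivity)]
      gcongr
      exact (Real.sqrt_le_left hc0).2 h5
    calc E = Real.sqrt (F * G) / c * (Real.sqrt (1 - t θ * s θ) ^ m / rb_J m) := by
          rw [hE]
          have : Real.sqrt (1 - t θ * s θ) ^ m = c / ω := by rw [hc]; field_simp
          rw [this]; field_simp
      _ ≤ _ := by gcongr
  obtain ⟨H1, H2⟩ := rb_H hm hEpos
    (fun θ hθ => ⟨(ht1 θ hθ).1.1, ht2 θ hθ, div_pos hF (hfp _ (ht1 θ hθ).1)⟩)
    (fun θ hθ => ⟨(hs1 θ hθ).1.1, hs2 θ hθ, div_pos hG (hgp _ (hs1 θ hθ).1)⟩) hk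
  have hE1 : E ≤ 1 := by
    have := H1 (1/2) (by norm_num); linarith
  refine ⟨hF, hG, ?_, ?_⟩
  · rw [hE, div_le_one (by positivity)] at hE1
    exact (Real.sqrt_le_left (by positivity)).1 hE1
  intro hτ hτ1 he hEF
  have hEe : 1 - e ≤ E := by
    rw [hE, le_div_iff₀ (by positivity)]
    exact Real.le_sqrt_of_sq_le hEF
  have he0 : 0 ≤ e := by linarith
  set r : ℝ → ℝ := fun θ => Real.sqrt (t θ * s θ) with hr
  have hsτ : 0 < Real.sqrt τ := Real.sqrt_pos.2 hτ
  have hsτ2 : Real.sqrt τ ≤ 1/2 := by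
    rw [Real.sqrt_le_left (by norm_num)]; linarith
  have hsq := Real.sq_sqrt hτ.le
  have h4m : (1:ℝ) ≤ 4 ^ m := one_le_pow₀ (by norm_num)
  have h2m : (1:ℝ) ≤ 2 ^ m := one_le_pow₀ (by norm_num)
  -- e small
  have he1 : e < rb_w m (Real.sqrt τ) := by
    refine lt_of_lt_of_le ?_ (rb_w_lower hsτ.le hsτ2)
    calc e ≤ _ := he
      _ ≤ τ ^ 1 / (36 * 2 ^ m) := by
          apply div_le_div₀ (by positivity) (pow_le_pow_of_le_one hτ.le (by linarith) (by omega))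
            (by positivity)
          gcongr; norm_num
      _ < Real.sqrt τ / 2 ^ m := by
          rw [div_lt_div_iff₀ (by positivity) (by positivity)]
          have : τ < 36 * Real.sqrt τ := by nlinarith
          nlinarith
      _ ≤ _ := by
          rw [le_div_iff₀ hJ]
          exact mul_le_of_le_one_right (by positivity) hJ1
  have he2 : e < 1 - rb_w m (1 - τ) := by
    refine lt_of_lt_of_le ?_ (rb_tail_lower hτ.le (by linarith))
    have h5 : τ / 2 ≤ Real.sqrt (τ / 2) := Real.le_sqrt_of_sq_le (by nlinarith)
    calc e ≤ _ := he
      _ = τ ^ (m+1) / 2 ^ m * (τ / (36 * 2 ^ m)) := by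
        have : (4:ℝ) ^ m = 2 ^ m * 2 ^ m := by rw [← mul_pow]; norm_num
        rw [this, pow_succ]; field_simp; 
      _ < τ ^ (m+1) / 2 ^ m * (1 / 2) := by
        apply mul_lt_mul_of_pos_left _ (by positivity)
        rw [div_lt_div_iff₀ (by positivity) (by positivity)]
        nlinarith
      _ = τ / 2 * (τ / 2) ^ m := by rw [div_pow, pow_succ]; field_simp
      _ ≤ τ / 2 * Real.sqrt (τ / 2) ^ m := by gcongr
      _ ≤ _ := by
          rw [le_div_iff₀ hJ]
          exact mul_le_of_le_one_right (by positivity) hJ1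
  have hrmono : ∀ θ ∈ Set.Ioo (0:ℝ) 1, ∀ θ' ∈ Set.Ioo (0:ℝ) 1, θ ≤ θ' → r θ ≤ r θ' := by
    intro θ hθ θ' hθ' h
    apply Real.sqrt_le_sqrt
    exact mul_le_mul (ht3.monotoneOn hθ hθ' h) (hs3.monotoneOn hθ hθ' h) (hs1 θ hθ).1.1.le
      (ht1 θ' hθ').1.1.le
  have hrcont : ContinuousOn r (Set.Ioo 0 1) := by
    apply ContinuousOn.sqrt
    exact ContinuousOn.mul (fun θ hθ => (ht2 θ hθ).continuousAt.continuousWithinAt)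
      (fun θ hθ => (hs2 θ hθ).continuousAt.continuousWithinAt)
  obtain ⟨θa, hθa, hra⟩ : ∃ θ ∈ Set.Ioo (0:ℝ) 1, r θ < Real.sqrt τ := by
    set δ := min (1/2) ((rb_w m (Real.sqrt τ) - e) / 2) with hδ
    have hδ0 : 0 < δ := lt_min (by norm_num) (by linarith)
    have hδ1 : δ ≤ 1/2 := min_le_left _ _
    have hδ2 : δ ≤ (rb_w m (Real.sqrt τ) - e) / 2 := min_le_right _ _
    refine ⟨δ, ⟨hδ0, by linarith⟩, ?_⟩
    by_contra hcon
    push Not at hcon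
    have h1 := rb_w_mono m hcon
    have h2 := (H1 δ ⟨hδ0, by linarith⟩).2
    have h3 : E * (1 - δ) ≥ (1 - e) * (1 - δ) := by gcongr; linarith
    nlinarith
  obtain ⟨θb, hθb, hrb⟩ : ∃ θ ∈ Set.Ioo (0:ℝ) 1, 1 - τ < r θ := by
    set δ := min (1/2) ((1 - rb_w m (1 - τ) - e) / 2) with hδ
    have hδ0 : 0 < δ := lt_min (by norm_num) (by linarith)
    have hδ1 : δ ≤ 1/2 := min_le_left _ _
    have hδ2 : δ ≤ (1 - rb_w m (1 - τ) - e) / 2 := min_le_right _ _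
    refine ⟨1 - δ, ⟨by linarith, by linarith⟩, ?_⟩
    by_contra hcon
    push Not at hcon
    have h1 := rb_w_mono m hcon
    have h2 := (H1 (1 - δ) ⟨by linarith, by linarith⟩).1
    have h3 : E * (1 - δ) ≥ (1 - e) * (1 - δ) := by gcongr; linarith
    nlinarith
  have hivt : ∀ ρ, Real.sqrt τ ≤ ρ → ρ ≤ 1 - τ → ∃ θ ∈ Set.Ioo (0:ℝ) 1, r θ = ρ := by
    intro ρ h1 h2
    have := isPreconnected_Ioo.intermediate_value hθa hθb hrcont
    obtain ⟨θ, hθ, h⟩ := this ⟨hra.le.trans h1, h2.trans hrb.le⟩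
    exact ⟨θ, hθ, h⟩
  have hlohi : Real.sqrt τ < 1 - τ := by linarith
  obtain ⟨θl, hθl, hrl⟩ := hivt _ le_rfl hlohi.le
  obtain ⟨θh, hθh, hrh⟩ := hivt _ hlohi.le le_rfl
  have hlh : θl ≤ θh := by
    by_contra hcon
    push Not at hcon
    have := hrmono _ hθh _ hθl hcon.le
    rw [hrl, hrh] at this; linarith
  set A := t θl / Real.sqrt τ with hA
  have hApos : 0 < A := div_pos (ht1 θl hθl).1.1 hsτ
  -- window comparison
  have hwin : ∀ θ ∈ Set.Icc θl θh, A * r θ * (1 - τ / 2) ≤ t θ ∧ t θ ≤ A * r θ * (1 + τ / 2) := by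
    intro θ hθ
    have hθ' : θ ∈ Set.Ioo (0:ℝ) 1 := ⟨hθl.1.trans_le hθ.1, hθ.2.trans_lt hθh.2⟩
    set lam := τ * Real.sqrt τ ^ m / (6 * 2 ^ m) with hlam
    have hlam0 : 0 < lam := by positivity
    set S := 2 ^ m * rb_J m / Real.sqrt τ ^ m with hS
    have h1 := H2 θl hθl θ hθ' hθ.1 S lam (by positivity) hlam0 (by
      intro θ2 hθ2
      have hθ2' : θ2 ∈ Set.Ioo (0:ℝ) 1 := ⟨hθl.1.trans_le hθ2.1, hθ2.2.trans_lt hθ'.2⟩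
      apply rb_S_bound hm hτ hτ1
      · rw [← hrl]; exact hrmono _ hθl _ hθ2' hθ2.1
      · rw [← hrh]; exact hrmono _ hθ2' _ hθh (hθ2.2.trans hθ.2))
    have h2 : (1 - E) / lam ≤ lam := by
      rw [div_le_iff₀ hlam0]
      have : lam * lam = τ ^ (m + 2) / (36 * 4 ^ m) := by
        have e4 : (4:ℝ) ^ m = 2 ^ m * 2 ^ m := by rw [← mul_pow]; norm_num
        have e5 : τ ^ m = Real.sqrt τ ^ m * Real.sqrt τ ^ m := by
          rw [← mul_pow, Real.mul_self_sqrt hτ.le]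
        rw [hlam, e4, pow_add, e5]; field_simp; norm_num
      linarith
    have h3 : S * ((1 - E) / lam + 2 * lam) ≤ τ / 2 := by
      calc S * ((1 - E) / lam + 2 * lam) ≤ S * (lam + 2 * lam) := by gcongr
        _ = rb_J m * (τ / 2) := by rw [hS, hlam]; field_simp; norm_num
        _ ≤ _ := mul_le_of_le_one_left (by positivity) hJ1
    have h4 := h1.trans h3
    have t0 := (ht1 θ hθ').1.1
    have s0 := (hs1 θ hθ').1.1
    have tl0 := (ht1 θl hθl).1.1
    have sl0 := (hs1 θl hθl).1.1
    have lr : Real.log (r θ) = (Real.log (t θ) + Real.log (s θ)) / 2 := by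
      rw [hr]; simp only; rw [Real.log_sqrt (by positivity), Real.log_mul t0.ne' s0.ne']
    have lrl : Real.log (r θl) = (Real.log (t θl) + Real.log (s θl)) / 2 := by
      rw [hr]; simp only; rw [Real.log_sqrt (by positivity), Real.log_mul tl0.ne' sl0.ne']
    have lA : Real.log A = Real.log (t θl) - Real.log (r θl) := by
      rw [hA, Real.log_div tl0.ne' hsτ.ne', hrl]
    have hr0 : 0 < r θ := Real.sqrt_pos.2 (by positivity)
    have hd : |Real.log (t θ) - Real.log (A * r θ)| ≤ τ / 4 := by
      rw [Real.log_mul hApos.ne' hr0.ne', lA, lr, lrl]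
      rw [abs_le] at h4 ⊢
      constructor <;> linarith [h4.1, h4.2]
    rw [abs_le] at hd
    have hAr : 0 < A * r θ := by positivity
    have et : t θ = A * r θ * Real.exp (Real.log (t θ) - Real.log (A * r θ)) := by
      rw [Real.exp_sub, Real.exp_log t0, Real.exp_log hAr]; field_simp
    constructor
    · rw [et]
      gcongr
      have := Real.add_one_le_exp (Real.log (t θ) - Real.log (A * r θ))
      linarith [hd.1]
    · rw [et]
      gcongr
      have h5 := Real.add_one_le_exp (-(τ/4))
      have h6 : Real.exp (Real.log (t θ) - Real.log (A * r θ)) ≤ Real.exp (τ/4) :=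
        Real.exp_le_exp.2 hd.2
      have h7 : Real.exp (τ / 4) * Real.exp (-(τ/4)) = 1 := by rw [← Real.exp_add]; simp
      have h8 := Real.exp_pos (τ/4)
      nlinarith
  have hth : A * (1 - 2 * τ) ≤ t θh := by
    have := (hwin θh (Set.right_mem_Icc.2 hlh)).1
    rw [hrh] at this
    refine le_trans ?_ this
    rw [mul_assoc]; gcongr; nlinarith
  refine ⟨A, hApos, hth.trans_lt (ht1 θh hθh).1.2, ?_⟩
  intro x hx1 hx2
  have hxb : x ∈ Set.Ioo 0 b := ⟨lt_of_lt_of_le (by positivity) hx1,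
    hx2.trans_lt (hth.trans_lt (ht1 θh hθh).1.2)⟩
  rw [← ht4] at hxb
  obtain ⟨θ, hθ, rfl⟩ := hxb
  have hθ1 : θl ≤ θ := by
    rw [← ht3.le_iff_le hθl hθ]
    have : t θl = A * Real.sqrt τ := by rw [hA]; field_simp
    rw [this]; nlinarith
  have hθ2 : θ ≤ θh := by
    rw [← ht3.le_iff_le hθ hθh]
    exact hx2.trans hth
  have hw := hwin θ ⟨hθ1, hθ2⟩
  rw [(ht1 θ hθ).2, mul_div_assoc, div_self hF.ne', mul_one]
  have H := H1 θ hθ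
  have hr0 : 0 < r θ := Real.sqrt_pos.2 (mul_pos (ht1 θ hθ).1.1 (hs1 θ hθ).1.1)
  have hlow : t θ / A * (1 - τ) ≤ r θ := by
    rw [div_mul_eq_mul_div, div_le_iff₀ hApos]
    calc t θ * (1 - τ) ≤ A * r θ * (1 + τ / 2) * (1 - τ) := by
          apply mul_le_mul_of_nonneg_right hw.2; linarith
      _ = (r θ * A) * ((1 + τ / 2) * (1 - τ)) := by ring
      _ ≤ (r θ * A) * 1 := by gcongr; nlinarith
      _ = _ := by ring
  have hup : r θ ≤ t θ / A * (1 + τ) := by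
    rw [div_mul_eq_mul_div, le_div_iff₀ hApos]
    calc r θ * A = (r θ * A) * 1 := by ring
      _ ≤ (r θ * A) * ((1 - τ / 2) * (1 + τ)) := by gcongr; nlinarith
      _ = A * r θ * (1 - τ / 2) * (1 + τ) := by ring
      _ ≤ _ := by apply mul_le_mul_of_nonneg_right hw.1; linarith
  have w1 := rb_w_mono m hlow
  have w2 := rb_w_mono m hup
  have b1 : E * θ ≥ (1 - e) * θ := by gcongr; exact hθ.1.le
  have b2 : E * (1 - θ) ≥ (1 - e) * (1 - θ) := by gcongr; linarith [hθ.2]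
  constructor
  · have : e * θ ≥ 0 := mul_nonneg he0 hθ.1.le
    linarith [H.2]
  · have : e * (1 - θ) ≥ 0 := mul_nonneg he0 (by linarith [hθ.2])
    linarith [H.1]

/-! part 10 -/

lemma rb_sl_vol {m : ℕ} {L : Set (ℝ × (Fin m → ℝ))} (hL : MeasurableSet L) {I : Set ℝ}
    (hI : MeasurableSet I) : volume (L ∩ {p | p.1 ∈ I}) = ∫⁻ s in I, rb_sl L s := by
  have hm2 : MeasurableSet (L ∩ {p : ℝ × (Fin m → ℝ) | p.1 ∈ I}) :=
    hL.inter (measurable_fst hI)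
  rw [Measure.volume_eq_prod, Measure.prod_apply hm2, ← lintegral_indicator hI]
  congr 1
  ext s
  by_cases hs : s ∈ I
  · rw [Set.indicator_of_mem hs]
    unfold rb_sl
    congr 1
    ext y
    simp [hs]
  · rw [Set.indicator_of_notMem hs]
    convert measure_empty (μ := (volume : Measure (Fin m → ℝ)))
    ext y
    simp [hs]

lemma rb_sl_real {m : ℕ} {L : Set (ℝ × (Fin m → ℝ))} (hL : IsCompact L) {x y : ℝ} (hx : x ≤ y) :
    ∫ s in x..y, (rb_sl L s).toReal = (volume (L ∩ {p | p.1 ∈ Set.Ioc x y})).toReal := by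
  have hmsl : Measurable (rb_sl L) := measurable_measure_prodMk_left hL.measurableSet
  rw [intervalIntegral.integral_of_le hx, rb_sl_vol hL.measurableSet measurableSet_Ioc,
    integral_toReal hmsl.aemeasurable (Filter.Eventually.of_forall fun s => rb_sl_lt_top hL s)]

lemma rb_om_succ {m : ℕ} (hm : 1 ≤ m) : rb_om (m + 1) = 2 * (rb_om m * rb_J m) := by
  set B : Set (ℝ × (Fin m → ℝ)) := (rb_e 0).symm ⁻¹' (rb_ball (m+1) 1) with hB
  have hBc : IsCompact B := (rb_e 0).symm.isCompact_preimage.2 (rb_ball_compact _ _)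
  have hmem : ∀ p, p ∈ B ↔ p.1 * p.1 + p.2 ⬝ᵥ p.2 ≤ 1 := by
    intro p
    have := rb_e_ip 0 ((rb_e 0).symm p) ((rb_e 0).symm p)
    rw [Homeomorph.apply_symm_apply] at this
    simp only [hB, Set.mem_preimage, rb_ball, Set.mem_setOf_eq, ← this]
    rfl
  have e1 : volume (rb_ball (m+1) 1) = volume B := by
    rw [← rb_e_vol 0 B, hB]; congr 1; ext x; simp
  have e2 : rb_refl ⁻¹' B = B := by
    ext p; simp [hmem, rb_refl]
  have e3 := rb_vol_split B hBc.measurableSet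
  rw [e2, ← two_mul] at e3
  have e4 : B ∩ {u | 0 < u.1} = B ∩ {p | p.1 ∈ Set.Ioc (0:ℝ) 1} := by
    ext p
    simp only [Set.mem_inter_iff, hmem, Set.mem_setOf_eq, Set.mem_Ioc]
    constructor
    · rintro ⟨h1, h2⟩
      refine ⟨h1, h2, ?_⟩
      have : 0 ≤ p.2 ⬝ᵥ p.2 := by simp only [dotProduct]; exact Finset.sum_nonneg fun i _ => mul_self_nonneg _
      nlinarith
    · rintro ⟨h1, h2, h3⟩
      exact ⟨h1, h2⟩
  have e5 : ∀ s, (rb_sl B s).toReal = rb_om m * Real.sqrt (1 - s ^ 2) ^ m := by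
    intro s
    have : rb_sl B s = volume (rb_ball m (1 - s ^ 2)) := by
      unfold rb_sl
      congr 1
      ext y
      simp only [hmem, Set.mem_setOf_eq, rb_ball]
      constructor <;> intro h <;> linarith
    rw [this, rb_ball_vol hm, ENNReal.toReal_ofReal]
    have := rb_om_pos m
    positivity
  have e6 := rb_sl_real hBc (zero_le_one (α := ℝ))
  simp only [e5] at e6
  rw [rb_om, e1, e3, e4, ENNReal.toReal_mul, ← e6, intervalIntegral.integral_const_mul]
  rfl

lemma rb_side {m : ℕ} (hm : 1 ≤ m) {L : Set (ℝ × (Fin m → ℝ))} (hL : IsCompact L)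
    (hconv : Convex ℝ L) (h0 : 0 ∈ interior L)
    (hu : ∀ i, ∀ p ∈ L, (p.1, Function.update p.2 i (-p.2 i)) ∈ L) :
    0 < (volume (L ∩ {p | 0 < p.1})).toReal ∧ 0 < (volume (rb_polt L 0 ∩ {p | 0 < p.1})).toReal ∧
    (volume (L ∩ {p | 0 < p.1})).toReal * (volume (rb_polt L 0 ∩ {p | 0 < p.1})).toReal ≤
      (rb_om m * rb_J m) ^ 2 ∧
    ∃ b : ℝ, 0 < b ∧ (∃ y, (b, y) ∈ L) ∧ (∀ p ∈ L, p.1 ≤ b) ∧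
    ∀ τ e : ℝ, 0 < τ → τ ≤ 1/4 → e ≤ τ ^ (m + 2) / (36 * 4 ^ m) →
    ((1 - e) * (rb_om m * rb_J m)) ^ 2 ≤
      (volume (L ∩ {p | 0 < p.1})).toReal * (volume (rb_polt L 0 ∩ {p | 0 < p.1})).toReal →
    ∃ A : ℝ, 0 < A ∧ A * (1 - 2 * τ) < b ∧ ∀ x, 2 * A * Real.sqrt τ ≤ x → x ≤ A * (1 - 2 * τ) →
      rb_w m (x / A * (1 - τ)) - e ≤
        (volume (L ∩ {p | p.1 ∈ Set.Ioc 0 x})).toReal / (volume (L ∩ {p | 0 < p.1})).toReal ∧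
      (volume (L ∩ {p | p.1 ∈ Set.Ioc 0 x})).toReal / (volume (L ∩ {p | 0 < p.1})).toReal ≤
        rb_w m (x / A * (1 + τ)) + e := by
  set M := rb_polt L 0 with hM
  have hMc : IsCompact M := rb_polt_compact (by exact h0)
  have hMv : Convex ℝ M := rb_polt_convex L 0
  have hM0 : 0 ∈ interior M := rb_polt_int hL 0
  obtain ⟨b, hb, f1, f2, f3, f4, f5, f6⟩ := rb_half hL hconv h0
  obtain ⟨b', hb', g1, g2, g3, g4, g5, g6⟩ := rb_half hMc hMv hM0
  have hfg : ∀ t ∈ Set.Ioo 0 b, ∀ s ∈ Set.Ioo 0 b', (rb_sl L t).toReal * (rb_sl M s).toReal ≤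
      (rb_om m * Real.sqrt (1 - t * s) ^ m) ^ 2 := by
    intro t _ s _
    have h1 := rb_slice_ineq hm hL h0 hu t s
    have hnn : 0 ≤ rb_om m * Real.sqrt (1 - t * s) ^ m := by have := rb_om_pos m; positivity
    rw [← ENNReal.ofReal_pow hnn] at h1
    rw [← ENNReal.toReal_mul]
    exact ENNReal.toReal_le_of_le_ofReal (by positivity) h1
  have hF : (volume (L ∩ {p | 0 < p.1})).toReal = ∫ s in (0:ℝ)..b, (rb_sl L s).toReal := by
    rw [← f6, ENNReal.toReal_ofReal]
    exact intervalIntegral.integral_nonneg hb.le fun _ _ => ENNReal.toReal_nonneg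
  have hG : (volume (M ∩ {p | 0 < p.1})).toReal = ∫ s in (0:ℝ)..b', (rb_sl M s).toReal := by
    rw [← g6, ENNReal.toReal_ofReal]
    exact intervalIntegral.integral_nonneg hb'.le fun _ _ => ENNReal.toReal_nonneg
  rw [hF, hG]
  have core := fun τ e => rb_core (τ := τ) (e := e) hm (rb_om_pos m) hb hb' f1 f2 f3 g1 g2 g3 hfg
  refine ⟨(core 0 0).1, (core 0 0).2.1, (core 0 0).2.2.1, b, hb, f4, f5, ?_⟩
  intro τ e h1 h2 h3 h4
  obtain ⟨A, hA, hA2, hA3⟩ := (core τ e).2.2.2 h1 h2 h3 h4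
  refine ⟨A, hA, hA2, ?_⟩
  intro x hx1 hx2
  have := hA3 x hx1 hx2
  rwa [rb_sl_real hL (le_trans (by positivity) hx1)] at this

/-- median -/
lemma rb_median {m : ℕ} {L : Set (ℝ × (Fin m → ℝ))} (hL : IsCompact L) :
    ∃ t0 : ℝ, volume (L ∩ {p | t0 < p.1}) = volume (L ∩ {p | p.1 < t0}) := by
  obtain ⟨R, hR⟩ := (hL.image continuous_fst).isBounded.subset_closedBall 0
  have hR' : ∀ p ∈ L, |p.1| ≤ R := by
    intro p hp
    have := hR ⟨p, hp, rfl⟩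
    simpa using this
  have hfin : ∀ A : Set (ℝ × (Fin m → ℝ)), volume (L ∩ A) ≠ ⊤ := fun A =>
    ((measure_mono Set.inter_subset_left).trans_lt hL.measure_lt_top).ne
  set S := |R| + 1 with hS
  have hS0 : 0 < S := by positivity
  have hRS : R < S := by have := le_abs_self R; linarith
  have hmsl : Measurable (rb_sl L) := measurable_measure_prodMk_left hL.measurableSet
  have hinn : Integrable (fun s => (rb_sl L s).toReal) volume := by
    apply integrable_toReal_of_lintegral_ne_top hmsl.aemeasurable
    have := rb_sl_vol hL.measurableSet MeasurableSet.univ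
    rw [Measure.restrict_univ] at this
    rw [← this]; exact hfin _
  set Φ : ℝ → ℝ := fun t => ∫ s in (-S)..t, (rb_sl L s).toReal with hΦ
  have hc : Continuous Φ := intervalIntegral.continuous_primitive
    (fun a b => hinn.intervalIntegrable) (-S)
  have hΦ0 : Φ (-S) = 0 := by simp [hΦ]
  have hΦ1 : 0 ≤ Φ S := intervalIntegral.integral_nonneg (by linarith) fun _ _ => ENNReal.toReal_nonneg
  obtain ⟨t0, ht0, hmid⟩ := intermediate_value_Icc (by linarith : -S ≤ S) hc.continuousOn
    (show Φ S / 2 ∈ Set.Icc (Φ (-S)) (Φ S) from ⟨by linarith, by linarith⟩)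
  refine ⟨t0, ?_⟩
  have e1 : Φ t0 = (volume (L ∩ {p | p.1 ∈ Set.Ioc (-S) t0})).toReal := rb_sl_real hL ht0.1
  have e2 : Φ S - Φ t0 = ∫ s in t0..S, (rb_sl L s).toReal :=
    intervalIntegral.integral_interval_sub_left hinn.intervalIntegrable hinn.intervalIntegrable
  rw [rb_sl_real hL ht0.2] at e2
  have e3 : L ∩ {p | p.1 ∈ Set.Ioc t0 S} = L ∩ {p | t0 < p.1} := by
    ext p
    constructor
    · rintro ⟨h1, h2⟩; exact ⟨h1, h2.1⟩
    · rintro ⟨h1, h2⟩; exact ⟨h1, h2, by have := (abs_le.1 (hR' p h1)).2; linarith⟩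
  have e4 : L ∩ {p | p.1 ∈ Set.Ioc (-S) t0} = L ∩ {p | p.1 ≤ t0} := by
    ext p
    constructor
    · rintro ⟨h1, h2⟩; exact ⟨h1, h2.2⟩
    · rintro ⟨h1, h2⟩; exact ⟨h1, by have := (abs_le.1 (hR' p h1)).1; linarith, h2⟩
  have e5 : volume (L ∩ {p | p.1 ≤ t0}) = volume (L ∩ {p | p.1 < t0}) := by
    have h1 := rb_sl_vol hL.measurableSet (measurableSet_Iic (a := t0))
    have h2 := rb_sl_vol hL.measurableSet (measurableSet_Iio (a := t0))
    rw [setLIntegral_congr Iio_ae_eq_Iic.symm, ← h2] at h1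
    exact h1
  rw [e3] at e2
  rw [e4, e5] at e1
  rw [← ENNReal.toReal_eq_toReal_iff' (hfin _) (hfin _), ← e2, ← e1]
  linarith

/-! part 11 -/

def rb_flipH {m : ℕ} (i : Fin m) : (ℝ × (Fin m → ℝ)) ≃ₜ (ℝ × (Fin m → ℝ)) where
  toFun p := (p.1, Function.update p.2 i (-p.2 i))
  invFun p := (p.1, Function.update p.2 i (-p.2 i))
  left_inv p := by simp
  right_inv p := by simp
  continuous_toFun := by fun_prop
  continuous_invFun := by fun_prop

lemma rb_axis {m : ℕ} {L : Set (ℝ × (Fin m → ℝ))} (hconv : Convex ℝ L)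
    (hu : ∀ i, ∀ p ∈ L, (p.1, Function.update p.2 i (-p.2 i)) ∈ L) {p : ℝ × (Fin m → ℝ)}
    (hp : p ∈ interior L) : ((p.1, 0) : ℝ × (Fin m → ℝ)) ∈ interior L := by
  have hfl : ∀ i, ∀ q ∈ interior L, (q.1, Function.update q.2 i (-q.2 i)) ∈ interior L := by
    intro i q hq
    have e : rb_flipH i ⁻¹' L = L := by
      ext x
      constructor
      · intro h
        have := hu i _ h
        simpa [rb_flipH] using this
      · intro h; exact hu i x h
    have h2 := (rb_flipH i).preimage_interior L
    rw [e] at h2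
    rw [← h2] at hq
    exact hq
  have key : ∀ S : Finset (Fin m), (p.1, fun j => if j ∈ S then 0 else p.2 j) ∈ interior L := by
    intro S
    induction S using Finset.induction_on with
    | empty => simpa using hp
    | insert i S hi ih =>
      have h1 := hconv.interior ih (hfl i _ ih) (by norm_num : (0:ℝ) ≤ 1/2)
        (by norm_num : (0:ℝ) ≤ 1/2) (by norm_num)
      convert h1 using 1
      ext j
      · simp; ring
      · by_cases hj : j = i
        · subst hj; simp [hi]
        · by_cases hjS : j ∈ S
          · simp [hj, hjS]
          · simp [hj, hjS]; ring
  have := key Finset.univ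
  simp only [Finset.mem_univ, if_true] at this
  exact this

lemma rb_axis_med {m : ℕ} {L : Set (ℝ × (Fin m → ℝ))} (hconv : Convex ℝ L)
    (hu : ∀ i, ∀ p ∈ L, (p.1, Function.update p.2 i (-p.2 i)) ∈ L) (hne : (interior L).Nonempty)
    {t0 : ℝ} (ht : volume (L ∩ {p | t0 < p.1}) = volume (L ∩ {p | p.1 < t0})) :
    ((t0, 0) : ℝ × (Fin m → ℝ)) ∈ interior L := by
  obtain ⟨c, hc⟩ := hne
  have comb : ∀ q ∈ L, (q.1 < t0 ∧ t0 < c.1) ∨ (t0 < q.1 ∧ c.1 < t0) →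
      ((t0, 0) : ℝ × (Fin m → ℝ)) ∈ interior L := by
    intro q hq h
    have hne : c.1 - q.1 ≠ 0 := by rcases h with h | h <;> intro h3 <;> linarith [h.1, h.2]
    have ha : 0 < (t0 - q.1) / (c.1 - q.1) := by
      rcases h with h | h
      · exact div_pos (by linarith) (by linarith [h.1, h.2])
      · exact div_pos_of_neg_of_neg (by linarith) (by linarith [h.1, h.2])
    have hb : 0 < (c.1 - t0) / (c.1 - q.1) := by
      rcases h with h | h
      · exact div_pos (by linarith) (by linarith [h.1, h.2])
      · exact div_pos_of_neg_of_neg (by linarith) (by linarith [h.1, h.2])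
    have h1 := hconv.combo_interior_closure_mem_interior hc (subset_closure hq) ha hb.le
      (by field_simp; ring)
    have h2 := rb_axis hconv hu h1
    convert h2 using 2
    simp; field_simp; ring
  rcases lt_trichotomy c.1 t0 with h | h | h
  · have ho : IsOpen (interior L ∩ {p | p.1 < t0}) :=
      isOpen_interior.inter (isOpen_lt continuous_fst continuous_const)
    have hp := ho.measure_pos volume ⟨c, hc, h⟩
    have hp2 : 0 < volume (L ∩ {p | p.1 < t0}) :=
      hp.trans_le (measure_mono (Set.inter_subset_inter_left _ interior_subset))
    rw [← ht] at hp2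
    obtain ⟨q, hq1, hq2⟩ := nonempty_of_measure_ne_zero hp2.ne'
    exact comb q hq1 (Or.inr ⟨hq2, h⟩)
  · have := rb_axis hconv hu hc
    rwa [h] at this
  · have ho : IsOpen (interior L ∩ {p | t0 < p.1}) :=
      isOpen_interior.inter (isOpen_lt continuous_const continuous_fst)
    have hp := ho.measure_pos volume ⟨c, hc, h⟩
    have hp2 : 0 < volume (L ∩ {p | t0 < p.1}) :=
      hp.trans_le (measure_mono (Set.inter_subset_inter_left _ interior_subset))
    rw [ht] at hp2
    obtain ⟨q, hq1, hq2⟩ := nonempty_of_measure_ne_zero hp2.ne'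
    exact comb q hq1 (Or.inl ⟨hq2, h⟩)

/-- marginal of K in direction `e_0` -/
def rb_N {m : ℕ} (K : Set (Fin (m + 1) → ℝ)) (I : Set ℝ) : ℝ := (volume (K ∩ {x | x 0 ∈ I})).toReal

set_option maxHeartbeats 1000000 in
/-- one-directional stability data -/
lemma rb_dir {m : ℕ} (hm : 1 ≤ m) {K : Set (Fin (m + 1) → ℝ)} (hK : IsCompact K) (hconv : Convex ℝ K)
    (hne : (interior K).Nonempty) : ∃ t0 F a b : ℝ, 0 < F ∧ 0 < a ∧ 0 < b ∧
      (volume K).toReal = 2 * F ∧ rb_N K (Set.Ioi t0) = F ∧ rb_N K (Set.Iio t0) = F ∧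
      (∃ x ∈ K, x 0 = t0 + b) ∧ (∀ x ∈ K, x 0 ≤ t0 + b) ∧
      (∃ x ∈ K, x 0 = t0 - a) ∧ (∀ x ∈ K, t0 - a ≤ x 0) ∧
      (∃ z ∈ interior K, (volume K).toReal * (volume (rb_pol K z)).toReal ≤ rb_om (m + 1) ^ 2) ∧
      ∀ τ η : ℝ, 0 < τ → τ ≤ 1 / 4 → 0 ≤ η → 2 * η ≤ τ ^ (m + 2) / (36 * 4 ^ m) →
        (∀ z ∈ interior K, (1 - η) * rb_om (m + 1) ^ 2 ≤ (volume K).toReal * (volume (rb_pol K z)).toReal) →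
        (∃ A : ℝ, 0 < A ∧ A * (1 - 2 * τ) < b ∧ ∀ x, 2 * A * Real.sqrt τ ≤ x → x ≤ A * (1 - 2 * τ) →
          rb_w m (x / A * (1 - τ)) - 2 * η ≤ rb_N K (Set.Ioc t0 (t0 + x)) / F ∧
          rb_N K (Set.Ioc t0 (t0 + x)) / F ≤ rb_w m (x / A * (1 + τ)) + 2 * η) ∧
        (∃ A : ℝ, 0 < A ∧ A * (1 - 2 * τ) < a ∧ ∀ x, 2 * A * Real.sqrt τ ≤ x → x ≤ A * (1 - 2 * τ) →
          rb_w m (x / A * (1 - τ)) - 2 * η ≤ rb_N K (Set.Ico (t0 - x) t0) / F ∧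
          rb_N K (Set.Ico (t0 - x) t0) / F ≤ rb_w m (x / A * (1 + τ)) + 2 * η) := by
  obtain ⟨K1, k1, k2, k3, k4, k5, k6, k7⟩ := rb_iterate hK hconv hne (Finset.univ.erase 0) (by simp)
  set L1 : Set (ℝ × (Fin m → ℝ)) := (rb_e 0).symm ⁻¹' K1 with hL1
  have L1c : IsCompact L1 := (rb_e 0).symm.isCompact_preimage.2 k1
  have L1v : Convex ℝ L1 := rb_e_convex 0 k2
  have L1i : interior L1 = (rb_e 0).symm ⁻¹' (interior K1) := ((rb_e 0).symm.preimage_interior K1).symm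
  have L1ne : (interior L1).Nonempty := by
    rw [L1i]
    obtain ⟨x, hx⟩ := k3
    exact ⟨rb_e 0 x, by simpa using hx⟩
  have L1u : ∀ i, ∀ p ∈ L1, (p.1, Function.update p.2 i (-p.2 i)) ∈ L1 := by
    intro i p hp
    have h1 := k4 i.succ (by simp) _ hp
    show (rb_e 0).symm _ ∈ K1
    convert h1 using 1
    rw [Homeomorph.symm_apply_eq]
    have hpp : rb_e 0 ((rb_e 0).symm p) = p := by simp
    have q0 : (rb_e 0).symm p 0 = p.1 := by
      have := rb_e_fst 0 ((rb_e 0).symm p)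
      rw [hpp] at this; exact this.symm
    have qj : ∀ j : Fin m, (rb_e 0).symm p j.succ = p.2 j := by
      intro j
      have := rb_e_snd 0 ((rb_e 0).symm p) j
      rw [hpp] at this
      simpa using this.symm
    ext j
    · rw [rb_e_fst, Function.update_of_ne (Fin.succ_ne_zero i).symm, q0]
    · rw [rb_e_snd]
      simp only [Fin.succAbove_zero]
      by_cases hj : j = i
      · subst hj; simp [qj]
      · rw [Function.update_of_ne hj, Function.update_of_ne (by simpa using hj), qj]
  obtain ⟨t0, ht0⟩ := rb_median L1c
  have hax := rb_axis_med L1v L1u L1ne ht0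
  set L : Set (ℝ × (Fin m → ℝ)) := (fun p => p + (t0, 0)) ⁻¹' L1 with hL
  have hLh : L = (Homeomorph.addRight ((t0, 0) : ℝ × (Fin m → ℝ))) ⁻¹' L1 := rfl
  have Lc : IsCompact L := by rw [hLh]; exact (Homeomorph.isCompact_preimage _).2 L1c
  have Lv : Convex ℝ L := L1v.translate_preimage_left _
  have L0 : (0 : ℝ × (Fin m → ℝ)) ∈ interior L := by
    rw [hL, rb_interior_translate]; simpa using hax
  have Lu : ∀ i, ∀ p ∈ L, (p.1, Function.update p.2 i (-p.2 i)) ∈ L := by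
    intro i p hp
    have := L1u i _ hp
    show _ + _ ∈ L1
    simpa using this
  -- marginals
  have hmarg : ∀ I : Set ℝ, MeasurableSet I →
      volume (L ∩ {p | p.1 ∈ I}) = volume (K ∩ {x | x 0 - t0 ∈ I}) := by
    intro I hI
    have e1 : L ∩ {p | p.1 ∈ I} = (fun p => p + ((t0, 0) : ℝ × (Fin m → ℝ))) ⁻¹'
        (L1 ∩ {p | p.1 - t0 ∈ I}) := by
      ext p; simp [hL]
    have e2 : K1 ∩ {x | x 0 - t0 ∈ I} = rb_e 0 ⁻¹' (L1 ∩ {p | p.1 - t0 ∈ I}) := by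
      ext x; simp [hL1, rb_e_fst]
    have e3 := k5 ((fun s => s - t0) ⁻¹' I) (measurable_sub_const t0 hI)
    rw [e1, measure_preimage_add_right, ← rb_e_vol 0, ← e2]
    exact e3
  set L' := rb_refl ⁻¹' L with hL'
  have hmarg' : ∀ I : Set ℝ, MeasurableSet I →
      volume (L' ∩ {p | p.1 ∈ I}) = volume (K ∩ {x | t0 - x 0 ∈ I}) := by
    intro I hI
    have e1 : L' ∩ {p | p.1 ∈ I} = rb_refl ⁻¹' (L ∩ {p | p.1 ∈ (fun s => -s) ⁻¹' I}) := by
      ext p; simp [hL', rb_refl]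
    have hI2 : MeasurableSet ((fun s : ℝ => -s) ⁻¹' I) := measurable_neg hI
    have hmm : MeasurableSet (L ∩ {p : ℝ × (Fin m → ℝ) | p.1 ∈ (fun s => -s) ⁻¹' I}) :=
      Lc.measurableSet.inter (measurable_fst hI2)
    rw [e1, rb_refl_mp.measure_preimage hmm.nullMeasurableSet, hmarg _ hI2]
    simp
  have L'c : IsCompact L' := rb_reflH.isCompact_preimage.2 Lc
  have L'v : Convex ℝ L' := by
    intro x hx y hy a b ha hb hab
    have := Lv hx hy ha hb hab
    simp only [hL', Set.mem_preimage] at this ⊢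
    convert this using 1
    ext <;> simp [rb_refl]; ring
  have L'0 : (0 : ℝ × (Fin m → ℝ)) ∈ interior L' := by
    have := rb_reflH.preimage_interior L
    have h2 : interior L' = rb_reflH ⁻¹' interior L := this.symm
    rw [h2]
    show rb_refl 0 ∈ interior L
    have : rb_refl (0 : ℝ × (Fin m → ℝ)) = 0 := by ext <;> simp [rb_refl]
    rw [this]; exact L0
  have L'u : ∀ i, ∀ p ∈ L', (p.1, Function.update p.2 i (-p.2 i)) ∈ L' := by
    intro i p hp
    exact Lu i _ hp
  obtain ⟨s1, s2, s3, b, hb, hb1, hb2, s4⟩ := rb_side hm Lc Lv L0 Lu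
  obtain ⟨s1', s2', s3', a, ha, ha1, ha2, s4'⟩ := rb_side hm L'c L'v L'0 L'u
  set F := (volume (L ∩ {p | 0 < p.1})).toReal with hF
  have nF : rb_N K (Set.Ioi t0) = F := by
    have := hmarg (Set.Ioi 0) measurableSet_Ioi
    rw [hF]
    have h2 : L ∩ {p | 0 < p.1} = L ∩ {p | p.1 ∈ Set.Ioi 0} := rfl
    rw [h2, this]; simp [rb_N]
  have nF' : rb_N K (Set.Iio t0) = (volume (L' ∩ {p | 0 < p.1})).toReal := by
    have := hmarg' (Set.Ioi 0) measurableSet_Ioi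
    have h2 : L' ∩ {p | 0 < p.1} = L' ∩ {p | p.1 ∈ Set.Ioi 0} := rfl
    rw [h2, this]; simp [rb_N]
  have hF' : (volume (L' ∩ {p | 0 < p.1})).toReal = F := by
    have h1 := hmarg (Set.Ioi 0) measurableSet_Ioi
    have h2 := hmarg' (Set.Ioi 0) measurableSet_Ioi
    have k51 := k5 (Set.Ioi t0) measurableSet_Ioi
    have k52 := k5 (Set.Iio t0) measurableSet_Iio
    have e1 : K1 ∩ {x | x 0 ∈ Set.Ioi t0} = rb_e 0 ⁻¹' (L1 ∩ {p | t0 < p.1}) := by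
      ext x; simp [hL1, rb_e_fst]
    have e2 : K1 ∩ {x | x 0 ∈ Set.Iio t0} = rb_e 0 ⁻¹' (L1 ∩ {p | p.1 < t0}) := by
      ext x; simp [hL1, rb_e_fst]
    have h3 : L' ∩ {p | 0 < p.1} = L' ∩ {p | p.1 ∈ Set.Ioi 0} := rfl
    have h4 : L ∩ {p | 0 < p.1} = L ∩ {p | p.1 ∈ Set.Ioi 0} := rfl
    rw [hF, h3, h4, h1, h2]
    congr 1
    simp only [Set.mem_Ioi, sub_pos]
    rw [e1, rb_e_vol] at k51
    rw [e2, rb_e_vol] at k52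
    simp only [Set.mem_Ioi, Set.mem_Iio] at k51 k52
    rw [← k51, ← k52, ht0]
  -- polars
  have hpolL' : rb_polt L' 0 = rb_refl ⁻¹' (rb_polt L 0) := by
    have := rb_polt_refl L 0
    rwa [neg_zero] at this
  rw [hF', hpolL'] at s3' s4'
  have Mc : IsCompact (rb_polt L 0) := rb_polt_compact (by exact L0)
  have volM := rb_vol_split (rb_polt L 0) Mc.measurableSet
  set G := (volume (rb_polt L 0 ∩ {p | 0 < p.1})).toReal with hG
  set G' := (volume (rb_refl ⁻¹' rb_polt L 0 ∩ {p | 0 < p.1})).toReal with hG'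
  have M'c : IsCompact (rb_refl ⁻¹' rb_polt L 0) := rb_reflH.isCompact_preimage.2 Mc
  have volM2 : (volume (rb_polt L 0)).toReal = G + G' := by
    rw [volM, ENNReal.toReal_add]
    · exact ((measure_mono Set.inter_subset_left).trans_lt Mc.measure_lt_top).ne
    · exact ((measure_mono Set.inter_subset_left).trans_lt M'c.measure_lt_top).ne
  set z' : Fin (m + 1) → ℝ := (rb_e 0).symm (t0, 0) with hz'
  have hez : rb_e 0 z' = (t0, 0) := by simp [hz']
  have z'0 : ∀ i ∈ Finset.univ.erase (0 : Fin (m + 1)), z' i = 0 := by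
    intro i hi
    obtain ⟨j, rfl⟩ := Fin.exists_succ_eq_of_ne_zero (Finset.ne_of_mem_erase hi)
    have := rb_e_snd 0 z' j
    rw [hez] at this
    simpa using this.symm
  obtain ⟨z, hz, hzv⟩ := k7 z' (by rw [L1i] at hax; exact hax) z'0
  have epol : volume (rb_pol K1 z') = volume (rb_polt L 0) := by
    rw [rb_pol_eq 0, rb_e_vol, hez]
    congr 1
    ext u
    constructor
    · intro h y hy
      have := h _ hy
      simpa using this
    · intro h y hy
      have := h (y - (t0, 0)) (by
        show y - (t0, 0) + (t0, 0) ∈ L1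
        rw [sub_add_cancel]; exact hy)
      simpa using this
  rw [epol] at hzv
  have hzv2 : (volume (rb_pol K z)).toReal ≤ G + G' := by
    rw [← volM2]; exact ENNReal.toReal_mono Mc.measure_lt_top.ne hzv
  have volK : (volume K).toReal = 2 * F := by
    have e1 : volume K = volume L := by
      have := hmarg Set.univ MeasurableSet.univ
      simpa using this.symm
    rw [e1, rb_vol_split L Lc.measurableSet, ENNReal.toReal_add]
    · show F + (volume (L' ∩ {p | 0 < p.1})).toReal = 2 * F
      rw [hF']; ring
    · exact ((measure_mono Set.inter_subset_left).trans_lt Lc.measure_lt_top).ne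
    · exact ((measure_mono Set.inter_subset_left).trans_lt L'c.measure_lt_top).ne
  have hom := rb_om_succ hm
  set I := rb_om m * rb_J m with hI
  have hIpos : 0 < I := mul_pos (rb_om_pos m) (rb_J_pos m)
  have hproj : ∀ t : ℝ, (∃ y, (t, y) ∈ L) ↔ ∃ x ∈ K, x 0 = t0 + t := by
    intro t
    rw [← k6 (t0 + t)]
    constructor
    · rintro ⟨y, hy⟩
      refine ⟨_, hy, ?_⟩
      have := rb_e_fst 0 ((rb_e 0).symm ((t, y) + (t0, 0)))
      rw [Homeomorph.apply_symm_apply] at this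
      rw [← this]; simp; ring
    · rintro ⟨x, hx, h⟩
      refine ⟨(rb_e 0 x).2, ?_⟩
      show (rb_e 0).symm _ ∈ K1
      convert hx using 1
      rw [Homeomorph.symm_apply_eq]
      ext j
      · rw [rb_e_fst, h]; simp; ring
      · simp
  refine ⟨t0, F, a, b, s1, ha, hb, volK, nF, nF'.trans hF', (hproj b).1 hb1, ?_, ?_, ?_, ?_, ?_⟩
  · intro x hx
    obtain ⟨y, hy⟩ := (hproj (x 0 - t0)).2 ⟨x, hx, by ring⟩
    have := hb2 _ hy
    simp at this; linarith
  · obtain ⟨y, hy⟩ := ha1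
    have := (hproj (-a)).1 ⟨y, hy⟩
    simpa [sub_eq_add_neg] using this
  · intro x hx
    obtain ⟨y, hy⟩ := (hproj (x 0 - t0)).2 ⟨x, hx, by ring⟩
    have h2 : ((t0 - x 0, y) : ℝ × (Fin m → ℝ)) ∈ L' := by
      show rb_refl _ ∈ L
      simpa [rb_refl] using hy
    have := ha2 _ h2
    simp at this; linarith
  · refine ⟨z, hz, ?_⟩
    rw [volK, hom]
    have : 2 * F * (volume (rb_pol K z)).toReal ≤ 2 * F * (G + G') := by gcongr
    nlinarith
  · intro τ η h1 h2 h0 h3 h4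
    have h5 := h4 z hz
    rw [volK, hom] at h5
    have h6 : 2 * F * (volume (rb_pol K z)).toReal ≤ 2 * F * (G + G') := by gcongr
    have hη : 2 * η ≤ 1 := by
      refine h3.trans ?_
      rw [div_le_one (by positivity)]
      have : τ ^ (m + 2) ≤ 1 := pow_le_one₀ h1.le (by linarith)
      have : (1:ℝ) ≤ 4 ^ m := one_le_pow₀ (by norm_num)
      linarith
    have h7 : ((1 - 2 * η) * I) ^ 2 ≤ (1 - 2 * η) * I ^ 2 := by
      rw [mul_pow]
      have : (1 - 2 * η) ^ 2 ≤ 1 - 2 * η := by nlinarith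
      gcongr
    obtain ⟨A, hA1, hA2, hA3⟩ := s4 τ (2 * η) h1 h2 h3 (by nlinarith)
    obtain ⟨A', hA1', hA2', hA3'⟩ := s4' τ (2 * η) h1 h2 h3 (by nlinarith)
    refine ⟨⟨A, hA1, hA2, ?_⟩, ⟨A', hA1', hA2', ?_⟩⟩
    · intro x hx1 hx2
      have := hA3 x hx1 hx2
      rw [hmarg _ measurableSet_Ioc] at this
      have e : K ∩ {y | y 0 - t0 ∈ Set.Ioc 0 x} = K ∩ {y | y 0 ∈ Set.Ioc t0 (t0 + x)} := by
        ext y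
        simp only [Set.mem_inter_iff, Set.mem_setOf_eq, Set.mem_Ioc, sub_pos, sub_le_iff_le_add']
      rw [e] at this
      exact this
    · intro x hx1 hx2
      have := hA3' x hx1 hx2
      rw [hmarg' _ measurableSet_Ioc] at this
      have e : K ∩ {y | t0 - y 0 ∈ Set.Ioc 0 x} = K ∩ {y | y 0 ∈ Set.Ico (t0 - x) t0} := by
        ext y
        simp only [Set.mem_inter_iff, Set.mem_setOf_eq, Set.mem_Ioc, Set.mem_Ico, sub_pos, sub_le_comm]
        tauto
      rw [e] at this
      exact this

/-! part 12 -/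

def rb_Lam (m : ℕ) : ℝ := 100 * 4 ^ (m + 4) * (m + 1)

def rb_k (m : ℕ) : ℝ := 1 + 2 * (9 * 4 ^ (m + 2))

lemma rb_Lam_ge (m : ℕ) : 25600 * ((m : ℝ) + 1) ≤ rb_Lam m ∧ 2 * rb_k m ≤ rb_Lam m ∧ 289 ≤ rb_k m := by
  unfold rb_Lam rb_k
  have h : (1:ℝ) ≤ 4 ^ m := one_le_pow₀ (by norm_num)
  have hm : (0:ℝ) ≤ m := Nat.cast_nonneg m
  rw [pow_add, pow_add]
  refine ⟨?_, ?_, ?_⟩ <;> nlinarith [mul_nonneg (sub_nonneg.2 h) hm]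

/-- the two-sided estimate, in terms of the tail `Q` -/
def rb_est (m : ℕ) (τ e A : ℝ) (Q : ℝ → ℝ) : Prop :=
  ∀ x, 2 * A * Real.sqrt τ ≤ x → x ≤ A * (1 - 2 * τ) →
    rb_w m (x / A * (1 - τ)) - e ≤ 1 - Q x ∧ 1 - Q x ≤ rb_w m (x / A * (1 + τ)) + e

set_option maxHeartbeats 1600000 in
lemma rb_Jzero {m : ℕ} (hm : 1 ≤ m) {τ e A b : ℝ} {Q : ℝ → ℝ} (hτ : 0 < τ) (hτ1 : rb_Lam m * τ ≤ 1)
    (he : e ≤ τ ^ (m + 2)) (hA : 0 < A) (hQ : AntitoneOn Q (Set.Ici 0))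
    (hh : ∀ x, 0 ≤ x → x ≤ b → Q x / 2 ^ (m + 1) ≤ Q ((b + x) / 2))
    (hest : rb_est m τ e A Q) : b ≤ A * (1 + rb_k m * τ) := by
  by_contra hb
  push Not at hb
  obtain ⟨l1, l2, l3⟩ := rb_Lam_ge m
  have hkτ : rb_k m * τ ≤ 1 / 2 := by nlinarith
  have hm0 : (0:ℝ) ≤ m := Nat.cast_nonneg m
  have hτs : τ ≤ 1 / 64 := by nlinarith
  have hs : Real.sqrt τ ≤ 1 / 8 := by
    rw [show (1:ℝ)/8 = Real.sqrt (1/64) by rw [show (1:ℝ)/64 = (1/8)^2 by norm_num]; rw [Real.sqrt_sq (by norm_num)]]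
    exact Real.sqrt_le_sqrt hτs
  have hs0 : 0 < Real.sqrt τ := Real.sqrt_pos.2 hτ
  have hJ := rb_J_pos m
  have hJ1 := rb_J_le_one m
  have hkp : 0 < rb_k m * τ := by apply mul_pos (by linarith) hτ
  have hAk : 0 < A * (rb_k m * τ) := mul_pos hA hkp
  have hk2 : 2 * τ ≤ rb_k m * τ := by gcongr; linarith
  have x1n : 0 ≤ A * (1 - rb_k m * τ) := mul_nonneg hA.le (by linarith)
  have h1 := hh (A * (1 - rb_k m * τ)) x1n (by linarith)
  have h2 : Q ((b + A * (1 - rb_k m * τ)) / 2) ≤ Q (A * (1 - 2 * τ)) := by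
    apply hQ
    · exact mul_nonneg hA.le (by linarith)
    · show (0:ℝ) ≤ _
      nlinarith
    · nlinarith
  have h3 := (hest (A * (1 - 2 * τ)) (by nlinarith) le_rfl).1
  have h4 := (hest (A * (1 - rb_k m * τ)) (by nlinarith) (by apply mul_le_mul_of_nonneg_left _ hA.le; linarith)).2
  rw [mul_div_cancel_left₀ _ hA.ne'] at h3 h4
  have h5 : rb_w m (1 - 3 * τ) ≤ rb_w m ((1 - 2 * τ) * (1 - τ)) := rb_w_mono m (by nlinarith)
  have h6 : rb_w m ((1 - rb_k m * τ) * (1 + τ)) ≤ rb_w m (1 - (rb_k m - 1) * τ) :=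
    rb_w_mono m (by nlinarith [mul_pos hkp hτ])
  have h7 := rb_tail_upper (m := m) (x := 3 * τ) (by positivity)
  have h8 := rb_tail_lower (m := m) (x := (rb_k m - 1) * τ) (by linarith) (by linarith)
  set L : ℝ := 9 * 4 ^ (m + 2) with hL
  have hkL : rb_k m - 1 = 2 * L := by unfold rb_k; ring
  rw [hkL] at h8 h6
  have hL0 : 0 < L := by positivity
  rw [show 2 * L * τ / 2 = L * τ by ring, Real.sqrt_mul hL0.le] at h8
  rw [show 2 * (3 * τ) = 6 * τ by ring, Real.sqrt_mul (by norm_num)] at h7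
  have s6 : Real.sqrt 6 ≤ 3 := by
    rw [show (3:ℝ) = Real.sqrt (3^2) by rw [Real.sqrt_sq (by norm_num)]]
    exact Real.sqrt_le_sqrt (by norm_num)
  have sL : 3 ≤ Real.sqrt L := by
    apply Real.le_sqrt_of_sq_le
    have : (1:ℝ) ≤ 4 ^ (m+2) := one_le_pow₀ (by norm_num)
    rw [hL]; linarith
  set P : ℝ := τ * Real.sqrt τ ^ m / rb_J m with hP
  have hP0 : 0 < P := by positivity
  have heP : e ≤ P := by
    refine he.trans ?_
    rw [hP, le_div_iff₀ hJ]
    have a1 : τ ^ (m + 2) * rb_J m ≤ τ ^ (m + 2) := mul_le_of_le_one_right (by positivity) hJ1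
    refine a1.trans ?_
    have a2 : τ ≤ Real.sqrt τ := by
      have := Real.mul_self_sqrt hτ.le
      have := mul_le_of_le_one_left hs0.le (show Real.sqrt τ ≤ 1 by linarith)
      linarith
    calc τ ^ (m + 2) = τ ^ m * τ * τ := by ring
      _ ≤ τ ^ m * τ * 1 := by gcongr; linarith
      _ = τ * τ ^ m := by ring
      _ ≤ _ := by gcongr
  have h7' : 1 - rb_w m (1 - 3 * τ) ≤ 3 * 3 ^ m * P := by
    refine h7.trans ?_
    rw [mul_pow, hP]
    have : Real.sqrt 6 ^ m ≤ 3 ^ m := by gcongr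
    calc 3 * τ * (Real.sqrt 6 ^ m * Real.sqrt τ ^ m) / rb_J m = 3 * Real.sqrt 6 ^ m * (τ * Real.sqrt τ ^ m / rb_J m) := by ring
      _ ≤ _ := by gcongr
  have h8' : L * 3 ^ m * P ≤ 1 - rb_w m (1 - 2 * L * τ) := by
    refine le_trans ?_ h8
    rw [mul_pow, hP]
    have : 3 ^ m ≤ Real.sqrt L ^ m := by gcongr
    calc _ ≤ L * Real.sqrt L ^ m * (τ * Real.sqrt τ ^ m / rb_J m) := by gcongr
      _ = _ := by ring
  have g1 : Q (A * (1 - 2 * τ)) ≤ (3 * 3 ^ m + 1) * P := by linarith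
  have g2 : (L * 3 ^ m - 1) * P ≤ Q (A * (1 - rb_k m * τ)) := by linarith
  have g3 : Q (A * (1 - rb_k m * τ)) ≤ 2 ^ (m + 1) * ((3 * 3 ^ m + 1) * P) := by
    have := h1.trans (h2.trans g1)
    rw [div_le_iff₀ (by positivity)] at this
    linarith
  have g4 : L * 3 ^ m - 1 ≤ 2 ^ (m + 1) * (3 * 3 ^ m + 1) := by
    have := g2.trans g3
    rw [← mul_assoc] at this
    exact le_of_mul_le_mul_right this hP0
  have p2 : (1:ℝ) ≤ 2 ^ m := one_le_pow₀ (by norm_num)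
  have p3 : (1:ℝ) ≤ 3 ^ m := one_le_pow₀ (by norm_num)
  have p4 : (4:ℝ) ^ (m + 2) = 16 * (2 ^ m * 2 ^ m) := by
    rw [← mul_pow]; norm_num [pow_add]; ring
  rw [hL, p4, pow_succ] at g4
  linarith [mul_le_mul p2 p3 (by norm_num) (by positivity), mul_nonneg (mul_nonneg (sub_nonneg.2 p2) (zero_le_one.trans p2)) (zero_le_one.trans p3), mul_le_mul_of_nonneg_left p3 (zero_le_one.trans p2)]

lemma rb_w_low {m : ℕ} {r : ℝ} (h0 : 0 ≤ r) (h1 : r ≤ 1) : 1 / rb_J m * (r * (1 - m * r ^ 2)) ≤ rb_w m r := by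
  have hJ := rb_J_pos m
  unfold rb_w
  have : ∫ x in (0:ℝ)..r, (1 / rb_J m * (1 - m * r ^ 2)) ≤ ∫ x in (0:ℝ)..r, rb_kap m x := by
    apply intervalIntegral.integral_mono_on h0 (by simp) ((rb_kap_cont m).intervalIntegrable _ _)
    intro x hx
    unfold rb_kap
    rw [div_mul_eq_mul_div, one_mul]
    apply div_le_div_of_nonneg_right _ hJ.le
    have hx1 : x ^ 2 ≤ r ^ 2 := by have := hx.1; have := hx.2; gcongr
    have hr1 : r ^ 2 ≤ 1 := by nlinarith
    have hy : 1 - x ^ 2 ≤ Real.sqrt (1 - x ^ 2) := by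
      apply Real.le_sqrt_of_sq_le; nlinarith [sq_nonneg x]
    have hb := one_add_mul_le_pow (a := -(x^2)) (by nlinarith) m
    calc 1 - m * r ^ 2 ≤ 1 - m * x ^ 2 := by
          have : (m:ℝ) * x ^ 2 ≤ m * r ^ 2 := by gcongr
          linarith
      _ ≤ (1 - x ^ 2) ^ m := by rw [sub_eq_add_neg 1 (x^2)]; linarith
      _ ≤ _ := pow_le_pow_left₀ (by nlinarith) hy m
  rw [intervalIntegral.integral_const, smul_eq_mul] at this
  linarith

lemma rb_w_up {m : ℕ} {r : ℝ} (h0 : 0 ≤ r) : rb_w m r ≤ 1 / rb_J m * r := by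
  have := rb_w_lip (m := m) h0
  rw [rb_w_zero] at this; linarith

set_option maxHeartbeats 1600000 in
lemma rb_Jtwo {m : ℕ} (hm : 1 ≤ m) {τ e A A' : ℝ} {Q Q' : ℝ → ℝ} (hτ : 0 < τ) (hτ1 : rb_Lam m * τ ≤ 1)
    (he : e ≤ τ ^ (m + 2)) (hA : 0 < A) (hA' : 0 < A') (hQ : AntitoneOn Q (Set.Ici 0))
    (hJ2 : ∀ x, 0 ≤ x → (1 - Q x) * (Q' x - Q' (2 * x)) ≤ (1 - Q' x) ^ 2)
    (hQ1 : ∀ x, 0 ≤ x → Q' x ≤ 1) (hQ0 : ∀ x, 0 ≤ x → Q x ≤ 1)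
    (hest : rb_est m τ e A Q) (hest' : rb_est m τ e A' Q') : A' ≤ A * (1 + rb_Lam m * τ) := by
  obtain ⟨l1, l2, l3⟩ := rb_Lam_ge m
  have hm0 : (1:ℝ) ≤ m := by exact_mod_cast hm
  have hmτ : ((m : ℝ) + 1) * τ ≤ 1 / 25600 := by nlinarith
  have hτs : τ ≤ 1 / 25600 := by nlinarith
  set s := Real.sqrt τ with hs_def
  have hs0 : 0 < s := Real.sqrt_pos.2 hτ
  have hss : s ^ 2 = τ := Real.sq_sqrt hτ.le
  have hs : s ≤ 1 / 160 := by
    by_contra h; push Not at h; nlinarith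
  have hJ := rb_J_pos m
  have hJ1 := rb_J_le_one m
  set R := 1 / rb_J m with hR
  have hR1 : 1 ≤ R := by rw [hR, le_div_iff₀ hJ]; linarith
  have he2 : e ≤ R * (s * τ) := by
    refine he.trans ?_
    have a0 : τ ^ (m + 2) ≤ τ ^ 2 := pow_le_pow_of_le_one hτ.le (by linarith) (by omega)
    have a1 : τ ≤ s := by rw [← hss, sq]; exact mul_le_of_le_one_left hs0.le (by linarith)
    have : τ ^ 2 ≤ s * τ := by rw [sq]; exact mul_le_mul_of_nonneg_right a1 hτ.le
    have := le_mul_of_one_le_left (mul_pos hs0 hτ).le hR1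
    linarith
  by_contra hcon
  push Not at hcon
  have hAA : A < A' := by
    have : 0 ≤ A * (rb_Lam m * τ) := by
      have : 0 ≤ rb_Lam m := by linarith
      positivity
    linarith
  set x := 2 * A' * s with hx
  have hx0 : 0 ≤ x := by positivity
  have e1 := (hest' x le_rfl (by rw [hx]; nlinarith)).2
  have e2 := (hest' (2 * x) (by linarith) (by rw [hx]; nlinarith)).1
  rw [show x / A' = 2 * s by rw [hx]; field_simp] at e1
  rw [show 2 * x / A' = 4 * s by rw [hx]; field_simp; ring] at e2
  have e1' := rb_w_up (m := m) (r := 2 * s * (1 + τ)) (by positivity)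
  have e2' := rb_w_low (m := m) (r := 4 * s * (1 - τ)) (by apply mul_nonneg <;> linarith) (by linarith [mul_pos hs0 hτ])
  rw [← hR] at e1' e2'
  have t1 : 1 - Q' x ≤ 2 * R * s * (1 + 3 / 2 * τ) := by linarith
  have t2 : 4 * R * s * (1 - (16 * m + 2) * τ) ≤ 1 - Q' (2 * x) := by
    have : 4 * s * (1 - (16 * m + 1) * τ) ≤ 4 * s * (1 - τ) * (1 - m * (4 * s * (1 - τ)) ^ 2) := by
      have a1 : (4 * s * (1 - τ)) ^ 2 ≤ 16 * τ := by
        rw [mul_pow, mul_pow, hss]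
        have q : (1 - τ) ^ 2 ≤ 1 := pow_le_one₀ (by linarith) (by linarith)
        linarith [mul_le_of_le_one_right hτ.le q]
      have a2 : m * (4 * s * (1 - τ)) ^ 2 ≤ m * (16 * τ) := by gcongr
      have a3 : 1 - (16 * m + 1) * τ ≤ (1 - τ) * (1 - m * (4 * s * (1 - τ)) ^ 2) := by
        calc _ ≤ (1 - τ) * (1 - m * (16 * τ)) := by
              have : 0 ≤ (m:ℝ) * τ ^ 2 := by positivity
              linarith
          _ ≤ _ := by gcongr; linarith
      rw [mul_assoc (4 * s)]
      exact mul_le_mul_of_nonneg_left a3 (by positivity)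
    have := mul_le_mul_of_nonneg_left this (zero_le_one.trans hR1)
    linarith [mul_pos (mul_pos (zero_lt_one.trans_le hR1) hs0) hτ]
  have t3 : 2 * R * s * (1 - (32 * m + 6) * τ) ≤ Q' x - Q' (2 * x) := by
    linarith [mul_pos (mul_pos (zero_lt_one.trans_le hR1) hs0) hτ]
  have hRs : 0 < 2 * R * s := by positivity
  have t4 : 1 - Q x ≤ 2 * R * s * (1 + (64 * m + 20) * τ) := by
    have j := hJ2 x hx0
    have q1 := hQ1 x hx0
    have q0 := hQ0 x hx0
    have a1 : (1 - Q' x) ^ 2 ≤ (2 * R * s * (1 + 3 / 2 * τ)) ^ 2 := by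
      apply pow_le_pow_left₀ (by linarith) t1
    have a2 : (1 - Q x) * (2 * R * s * (1 - (32 * m + 6) * τ)) ≤ (2 * R * s * (1 + 3 / 2 * τ)) ^ 2 :=
      (mul_le_mul_of_nonneg_left t3 (by linarith)).trans (j.trans a1)
    have a3 : (1 - Q x) * (1 - (32 * m + 6) * τ) ≤ 2 * R * s * (1 + 3 / 2 * τ) ^ 2 := by
      have : (2 * R * s) * ((1 - Q x) * (1 - (32 * m + 6) * τ)) ≤ (2 * R * s) * (2 * R * s * (1 + 3 / 2 * τ) ^ 2) := by
        linarith
      exact le_of_mul_le_mul_left this hRs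
    have c0 : (32 * m + 6) * τ ≤ 1 / 8 := by linarith
    have a4 : (1 + 3 / 2 * τ) ^ 2 ≤ (1 + (64 * m + 20) * τ) * (1 - (32 * m + 6) * τ) := by
      have h3 : τ * τ ≤ 1 / 25600 * τ := mul_le_mul_of_nonneg_right hτs hτ.le
      linarith [mul_le_mul_of_nonneg_left c0 (show 0 ≤ (64 * (m:ℝ) + 20) * τ by positivity), mul_pos (show (0:ℝ) < m by linarith) hτ]
    have a5 : (1 - Q x) * (1 - (32 * m + 6) * τ) ≤ (2 * R * s * (1 + (64 * m + 20) * τ)) * (1 - (32 * m + 6) * τ) := by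
      refine a3.trans ?_
      rw [mul_assoc (2 * R * s)]
      exact mul_le_mul_of_nonneg_left a4 hRs.le
    exact le_of_mul_le_mul_right a5 (by linarith)
  set β := min (x / A) (4 * s) with hβ
  have hβ2 : 2 * s ≤ β := by
    apply le_min
    · rw [le_div_iff₀ hA, hx]; linarith [mul_lt_mul_of_pos_left hAA hs0]
    · linarith
  have hβ4 : β ≤ 4 * s := min_le_right _ _
  have hβx : A * β ≤ x := by
    have : β ≤ x / A := min_le_left _ _
    rw [le_div_iff₀ hA] at this; linarith
  have e3 := (hest (A * β) (by linarith [mul_le_mul_of_nonneg_left hβ2 hA.le]) (by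
    have : β ≤ 1 - 2 * τ := by linarith
    exact mul_le_mul_of_nonneg_left this hA.le)).1
  rw [mul_div_cancel_left₀ _ hA.ne'] at e3
  have hβ0 : 0 < β := by linarith
  have e4 : Q x ≤ Q (A * β) := hQ (by show 0 ≤ A * β; positivity) hx0 hβx
  have e3' := rb_w_low (m := m) (r := β * (1 - τ)) (by apply mul_nonneg <;> linarith) (by linarith [mul_pos hβ0 hτ])
  rw [← hR] at e3'
  have t5 : R * β * (1 - (16 * m + 2) * τ) ≤ 1 - Q (A * β) := by
    have : β * (1 - (16 * m + 1) * τ) ≤ β * (1 - τ) * (1 - m * (β * (1 - τ)) ^ 2) := by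
      have a1 : (β * (1 - τ)) ^ 2 ≤ 16 * τ := by
        rw [mul_pow, ← hss]
        have : β ^ 2 ≤ (4 * s) ^ 2 := pow_le_pow_left₀ hβ0.le hβ4 2
        have q : (1 - s ^ 2) ^ 2 ≤ 1 := by rw [hss]; exact pow_le_one₀ (by linarith) (by linarith)
        have := mul_le_of_le_one_right (sq_nonneg β) q
        linarith
      have a2 : m * (β * (1 - τ)) ^ 2 ≤ m * (16 * τ) := by gcongr
      have a3 : 1 - (16 * m + 1) * τ ≤ (1 - τ) * (1 - m * (β * (1 - τ)) ^ 2) := by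
        calc _ ≤ (1 - τ) * (1 - m * (16 * τ)) := by
              have : 0 ≤ (m:ℝ) * τ ^ 2 := by positivity
              linarith
          _ ≤ _ := by gcongr; linarith
      rw [mul_assoc β]
      exact mul_le_mul_of_nonneg_left a3 hβ0.le
    have := mul_le_mul_of_nonneg_left this (zero_le_one.trans hR1)
    have : R * (s * τ) ≤ R * (β * τ) := by gcongr; linarith
    linarith
  have t6 : β * (1 - (16 * m + 2) * τ) ≤ 2 * s * (1 + (64 * m + 20) * τ) := by
    have : R * (β * (1 - (16 * m + 2) * τ)) ≤ R * (2 * s * (1 + (64 * m + 20) * τ)) := by linarith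
    exact le_of_mul_le_mul_left this (by linarith)
  have t7 : β ≤ 2 * s * (1 + (200 * m + 100) * τ) := by
    have c0 : (16 * m + 2) * τ ≤ 1 / 8 := by linarith
    have a4 : 1 + (64 * m + 20) * τ ≤ (1 + (200 * m + 100) * τ) * (1 - (16 * m + 2) * τ) := by
      linarith [mul_le_mul_of_nonneg_left c0 (show 0 ≤ (200 * (m:ℝ) + 100) * τ by positivity), mul_pos (show (0:ℝ) < m by linarith) hτ]
    have : β * (1 - (16 * m + 2) * τ) ≤ 2 * s * (1 + (200 * m + 100) * τ) * (1 - (16 * m + 2) * τ) := by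
      refine t6.trans ?_
      rw [mul_assoc (2 * s)]
      exact mul_le_mul_of_nonneg_left a4 (by positivity)
    exact le_of_mul_le_mul_right this (by linarith)
  have t8 : β < 4 * s := by
    have : (200 * (m:ℝ) + 100) * τ < 1 := by linarith
    have := mul_lt_mul_of_pos_left this hs0
    linarith
  have t9 : β = x / A := by
    rcases min_choice (x / A) (4 * s) with h | h
    · rw [hβ, h]
    · exfalso; rw [hβ, h] at t8; exact lt_irrefl _ t8
  rw [t9, div_le_iff₀ hA, hx] at t7
  have t10 : A' ≤ A * (1 + (200 * m + 100) * τ) := by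
    have : (2 * s) * A' ≤ (2 * s) * (A * (1 + (200 * m + 100) * τ)) := by linarith
    exact le_of_mul_le_mul_left this (by positivity)
  have : (200 * (m:ℝ) + 100) * τ ≤ rb_Lam m * τ := by gcongr; linarith
  linarith [mul_le_mul_of_nonneg_left this hA.le]

/-! part 13 -/

def rb_M1 (m : ℕ) : ℝ := ∫ x in (0:ℝ)..1, (1 - rb_w m x)
def rb_M2 (m : ℕ) : ℝ := ∫ x in (0:ℝ)..1, 2 * x * (1 - rb_w m x)

lemma rb_w_cont (m : ℕ) : Continuous (rb_w m) :=
  continuous_iff_continuousAt.2 fun r => (rb_w_deriv m r).continuousAt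

lemma rb_M2_pos {m : ℕ} : 0 < rb_M2 m := by
  have hJ := rb_J_pos m
  have hc : Continuous fun x => 2 * x * (1 - rb_w m x) := by
    have := rb_w_cont m; fun_prop
  have hwlt : ∀ x ∈ Set.Ioo (0:ℝ) 1, rb_w m x < 1 := by
    intro x hx
    have := rb_tail_lower (m := m) (x := 1 - x) (by linarith [hx.2]) (by linarith [hx.1])
    have h0 : 0 < 1 - x := by linarith [hx.2]
    have : 0 < (1 - x) / 2 * Real.sqrt ((1 - x) / 2) ^ m / rb_J m := by positivity
    simp only [sub_sub_cancel] at *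
    linarith
  apply intervalIntegral.intervalIntegral_pos_of_pos_on (hc.intervalIntegrable _ _) _ zero_lt_one
  intro x hx
  have := hwlt x hx
  have := hx.1
  have : 0 < 1 - rb_w m x := by linarith
  positivity

lemma rb_mom_w {m : ℕ} (hm : 1 ≤ m) {A B : ℝ} (hA : 0 < A) (hB : A ≤ B) :
    (∫ x in (0:ℝ)..B, (1 - rb_w m (x / A))) = A * rb_M1 m ∧
    (∫ x in (0:ℝ)..B, 2 * x * (1 - rb_w m (x / A))) = A ^ 2 * rb_M2 m := by
  have hBA : 1 ≤ B / A := by rw [le_div_iff₀ hA]; linarith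
  have key : ∀ g : ℝ → ℝ, Continuous g →
      (∫ x in (0:ℝ)..(B / A), g x * (1 - rb_w m x)) = ∫ x in (0:ℝ)..1, g x * (1 - rb_w m x) := by
    intro g hg
    have hc : Continuous fun x => g x * (1 - rb_w m x) := by
      have := rb_w_cont m; fun_prop
    rw [← intervalIntegral.integral_add_adjacent_intervals (hc.intervalIntegrable 0 1) (hc.intervalIntegrable 1 (B/A))]
    have : (∫ x in (1:ℝ)..(B / A), g x * (1 - rb_w m x)) = ∫ x in (1:ℝ)..(B / A), (0:ℝ) := by
      apply intervalIntegral.integral_congr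
      intro x hx
      rw [Set.uIcc_of_le hBA] at hx
      simp [rb_w_one_of_ge hm hx.1]
    rw [this]; simp
  constructor
  · have h1 := intervalIntegral.integral_comp_div (a := 0) (b := B) (fun x => 1 - rb_w m x) hA.ne'
    rw [h1, zero_div, smul_eq_mul]
    have := key (fun _ => 1) (by fun_prop)
    simp only [one_mul] at this
    rw [this, rb_M1]
  · have h1 := intervalIntegral.integral_comp_div (a := 0) (b := B) (fun x => (2 * x) * (1 - rb_w m x)) hA.ne'
    rw [zero_div, smul_eq_mul, key (fun x => 2 * x) (by fun_prop)] at h1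
    have h2 : (∫ x in (0:ℝ)..B, 2 * x * (1 - rb_w m (x / A))) =
        A * ∫ x in (0:ℝ)..B, 2 * (x / A) * (1 - rb_w m (x / A)) := by
      rw [← intervalIntegral.integral_const_mul]
      congr 1; ext x; field_simp
    rw [h2, h1, rb_M2]; ring

def rb_C (m : ℕ) : ℝ := 9 * (1 / rb_J m) + rb_k m + 5

set_option maxHeartbeats 1000000 in
lemma rb_mom {m : ℕ} (hm : 1 ≤ m) {τ e A : ℝ} {Q : ℝ → ℝ} (hτ : 0 < τ) (hτ1 : rb_Lam m * τ ≤ 1)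
    (he : e ≤ τ ^ (m + 2)) (hA : 0 < A) (hQ : AntitoneOn Q (Set.Ici 0))
    (hQ0 : ∀ x, 0 ≤ x → 0 ≤ Q x) (hQ1 : ∀ x, 0 ≤ x → Q x ≤ 1)
    (hest : rb_est m τ e A Q) {g : ℝ → ℝ} (hg : Continuous g) {G : ℝ}
    (hG : ∀ x, 0 ≤ x → x ≤ A * (1 + rb_k m * τ) → |g x| ≤ G) :
    |(∫ x in (0:ℝ)..(A * (1 + rb_k m * τ)), g x * Q x) -
      ∫ x in (0:ℝ)..(A * (1 + rb_k m * τ)), g x * (1 - rb_w m (x / A))| ≤ G * (rb_C m * τ * A) := by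
  obtain ⟨l1, l2, l3⟩ := rb_Lam_ge m
  have hm0 : (1:ℝ) ≤ m := by exact_mod_cast hm
  have hτs : τ ≤ 1 / 25600 := by nlinarith
  set s := Real.sqrt τ with hs_def
  have hs0 : 0 < s := Real.sqrt_pos.2 hτ
  have hss : s * s = τ := Real.mul_self_sqrt hτ.le
  have hs : s ≤ 1 / 160 := by
    by_contra h; push Not at h; nlinarith
  have hτle : τ ≤ s := by rw [← hss]; exact mul_le_of_le_one_left hs0.le (by linarith)
  have hJ := rb_J_pos m
  have hJ1 := rb_J_le_one m
  set R := 1 / rb_J m with hR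
  have hR1 : 1 ≤ R := by rw [hR, le_div_iff₀ hJ]; linarith
  have he2 : e ≤ τ := by
    refine he.trans ?_
    calc τ ^ (m + 2) ≤ τ ^ 1 := pow_le_pow_of_le_one hτ.le (by linarith) (by omega)
      _ = τ := pow_one τ
  have hkp : 0 < rb_k m * τ := mul_pos (by linarith) hτ
  set B := A * (1 + rb_k m * τ) with hB
  have hBA : A ≤ B := by rw [hB]; linarith [mul_pos hA hkp]
  have hG0 : 0 ≤ G := (abs_nonneg _).trans (hG 0 le_rfl (by linarith))
  set x1 := 2 * A * s with hx1
  set x2 := A * (1 - 2 * τ) with hx2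
  have h01 : 0 ≤ x1 := by positivity
  have h12 : x1 ≤ x2 := by rw [hx1, hx2]; linarith [mul_le_mul_of_nonneg_left hs hA.le, mul_le_mul_of_nonneg_left hτs hA.le]
  have h2B : x2 ≤ B := by rw [hx2]; linarith [mul_pos hA hτ]
  have hQi : ∀ a b, 0 ≤ a → a ≤ b → IntervalIntegrable (fun x => g x * Q x) volume a b := by
    intro a b ha hab
    apply IntervalIntegrable.continuousOn_mul _ hg.continuousOn
    apply AntitoneOn.intervalIntegrable
    rw [Set.uIcc_of_le hab]
    exact hQ.mono (fun x hx => ha.trans hx.1)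
  have hwc : Continuous fun x => g x * (1 - rb_w m (x / A)) := by
    have := rb_w_cont m; fun_prop
  rw [← intervalIntegral.integral_sub (hQi 0 B le_rfl (by linarith)) (hwc.intervalIntegrable _ _)]
  set D : ℝ → ℝ := fun x => g x * Q x - g x * (1 - rb_w m (x / A)) with hD
  have hDi : ∀ a b, 0 ≤ a → a ≤ b → IntervalIntegrable D volume a b := fun a b ha hab =>
    (hQi a b ha hab).sub (hwc.intervalIntegrable _ _)
  have hDeq : ∀ x, D x = g x * (rb_w m (x / A) - (1 - Q x)) := by intro x; simp only [hD]; ring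
  have hDb : ∀ x c, 0 ≤ x → x ≤ B → |rb_w m (x / A) - (1 - Q x)| ≤ c → ‖D x‖ ≤ G * c := by
    intro x c h0 h1 h2
    rw [hDeq, Real.norm_eq_abs, abs_mul]
    exact mul_le_mul (hG x h0 h1) h2 (abs_nonneg _) hG0
  have i1 : ‖∫ x in (0:ℝ)..x1, D x‖ ≤ G * ((4 * R + 1) * s) * |x1 - 0| := by
    apply intervalIntegral.norm_integral_le_of_norm_le_const
    intro x hx
    rw [Set.uIoc_of_le h01] at hx
    apply hDb x _ hx.1.le (by linarith [hx.2])
    have a1 := (hest x1 le_rfl h12).2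
    rw [show x1 / A = 2 * s by rw [hx1]; field_simp] at a1
    have a2 := rb_w_up (m := m) (r := 2 * s * (1 + τ)) (by positivity)
    rw [← hR] at a2
    have a3 : Q x1 ≤ Q x := hQ hx.1.le h01 hx.2
    have a4 := hQ1 x hx.1.le
    have hxA : 0 ≤ x / A := div_nonneg hx.1.le hA.le
    have a5 := rb_w_up (m := m) (r := x / A) hxA
    have a6 := rb_w_nonneg (m := m) hxA
    rw [← hR] at a5
    have a7 : x / A ≤ 2 * s := by
      rw [div_le_iff₀ hA]; linarith [hx.2]
    have a8 : R * (x / A) ≤ R * (2 * s) := mul_le_mul_of_nonneg_left a7 (by linarith)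
    have a9 : R * (s * τ) ≤ R * (s * (1 / 25600)) := by gcongr
    have a10 : 0 < R * s := by positivity
    rw [abs_le]; constructor <;> linarith
  have i2 : ‖∫ x in x1..x2, D x‖ ≤ G * ((R + 1) * τ) * |x2 - x1| := by
    apply intervalIntegral.norm_integral_le_of_norm_le_const
    intro x hx
    rw [Set.uIoc_of_le h12] at hx
    have hx0 : 0 ≤ x := by linarith [hx.1]
    apply hDb x _ hx0 (by linarith [hx.2])
    obtain ⟨a1, a2⟩ := hest x hx.1.le hx.2
    have hxA : 0 ≤ x / A := div_nonneg hx0 hA.le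
    have hxA1 : x / A ≤ 1 := by
      rw [div_le_one hA]; linarith [hx.2, mul_pos hA hτ]
    have a3 := rb_w_lip (m := m) (x := x / A * (1 - τ)) (y := x / A) (by linarith [mul_nonneg hxA hτ.le])
    have a4 := rb_w_lip (m := m) (x := x / A) (y := x / A * (1 + τ)) (by linarith [mul_nonneg hxA hτ.le])
    rw [← hR] at a3 a4
    have a5 : R * (x / A * τ) ≤ R * (1 * τ) := by gcongr
    rw [abs_le]; constructor <;> linarith
  have i3 : ‖∫ x in x2..B, D x‖ ≤ G * 1 * |B - x2| := by
    apply intervalIntegral.norm_integral_le_of_norm_le_const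
    intro x hx
    rw [Set.uIoc_of_le h2B] at hx
    have hx0 : 0 ≤ x := by linarith [hx.1]
    apply hDb x _ hx0 hx.2
    have hxA : 0 ≤ x / A := div_nonneg hx0 hA.le
    have b1 := hQ0 x hx0
    have b2 := hQ1 x hx0
    have b3 := rb_w_nonneg (m := m) hxA
    have b4 := rb_w_le_one hm (x / A)
    rw [abs_le]; constructor <;> linarith
  rw [← intervalIntegral.integral_add_adjacent_intervals (hDi 0 x1 le_rfl h01) (hDi x1 B h01 (by linarith)),
    ← intervalIntegral.integral_add_adjacent_intervals (hDi x1 x2 h01 h12) (hDi x2 B (by linarith) h2B)]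
  rw [abs_of_nonneg (by linarith)] at i1 i2 i3
  rw [Real.norm_eq_abs] at i1 i2 i3
  have t1 := abs_add_le (∫ x in (0:ℝ)..x1, D x) ((∫ x in x1..x2, D x) + ∫ x in x2..B, D x)
  have t2 := abs_add_le (∫ x in x1..x2, D x) (∫ x in x2..B, D x)
  have f1 : G * ((4 * R + 1) * s) * (x1 - 0) = G * ((8 * R + 2) * τ * A) := by rw [hx1, ← hss]; ring
  have f2 : G * ((R + 1) * τ) * (x2 - x1) ≤ G * ((R + 1) * τ * A) := by
    have : x2 - x1 ≤ A := by rw [hx2]; linarith [mul_pos hA hτ]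
    have : G * ((R + 1) * τ) * (x2 - x1) ≤ G * ((R + 1) * τ) * A := by gcongr
    linarith
  have f3 : G * 1 * (B - x2) = G * ((rb_k m + 2) * τ * A) := by rw [hB, hx2]; ring
  have f4 : G * (rb_C m * τ * A) = G * ((8 * R + 2) * τ * A) + G * ((R + 1) * τ * A) + G * ((rb_k m + 2) * τ * A) := by
    rw [rb_C, ← hR]; ring
  linarith

/-! part 14 -/

/-- tail of the volume of `K` in the direction `ℓ` -/
def rb_T {n : ℕ} (K : Set (Fin n → ℝ)) (ℓ : (Fin n → ℝ) →L[ℝ] ℝ) (c x : ℝ) : ℝ :=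
  (volume (K ∩ {y | c + x < ℓ y})).toReal

lemma rb_T_anti {n : ℕ} {K : Set (Fin n → ℝ)} (hK : IsCompact K) (ℓ : (Fin n → ℝ) →L[ℝ] ℝ) (c : ℝ) :
    Antitone (rb_T K ℓ c) := by
  intro x y hxy
  apply ENNReal.toReal_mono (measure_ne_top_of_subset Set.inter_subset_left hK.measure_lt_top.ne)
  apply measure_mono
  rintro z ⟨h1, h2⟩
  refine ⟨h1, ?_⟩
  simp only [Set.mem_setOf_eq] at *
  linarith

lemma rb_T_nonneg {n : ℕ} (K : Set (Fin n → ℝ)) (ℓ : (Fin n → ℝ) →L[ℝ] ℝ) (c x : ℝ) : 0 ≤ rb_T K ℓ c x :=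
  ENNReal.toReal_nonneg

lemma rb_T_sub {n : ℕ} {K : Set (Fin n → ℝ)} (hK : IsCompact K) (ℓ : (Fin n → ℝ) →L[ℝ] ℝ) (c : ℝ) {x y : ℝ}
    (hxy : x ≤ y) : rb_T K ℓ c x - rb_T K ℓ c y = (volume (K ∩ {z | c + x < ℓ z ∧ ℓ z ≤ c + y})).toReal := by
  have fin : ∀ S, volume (K ∩ S) ≠ ⊤ := fun S =>
    measure_ne_top_of_subset Set.inter_subset_left hK.measure_lt_top.ne
  have hm : MeasurableSet (K ∩ {z | c + y < ℓ z}) :=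
    hK.measurableSet.inter (measurableSet_lt measurable_const ℓ.continuous.measurable)
  have e : K ∩ {z | c + x < ℓ z} = (K ∩ {z | c + x < ℓ z ∧ ℓ z ≤ c + y}) ∪ (K ∩ {z | c + y < ℓ z}) := by
    ext z
    simp only [Set.mem_inter_iff, Set.mem_setOf_eq, Set.mem_union]
    constructor
    · rintro ⟨h1, h2⟩
      rcases le_or_gt (ℓ z) (c + y) with h | h
      · exact Or.inl ⟨h1, h2, h⟩
      · exact Or.inr ⟨h1, h⟩
    · rintro (⟨h1, h2, h3⟩ | ⟨h1, h2⟩)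
      · exact ⟨h1, h2⟩
      · exact ⟨h1, by linarith⟩
  unfold rb_T
  rw [e, measure_union _ hm, ENNReal.toReal_add (fin _) (fin _)]
  · ring
  · rw [Set.disjoint_left]
    rintro z ⟨_, _, h1⟩ ⟨_, h2⟩
    simp only [Set.mem_setOf_eq] at h2
    linarith

lemma rb_T_homot {n : ℕ} {K : Set (Fin n → ℝ)} (hK : IsCompact K) (hconv : Convex ℝ K)
    (ℓ : (Fin n → ℝ) →L[ℝ] ℝ) (c : ℝ) {b x : ℝ} {p : Fin n → ℝ} (hp : p ∈ K) (hpb : ℓ p = c + b)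
    {t : ℝ} (ht0 : 0 < t) (ht1 : t ≤ 1) :
    t ^ n * rb_T K ℓ c x ≤ rb_T K ℓ c ((1 - t) * b + t * x) := by
  have fin : ∀ S, volume (K ∩ S) ≠ ⊤ := fun S =>
    measure_ne_top_of_subset Set.inter_subset_left hK.measure_lt_top.ne
  have h1 : AffineMap.homothety p t '' (K ∩ {y | c + x < ℓ y}) ⊆ K ∩ {y | c + ((1 - t) * b + t * x) < ℓ y} := by
    rintro _ ⟨y, ⟨hy1, hy2⟩, rfl⟩
    rw [AffineMap.homothety_apply]
    simp only [vsub_eq_sub, vadd_eq_add]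
    refine ⟨?_, ?_⟩
    · have := hconv hp hy1 (show 0 ≤ 1 - t by linarith) ht0.le (by ring)
      convert this using 1
      module
    · simp only [Set.mem_setOf_eq] at *
      simp only [map_add, map_smul, map_sub, smul_eq_mul, hpb]
      nlinarith
  have h2 := measure_mono (μ := volume) h1
  rw [Measure.addHaar_image_homothety] at h2
  have h3 := ENNReal.toReal_mono (fin _) h2
  rw [ENNReal.toReal_mul, ENNReal.toReal_ofReal (abs_nonneg _), abs_of_pos (by positivity)] at h3
  simpa [rb_T] using h3

lemma rb_T_bm {n : ℕ} {K : Set (Fin n → ℝ)} (hK : IsCompact K) (hconv : Convex ℝ K)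
    (ℓ : (Fin n → ℝ) →L[ℝ] ℝ) (c : ℝ) {x : ℝ} (hx : 0 ≤ x) :
    (rb_T K ℓ c 0 - rb_T K ℓ c x) * (rb_T K (-ℓ) (-c) x - rb_T K (-ℓ) (-c) (2 * x)) ≤
      (rb_T K (-ℓ) (-c) 0 - rb_T K (-ℓ) (-c) x) ^ 2 := by
  have fin : ∀ S, volume (K ∩ S) ≠ ⊤ := fun S =>
    measure_ne_top_of_subset Set.inter_subset_left hK.measure_lt_top.ne
  rw [rb_T_sub hK _ _ hx, rb_T_sub hK _ _ hx, rb_T_sub hK _ _ (by linarith)]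
  have ms : ∀ (g : (Fin n → ℝ) →L[ℝ] ℝ) (u v : ℝ), MeasurableSet (K ∩ {z | u < g z ∧ g z ≤ v}) := fun g u v =>
    hK.measurableSet.inter ((measurableSet_lt measurable_const g.continuous.measurable).inter
      (measurableSet_le g.continuous.measurable measurable_const))
  have key := rb_bm_set (a := 1/2) (b := 1/2) (by norm_num) (by norm_num) (by norm_num)
    (ms ℓ (c + 0) (c + x)) (ms (-ℓ) (-c + x) (-c + 2 * x)) (ms (-ℓ) (-c + 0) (-c + x)) (by
      rintro u ⟨hu1, hu2, hu3⟩ v ⟨hv1, hv2, hv3⟩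
      refine ⟨hconv hu1 hv1 (by norm_num) (by norm_num) (by norm_num), ?_⟩
      simp only [Set.mem_setOf_eq, ContinuousLinearMap.neg_apply, map_add, map_smul, smul_eq_mul] at *
      constructor <;> linarith)
  have k2 := ENNReal.toReal_mono (fin _) key
  rw [ENNReal.toReal_mul, ← ENNReal.toReal_rpow, ← ENNReal.toReal_rpow, ← Real.sqrt_eq_rpow, ← Real.sqrt_eq_rpow] at k2
  rw [← Real.sqrt_mul ENNReal.toReal_nonneg] at k2
  exact Real.sqrt_le_iff.1 k2 |>.2

lemma rb_layerK {n : ℕ} {K : Set (Fin n → ℝ)} (hK : IsCompact K)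
    (ℓ : (Fin n → ℝ) →L[ℝ] ℝ) (c : ℝ) {B : ℝ} (hB0 : 0 ≤ B) (hB : ∀ y ∈ K, ℓ y ≤ c + B) {g : ℝ → ℝ}
    (hg : Continuous g) (hg0 : ∀ x, 0 ≤ x → 0 ≤ g x) :
    ∫ y in K, (∫ t in (0:ℝ)..(max (ℓ y - c) 0), g t) = ∫ x in (0:ℝ)..B, g x * rb_T K ℓ c x := by
  have fin : ∀ S, volume (K ∩ S) ≠ ⊤ := fun S =>
    measure_ne_top_of_subset Set.inter_subset_left hK.measure_lt_top.ne
  have hfc : Continuous fun y => max (ℓ y - c) 0 := by fun_prop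
  have h := lintegral_comp_eq_lintegral_meas_lt_mul (volume.restrict K) (f := fun y => max (ℓ y - c) 0) (g := g)
    (Filter.Eventually.of_forall fun y => le_max_right _ _) hfc.measurable.aemeasurable
    (fun t _ => hg.intervalIntegrable _ _)
    ((ae_restrict_iff' measurableSet_Ioi).2 (Filter.Eventually.of_forall fun t ht => hg0 t (le_of_lt ht)))
  have hGc : Continuous fun x : ℝ => ∫ t in (0:ℝ)..x, g t :=
    intervalIntegral.continuous_primitive (fun a b => hg.intervalIntegrable a b) 0
  have hGf : Continuous fun y => ∫ t in (0:ℝ)..(max (ℓ y - c) 0), g t := hGc.comp hfc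
  rw [integral_eq_lintegral_of_nonneg_ae _ hGf.aestronglyMeasurable, h]
  · have hTm : Measurable (rb_T K ℓ c) := (rb_T_anti hK ℓ c).measurable
    have e1 : ∫ x in (0:ℝ)..B, g x * rb_T K ℓ c x = ∫ x in Set.Ioi (0:ℝ), g x * rb_T K ℓ c x := by
      rw [intervalIntegral.integral_of_le hB0]
      symm
      apply setIntegral_eq_of_subset_of_forall_diff_eq_zero measurableSet_Ioi
      · intro x hx; exact hx.1
      · intro x hx
        have hxB : B < x := by
          by_contra hh
          exact hx.2 ⟨hx.1, by linarith⟩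
        have : K ∩ {y | c + x < ℓ y} = ∅ := by
          ext y
          simp only [Set.mem_inter_iff, Set.mem_setOf_eq, Set.mem_empty_iff_false, iff_false, not_and, not_lt]
          intro hy
          linarith [hB y hy]
        simp [rb_T, this]
    rw [e1, integral_eq_lintegral_of_nonneg_ae _ (by fun_prop)]
    · congr 1
      apply setLIntegral_congr_fun measurableSet_Ioi
      intro t ht
      simp only
      have e2 : (volume.restrict K) {a | t < max (ℓ a - c) 0} = volume (K ∩ {y | c + t < ℓ y}) := by
        rw [Measure.restrict_apply (measurableSet_lt measurable_const hfc.measurable), Set.inter_comm]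
        congr 1
        ext y
        simp only [Set.mem_inter_iff, Set.mem_setOf_eq, and_congr_right_iff, lt_max_iff]
        intro _
        have := ht.out
        constructor
        · rintro (h | h) <;> linarith
        · intro h; left; linarith
      rw [e2, ENNReal.ofReal_mul (hg0 t (le_of_lt ht)), rb_T, ENNReal.ofReal_toReal (fin _), mul_comm]
    · refine (ae_restrict_iff' measurableSet_Ioi).2 (Filter.Eventually.of_forall fun t ht => ?_)
      exact mul_nonneg (hg0 t (le_of_lt ht)) (rb_T_nonneg _ _ _ _)
  · refine Filter.Eventually.of_forall fun y => ?_
    exact intervalIntegral.integral_nonneg (le_max_right _ _) (fun u hu => hg0 u hu.1)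

lemma rb_moments {n : ℕ} {K : Set (Fin n → ℝ)} (hK : IsCompact K)
    (ℓ : (Fin n → ℝ) →L[ℝ] ℝ) (c : ℝ) {B B' : ℝ} (hB0 : 0 ≤ B) (hB : ∀ y ∈ K, ℓ y ≤ c + B)
    (hB0' : 0 ≤ B') (hB' : ∀ y ∈ K, c - B' ≤ ℓ y) :
    (∫ y in K, (ℓ y - c)) = (∫ x in (0:ℝ)..B, rb_T K ℓ c x) - (∫ x in (0:ℝ)..B', rb_T K (-ℓ) (-c) x) ∧
    (∫ y in K, (ℓ y - c) ^ 2) = (∫ x in (0:ℝ)..B, 2 * x * rb_T K ℓ c x) + (∫ x in (0:ℝ)..B', 2 * x * rb_T K (-ℓ) (-c) x) := by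
  have hB'' : ∀ y ∈ K, (-ℓ) y ≤ -c + B' := fun y hy => by
    have := hB' y hy
    simp only [ContinuousLinearMap.neg_apply]; linarith
  have a1 := rb_layerK hK ℓ c hB0 hB (g := fun _ => 1) continuous_const (fun _ _ => zero_le_one)
  have a2 := rb_layerK hK (-ℓ) (-c) hB0' hB'' (g := fun _ => 1) continuous_const (fun _ _ => zero_le_one)
  have b1 := rb_layerK hK ℓ c hB0 hB (g := fun x => 2 * x) (by fun_prop) (fun _ _ => by positivity)
  have b2 := rb_layerK hK (-ℓ) (-c) hB0' hB'' (g := fun x => 2 * x) (by fun_prop) (fun _ _ => by positivity)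
  have i2 : ∀ u : ℝ, ∫ t in (0:ℝ)..u, 2 * t = u ^ 2 := by
    intro u
    rw [intervalIntegral.integral_const_mul, integral_id]; ring
  simp only [one_mul, intervalIntegral.integral_const, smul_eq_mul, mul_one, sub_zero, i2, ContinuousLinearMap.neg_apply] at a1 a2 b1 b2
  have ci : ∀ f : (Fin n → ℝ) → ℝ, Continuous f → IntegrableOn f K := fun f hf =>
    hf.continuousOn.integrableOn_compact hK
  constructor
  · rw [← a1, ← a2, ← integral_sub (ci _ (by fun_prop)) (ci _ (by fun_prop))]
    congr 1; ext y
    rcases le_total (ℓ y) c with h | h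
    · rw [max_eq_right (by linarith), max_eq_left (by linarith)]; ring
    · rw [max_eq_left (by linarith), max_eq_right (by linarith)]; ring
  · rw [← b1, ← b2, ← integral_add (ci _ (by fun_prop)) (ci _ (by fun_prop))]
    congr 1; ext y
    rcases le_total (ℓ y) c with h | h
    · rw [max_eq_right (by linarith), max_eq_left (by linarith)]; ring
    · rw [max_eq_left (by linarith), max_eq_right (by linarith)]; ring

/-! part 15 -/

lemma rb_M1_bd {m : ℕ} (hm : 1 ≤ m) : 0 ≤ rb_M1 m ∧ rb_M1 m ≤ 1 ∧ rb_M2 m ≤ 1 := by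
  have hw := rb_w_cont m
  have h1 : ∫ x in (0:ℝ)..1, (1:ℝ) = 1 := by simp
  have h2 : ∫ x in (0:ℝ)..1, (2 * x : ℝ) = 1 := by
    rw [intervalIntegral.integral_const_mul, integral_id]; norm_num
  refine ⟨?_, ?_, ?_⟩
  · exact intervalIntegral.integral_nonneg zero_le_one fun x hx => by linarith [rb_w_le_one hm x]
  · refine le_of_le_of_eq ?_ h1
    apply intervalIntegral.integral_mono_on zero_le_one (Continuous.intervalIntegrable (by fun_prop) _ _)
      (Continuous.intervalIntegrable (by fun_prop) _ _)
    intro x hx; linarith [rb_w_nonneg (m := m) hx.1]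
  · refine le_of_le_of_eq ?_ h2
    apply intervalIntegral.integral_mono_on zero_le_one (Continuous.intervalIntegrable (by fun_prop) _ _)
      (Continuous.intervalIntegrable (by fun_prop) _ _)
    intro x hx
    exact mul_le_of_le_one_right (by linarith [hx.1]) (by linarith [rb_w_nonneg (m := m) hx.1])

def rb_C2 (m : ℕ) : ℝ := 13 * rb_C m + 5 * rb_Lam m + rb_k m

lemma rb_C_pos (m : ℕ) : 1 ≤ rb_C m := by
  unfold rb_C
  have := rb_J_pos m
  have : 0 < 1 / rb_J m := by positivity
  have := (rb_Lam_ge m).2.2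
  linarith

lemma rb_combine {M1 M2 C1 L k τ A A' I I' S S' b : ℝ} (hτ : 0 < τ) (hA : 0 < A) (hA' : 0 < A')
    (h1 : 0 ≤ M1) (h2 : M1 ≤ 1) (h3 : 0 ≤ M2) (h4 : M2 ≤ 1) (hC : 0 ≤ C1) (hL : 0 ≤ L) (hk : 2 ≤ k)
    (hLτ : L * τ ≤ 1) (hbig : (3 * C1 + 2 * L) * τ ≤ 1)
    (a1 : A' ≤ A * (1 + L * τ)) (a2 : A ≤ A' * (1 + L * τ))
    (i1 : |I - A * M1| ≤ C1 * τ * A) (i2 : |I' - A' * M1| ≤ C1 * τ * A')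
    (s1 : |S - A ^ 2 * M2| ≤ 4 * A * (C1 * τ * A)) (s2 : |S' - A' ^ 2 * M2| ≤ 4 * A' * (C1 * τ * A'))
    (b1 : A * (1 - 2 * τ) ≤ b) (b2 : b ≤ A * (1 + k * τ)) :
    |b - (I - I') / 2 - A| ≤ (13 * C1 + 5 * L + k) * τ * A ∧
    |(S + S') / 2 - ((I - I') / 2) ^ 2 - A ^ 2 * M2| ≤ (13 * C1 + 5 * L + k) * τ * A ^ 2 := by
  have d1 : A' - A ≤ L * τ * A := by linarith
  have q0 : 0 ≤ L * τ := by positivity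
  have hA2 : A' ≤ 2 * A := by linarith [mul_le_mul_of_nonneg_left hLτ hA.le]
  have d2 : A - A' ≤ 2 * (L * τ * A) := by linarith [mul_le_mul_of_nonneg_left hA2 q0]
  have q1 : 0 ≤ L * τ * A := by positivity
  have q2 : 0 ≤ C1 * τ * A := by positivity
  have q3 : 0 ≤ k * τ * A := by positivity
  have q4 : 2 * (τ * A) ≤ k * (τ * A) := mul_le_mul_of_nonneg_right hk (by positivity)
  have i3 : C1 * τ * A' ≤ C1 * τ * (2 * A) := by gcongr
  have m1 : |A * M1 - A' * M1| ≤ 2 * (L * τ * A) := by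
    rw [← sub_mul, abs_mul, abs_of_nonneg h1]
    have : |A - A'| ≤ 2 * (L * τ * A) := abs_le.2 ⟨by linarith, by linarith⟩
    calc |A - A'| * M1 ≤ |A - A'| * 1 := by gcongr
      _ ≤ _ := by linarith
  rw [abs_le] at i1 i2 m1
  have n1 : |(I - I') / 2| ≤ (3 * C1 + 2 * L) * τ * A := by
    rw [abs_le]; constructor <;> linarith
  have n2 : ((I - I') / 2) ^ 2 ≤ (3 * C1 + 2 * L) * τ * A ^ 2 := by
    rw [← sq_abs]
    have w1 : |(I - I') / 2| ≤ A := n1.trans (by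
      have := mul_le_mul_of_nonneg_right hbig hA.le
      linarith)
    calc |(I - I') / 2| ^ 2 = |(I - I') / 2| * |(I - I') / 2| := by ring
      _ ≤ ((3 * C1 + 2 * L) * τ * A) * A := by gcongr
      _ = _ := by ring
  constructor
  · rw [abs_le] at n1 ⊢
    constructor <;> linarith
  · have p2 : A' * A' ≤ 2 * A * (2 * A) := by gcongr
    have s3 : 4 * A' * (C1 * τ * A') ≤ 16 * (C1 * τ * A ^ 2) := by
      have := mul_le_mul_of_nonneg_left p2 (show 0 ≤ 4 * (C1 * τ) by positivity)
      linarith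
    have m2 : |A' ^ 2 * M2 - A ^ 2 * M2| ≤ 6 * (L * τ * A ^ 2) := by
      rw [← sub_mul, abs_mul, abs_of_nonneg h3]
      have e : A' ^ 2 - A ^ 2 = (A' - A) * (A' + A) := by ring
      have : |A' - A| ≤ 2 * (L * τ * A) := abs_le.2 ⟨by linarith, by linarith⟩
      rw [e, abs_mul, abs_of_pos (show 0 < A' + A by linarith)]
      calc |A' - A| * (A' + A) * M2 ≤ (2 * (L * τ * A)) * (2 * A + A) * 1 := by gcongr
        _ = _ := by ring
    have n3 : 0 ≤ ((I - I') / 2) ^ 2 := sq_nonneg _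
    have q1 : 0 ≤ L * τ * A ^ 2 := by positivity
    have q2 : 0 ≤ C1 * τ * A ^ 2 := by positivity
    have q3 : 0 ≤ k * τ * A ^ 2 := by positivity
    rw [abs_le] at s1 s2 m2 ⊢
    constructor <;> linarith

lemma rb_side_mom {m : ℕ} (hm : 1 ≤ m) {τ e A : ℝ} {Q : ℝ → ℝ} (hτ : 0 < τ) (hτ1 : rb_Lam m * τ ≤ 1)
    (he : e ≤ τ ^ (m + 2)) (hA : 0 < A) (hQ : Antitone Q)
    (hQ0 : ∀ x, 0 ≤ x → 0 ≤ Q x) (hQ1 : ∀ x, 0 ≤ x → Q x ≤ 1) (hest : rb_est m τ e A Q) :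
    |(∫ x in (0:ℝ)..(A * (1 + rb_k m * τ)), Q x) - A * rb_M1 m| ≤ rb_C m * τ * A ∧
    |(∫ x in (0:ℝ)..(A * (1 + rb_k m * τ)), 2 * x * Q x) - A ^ 2 * rb_M2 m| ≤ 4 * A * (rb_C m * τ * A) := by
  obtain ⟨l1, l2, l3⟩ := rb_Lam_ge m
  have hkp : 0 < rb_k m * τ := mul_pos (by linarith) hτ
  have hk1 : rb_k m * τ ≤ 1 := by nlinarith
  obtain ⟨w1, w2⟩ := rb_mom_w hm hA (B := A * (1 + rb_k m * τ)) (by linarith [mul_pos hA hkp])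
  have r1 := rb_mom hm hτ hτ1 he hA (hQ.antitoneOn _) hQ0 hQ1 hest (g := fun _ => 1) continuous_const (G := 1) (by simp)
  have r2 := rb_mom hm hτ hτ1 he hA (hQ.antitoneOn _) hQ0 hQ1 hest (g := fun x => 2 * x) (by fun_prop) (G := 4 * A) (by
    intro x h0 h1
    rw [abs_of_nonneg (by linarith)]
    linarith [mul_le_mul_of_nonneg_left hk1 hA.le])
  simp only [one_mul] at r1
  rw [w1] at r1
  rw [w2] at r2
  exact ⟨r1, r2⟩

set_option maxHeartbeats 1000000 in
lemma rb_onedir {m : ℕ} (hm : 1 ≤ m) {K : Set (Fin (m + 1) → ℝ)} (hK : IsCompact K) (hconv : Convex ℝ K)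
    (hne : (interior K).Nonempty) {τ : ℝ} (hτ : 0 < τ) (hτ1 : rb_C2 m * τ ≤ 1)
    (hP : ∀ z ∈ interior K, (1 - τ ^ (m + 2) / (72 * 4 ^ m)) * rb_om (m + 1) ^ 2 ≤
      (volume K).toReal * (volume (rb_pol K z)).toReal)
    {h μ V : ℝ} (hh : ∃ x ∈ K, x 0 = h) (hh2 : ∀ x ∈ K, x 0 ≤ h)
    (hμ : (volume K).toReal * μ = ∫ x in K, x 0) (hV : (volume K).toReal * V = ∫ x in K, (x 0 - μ) ^ 2) :
    ∃ A, 0 < A ∧ |h - μ - A| ≤ rb_C2 m * τ * A ∧ |V - A ^ 2 * rb_M2 m| ≤ rb_C2 m * τ * A ^ 2 := by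
  obtain ⟨l1, l2, l3⟩ := rb_Lam_ge m
  have hm0 : (1:ℝ) ≤ m := by exact_mod_cast hm
  have hC1 := rb_C_pos m
  have hLτ : rb_Lam m * τ ≤ 1 := by
    refine le_trans ?_ hτ1
    unfold rb_C2
    gcongr; linarith
  have hbig : (3 * rb_C m + 2 * rb_Lam m) * τ ≤ 1 := by
    refine le_trans ?_ hτ1
    unfold rb_C2
    gcongr ?_ * τ; linarith
  have hτs : τ ≤ 1 / 25600 := by nlinarith
  obtain ⟨t0, F, a, b, hF, ha, hb, hvol, hN1, hN2, hb1, hb2, ha1, ha2, -, hmain⟩ := rb_dir hm hK hconv hne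
  have p4 : (1:ℝ) ≤ 4 ^ m := one_le_pow₀ (by norm_num)
  have hη : 0 ≤ τ ^ (m + 2) / (72 * 4 ^ m) := by positivity
  obtain ⟨⟨A, hA, hAb, hest⟩, ⟨A', hA', hAa, hest'⟩⟩ := hmain τ (τ ^ (m + 2) / (72 * 4 ^ m)) hτ (by linarith) hη
    (le_of_eq (by field_simp; ring)) hP
  set e := 2 * (τ ^ (m + 2) / (72 * 4 ^ m)) with he_def
  have he : e ≤ τ ^ (m + 2) := by
    rw [he_def, mul_div_assoc', div_le_iff₀ (by positivity)]
    nlinarith [pow_pos hτ (m + 2)]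
  set ℓ : (Fin (m + 1) → ℝ) →L[ℝ] ℝ := ContinuousLinearMap.proj 0 with hℓ
  have hℓx : ∀ x, ℓ x = x 0 := fun x => rfl
  have T0 : rb_T K ℓ t0 0 = F := by
    rw [← hN1]; unfold rb_T rb_N
    simp [hℓx, Set.mem_Ioi]
  have T0' : rb_T K (-ℓ) (-t0) 0 = F := by
    rw [← hN2]; unfold rb_T rb_N
    simp [hℓx, Set.mem_Iio]
  have Tx : ∀ x, 0 ≤ x → rb_N K (Set.Ioc t0 (t0 + x)) = rb_T K ℓ t0 0 - rb_T K ℓ t0 x := by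
    intro x hx
    rw [rb_T_sub hK _ _ hx]; unfold rb_N
    simp [hℓx, Set.mem_Ioc]
  have Tx' : ∀ x, 0 ≤ x → rb_N K (Set.Ico (t0 - x) t0) = rb_T K (-ℓ) (-t0) 0 - rb_T K (-ℓ) (-t0) x := by
    intro x hx
    rw [rb_T_sub hK _ _ hx]; unfold rb_N
    congr 3; ext y
    simp only [Set.mem_Ico, Set.mem_setOf_eq, ContinuousLinearMap.neg_apply, hℓx]
    constructor
    · rintro ⟨h1, h2⟩; constructor <;> linarith
    · rintro ⟨h1, h2⟩; constructor <;> linarith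
  set Q : ℝ → ℝ := fun x => rb_T K ℓ t0 x / F with hQ
  set Q' : ℝ → ℝ := fun x => rb_T K (-ℓ) (-t0) x / F with hQ'
  have q1 : Antitone Q := fun x y hxy => div_le_div_of_nonneg_right (rb_T_anti hK ℓ t0 hxy) hF.le
  have q1' : Antitone Q' := fun x y hxy => div_le_div_of_nonneg_right (rb_T_anti hK (-ℓ) (-t0) hxy) hF.le
  have q2 : ∀ x, 0 ≤ x → 0 ≤ Q x := fun x _ => div_nonneg (rb_T_nonneg _ _ _ _) hF.le
  have q2' : ∀ x, 0 ≤ x → 0 ≤ Q' x := fun x _ => div_nonneg (rb_T_nonneg _ _ _ _) hF.le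
  have q00 : Q 0 = 1 := by simp only [hQ, T0]; exact div_self hF.ne'
  have q00' : Q' 0 = 1 := by simp only [hQ', T0']; exact div_self hF.ne'
  have q3 : ∀ x, 0 ≤ x → Q x ≤ 1 := fun x hx => q00 ▸ q1 hx
  have q3' : ∀ x, 0 ≤ x → Q' x ≤ 1 := fun x hx => q00' ▸ q1' hx
  have s0 := Real.sqrt_nonneg τ
  have hE : rb_est m τ e A Q := by
    intro x hx1 hx2
    have hx0 : 0 ≤ x := le_trans (by positivity) hx1
    have := hest x hx1 hx2
    rw [Tx x hx0, sub_div] at this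
    have e0 : rb_T K ℓ t0 0 / F = 1 := q00
    rw [e0] at this
    exact this
  have hE' : rb_est m τ e A' Q' := by
    intro x hx1 hx2
    have hx0 : 0 ≤ x := le_trans (by positivity) hx1
    have := hest' x hx1 hx2
    rw [Tx' x hx0, sub_div] at this
    have e0 : rb_T K (-ℓ) (-t0) 0 / F = 1 := q00'
    rw [e0] at this
    exact this
  have hbB : b ≤ A * (1 + rb_k m * τ) := by
    apply rb_Jzero hm hτ hLτ he hA (q1.antitoneOn _) _ hE
    intro x hx hxb
    obtain ⟨p, hp, hp2⟩ := hb1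
    have := rb_T_homot hK hconv ℓ t0 (x := x) hp (by rw [hℓx, hp2]) (t := 1/2) (by norm_num) (by norm_num)
    simp only [hQ]
    rw [show (b + x) / 2 = (1 - 1/2) * b + 1/2 * x by ring, div_div, div_le_div_iff₀ (by positivity) hF]
    rw [one_div, inv_pow, inv_mul_eq_div, div_le_iff₀ (by positivity)] at this
    nlinarith
  have haB : a ≤ A' * (1 + rb_k m * τ) := by
    apply rb_Jzero hm hτ hLτ he hA' (q1'.antitoneOn _) _ hE'
    intro x hx hxb
    obtain ⟨p, hp, hp2⟩ := ha1
    have := rb_T_homot hK hconv (-ℓ) (-t0) (b := a) (x := x) hp (by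
      simp only [ContinuousLinearMap.neg_apply, hℓx, hp2]; ring) (t := 1/2) (by norm_num) (by norm_num)
    simp only [hQ']
    rw [show (a + x) / 2 = (1 - 1/2) * a + 1/2 * x by ring, div_div, div_le_div_iff₀ (by positivity) hF]
    rw [one_div, inv_pow, inv_mul_eq_div, div_le_iff₀ (by positivity)] at this
    nlinarith
  have a1 : A' ≤ A * (1 + rb_Lam m * τ) := by
    apply rb_Jtwo hm hτ hLτ he hA hA' (q1.antitoneOn _) _ q3' q3 hE hE'
    intro x hx
    have := rb_T_bm hK hconv ℓ t0 hx
    rw [T0, T0'] at this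
    have e1 : (1 - Q x) * (Q' x - Q' (2 * x)) = ((F - rb_T K ℓ t0 x) * (rb_T K (-ℓ) (-t0) x - rb_T K (-ℓ) (-t0) (2 * x))) / F ^ 2 := by
      simp only [hQ, hQ']; field_simp
    have e2 : (1 - Q' x) ^ 2 = (F - rb_T K (-ℓ) (-t0) x) ^ 2 / F ^ 2 := by
      simp only [hQ']; field_simp
    rw [e1, e2]
    exact div_le_div_of_nonneg_right this (by positivity)
  have a2 : A ≤ A' * (1 + rb_Lam m * τ) := by
    apply rb_Jtwo hm hτ hLτ he hA' hA (q1'.antitoneOn _) _ q3 q3' hE' hE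
    intro x hx
    have := rb_T_bm hK hconv (-ℓ) (-t0) hx
    rw [neg_neg, neg_neg, T0, T0'] at this
    have e1 : (1 - Q' x) * (Q x - Q (2 * x)) = ((F - rb_T K (-ℓ) (-t0) x) * (rb_T K ℓ t0 x - rb_T K ℓ t0 (2 * x))) / F ^ 2 := by
      simp only [hQ, hQ']; field_simp
    have e2 : (1 - Q x) ^ 2 = (F - rb_T K ℓ t0 x) ^ 2 / F ^ 2 := by
      simp only [hQ]; field_simp
    rw [e1, e2]
    exact div_le_div_of_nonneg_right this (by positivity)
  obtain ⟨i1, s1⟩ := rb_side_mom hm hτ hLτ he hA q1 q2 q3 hE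
  obtain ⟨i2, s2⟩ := rb_side_mom hm hτ hLτ he hA' q1' q2' q3' hE'
  obtain ⟨mm1, mm2, mm3⟩ := rb_M1_bd hm
  have fin := rb_combine hτ hA hA' mm1 mm2 (rb_M2_pos (m := m)).le mm3 (by linarith) (by linarith) (by linarith) hLτ hbig a1 a2 i1 i2 s1 s2
    hAb.le hbB
  have hh0 : h = t0 + b := by
    obtain ⟨x, hx, hx2⟩ := hh
    obtain ⟨y, hy, hy2⟩ := hb1
    apply le_antisymm
    · rw [← hx2]; exact hb2 x hx
    · rw [← hy2]; exact hh2 y hy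
  obtain ⟨mo1, mo2⟩ := rb_moments hK ℓ t0 (hb.le.trans hbB) (fun y hy => by linarith [hb2 y hy, hℓx y])
    (ha.le.trans haB) (fun y hy => by linarith [ha2 y hy, hℓx y])
  have r1 : ∀ B, (∫ x in (0:ℝ)..B, Q x) = (∫ x in (0:ℝ)..B, rb_T K ℓ t0 x) / F := fun B =>
    intervalIntegral.integral_div _ _
  have r1' : ∀ B, (∫ x in (0:ℝ)..B, Q' x) = (∫ x in (0:ℝ)..B, rb_T K (-ℓ) (-t0) x) / F := fun B =>
    intervalIntegral.integral_div _ _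
  have r2 : ∀ B, (∫ x in (0:ℝ)..B, 2 * x * Q x) = (∫ x in (0:ℝ)..B, 2 * x * rb_T K ℓ t0 x) / F := fun B => by
    rw [← intervalIntegral.integral_div]; simp only [hQ, mul_div_assoc]
  have r2' : ∀ B, (∫ x in (0:ℝ)..B, 2 * x * Q' x) = (∫ x in (0:ℝ)..B, 2 * x * rb_T K (-ℓ) (-t0) x) / F := fun B => by
    rw [← intervalIntegral.integral_div]; simp only [hQ', mul_div_assoc]
  rw [r1, r1', r2, r2', ← sub_div, ← add_div, ← mo1, ← mo2] at fin
  have ci : ∀ f : (Fin (m+1) → ℝ) → ℝ, Continuous f → IntegrableOn f K := fun f hf =>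
    hf.continuousOn.integrableOn_compact hK
  have volc : ∀ c : ℝ, ∫ x in K, c = 2 * F * c := by
    intro c; rw [setIntegral_const, smul_eq_mul, measureReal_def, hvol]
  have m1 : ∫ y in K, (ℓ y - t0) = 2 * F * (μ - t0) := by
    rw [integral_sub (ci _ (by fun_prop)) (ci _ (by fun_prop)), volc]
    simp only [hℓx]; rw [← hμ, hvol]; ring
  have m2 : ∫ y in K, (ℓ y - t0) ^ 2 = 2 * F * (V + (μ - t0) ^ 2) := by
    have e1 : ∀ y : Fin (m+1) → ℝ, (ℓ y - t0) ^ 2 = (y 0 - μ) ^ 2 + (2 * (μ - t0) * (ℓ y - t0) - (μ - t0) ^ 2) := by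
      intro y; rw [hℓx]; ring
    simp only [e1]
    rw [integral_add (ci _ (by fun_prop)) (ci _ (by fun_prop)), ← hV, integral_sub (ci _ (by fun_prop)) (ci _ (by fun_prop)),
      integral_const_mul, m1, volc, hvol]
    ring
  rw [m1, m2] at fin
  refine ⟨A, hA, ?_, ?_⟩
  · have := fin.1
    rw [show 2 * F * (μ - t0) / F / 2 = μ - t0 by field_simp] at this
    rw [hh0, show t0 + b - μ - A = b - (μ - t0) - A by ring]
    exact this
  · have := fin.2
    rw [show 2 * F * (μ - t0) / F / 2 = μ - t0 by field_simp,
      show 2 * F * (V + (μ - t0) ^ 2) / F / 2 - (μ - t0) ^ 2 = V by field_simp; ring] at this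
    exact this

/-! part 16 -/

lemma rb_univ {m : ℕ} {K : Set (Fin (m + 1) → ℝ)} (hK : IsCompact K) (hconv : Convex ℝ K)
    (hne : (interior K).Nonempty)
    {h μ V : ℝ} (hh : ∃ x ∈ K, x 0 = h) (hh2 : ∀ x ∈ K, x 0 ≤ h)
    (hμ : (volume K).toReal * μ = ∫ x in K, x 0) (hV : (volume K).toReal * V = ∫ x in K, (x 0 - μ) ^ 2) :
    0 < V ∧ Real.sqrt V ≤ 8 * 8 ^ (m + 1) * (h - μ) ∧ h - μ ≤ 4 * 8 ^ (m + 1) * Real.sqrt V := by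
  set v := (volume K).toReal with hv
  have hv0 : 0 < v := by
    apply ENNReal.toReal_pos _ hK.measure_lt_top.ne
    exact (Measure.measure_pos_of_nonempty_interior volume hne).ne'
  have ci : ∀ f : (Fin (m+1) → ℝ) → ℝ, Continuous f → IntegrableOn f K := fun f hf =>
    hf.continuousOn.integrableOn_compact hK
  have volc : ∀ c : ℝ, ∫ x in K, c = v * c := by
    intro c; rw [setIntegral_const, smul_eq_mul, measureReal_def]
  have hKne : K.Nonempty := hne.mono interior_subset
  obtain ⟨p, hp, hph⟩ := hh
  obtain ⟨q, hq, hqmin⟩ := hK.exists_isMinOn hKne (f := fun x => x 0) (by fun_prop)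
  set l := q 0 with hl
  have hl2 : ∀ x ∈ K, l ≤ x 0 := fun x hx => hqmin hx
  have hlh : l < h := by
    obtain ⟨z, hz⟩ := hne
    obtain ⟨ε, hε, hball⟩ := Metric.isOpen_iff.1 isOpen_interior z hz
    have h1 : z + Pi.single 0 (ε / 2) ∈ K := by
      apply interior_subset (hball _)
      rw [Metric.mem_ball, dist_eq_norm, add_sub_cancel_left, Pi.norm_single, Real.norm_eq_abs, abs_of_pos (by positivity)]
      linarith
    have h2 := hh2 _ h1
    have h3 := hl2 z (interior_subset hz)
    simp at h2
    linarith
  set W := h - l with hW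
  have hW0 : 0 < W := by linarith
  have lμ : l ≤ μ := by
    have : ∫ x in K, l ≤ ∫ x in K, x 0 :=
      setIntegral_mono_on (ci _ (by fun_prop)) (ci _ (by fun_prop)) hK.measurableSet hl2
    rw [volc, ← hμ] at this
    exact le_of_mul_le_mul_left this hv0
  have μh : μ ≤ h := by
    have : ∫ x in K, x 0 ≤ ∫ x in K, h :=
      setIntegral_mono_on (ci _ (by fun_prop)) (ci _ (by fun_prop)) hK.measurableSet hh2
    rw [volc, ← hμ] at this
    exact le_of_mul_le_mul_left this hv0
  have up : V ≤ 2 * W * (h - μ) := by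
    have : ∫ x in K, (x 0 - μ) ^ 2 ≤ ∫ x in K, (W * (2 * (h - μ) + μ) - W * x 0) := by
      apply setIntegral_mono_on (ci _ (by fun_prop)) (ci _ (by fun_prop)) hK.measurableSet
      intro x hx
      have h1 := hl2 x hx
      have h2 := hh2 x hx
      rcases le_total (x 0) μ with h3 | h3
      · nlinarith
      · nlinarith
    rw [integral_sub (ci _ (by fun_prop)) (ci _ (by fun_prop)), volc, integral_const_mul, ← hμ, ← hV] at this
    have : v * V ≤ v * (2 * W * (h - μ)) := by linarith
    exact le_of_mul_le_mul_left this hv0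
  have low : W ^ 2 ≤ 16 * 8 ^ (m + 1) * V := by
    have cheb : ∀ S : Set (Fin (m+1) → ℝ), MeasurableSet S → (∀ x ∈ S, (W / 4) ^ 2 ≤ (x 0 - μ) ^ 2) →
        (1/8) ^ (m + 1) * v ≤ (volume (K ∩ S)).toReal → W ^ 2 ≤ 16 * 8 ^ (m + 1) * V := by
      intro S hS hSx hvol
      have h1 : ∫ x in K ∩ S, (W / 4) ^ 2 ≤ ∫ x in K ∩ S, (x 0 - μ) ^ 2 :=
        setIntegral_mono_on ((ci _ (by fun_prop)).mono_set Set.inter_subset_left)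
          ((ci _ (by fun_prop)).mono_set Set.inter_subset_left) (hK.measurableSet.inter hS) (fun x hx => hSx x hx.2)
      have h2 : ∫ x in K ∩ S, (x 0 - μ) ^ 2 ≤ ∫ x in K, (x 0 - μ) ^ 2 :=
        setIntegral_mono_set (ci _ (by fun_prop)) (Filter.Eventually.of_forall fun x => sq_nonneg _)
          (Filter.Eventually.of_forall Set.inter_subset_left)
      rw [setIntegral_const, smul_eq_mul, measureReal_def] at h1
      have h3 : (1/8) ^ (m + 1) * v * (W / 4) ^ 2 ≤ v * V := by
        rw [hV]; exact (mul_le_mul_of_nonneg_right hvol (sq_nonneg _)).trans (h1.trans h2)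
      have h4 : v * ((1/8) ^ (m + 1) * (W / 4) ^ 2) ≤ v * V := by linarith
      have h5 := le_of_mul_le_mul_left h4 hv0
      rw [one_div, inv_pow, inv_mul_eq_div, div_le_iff₀ (by positivity)] at h5
      linarith
    set ℓ : (Fin (m + 1) → ℝ) →L[ℝ] ℝ := ContinuousLinearMap.proj 0 with hℓ
    have hℓx : ∀ x, ℓ x = x 0 := fun x => rfl
    rcases le_total μ ((l + h) / 2) with hc | hc
    · apply cheb {y | 0 + ((1 - 1/8) * h + 1/8 * (l - W)) < ℓ y}
        (measurableSet_lt measurable_const ℓ.continuous.measurable)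
      · intro x hx
        simp only [Set.mem_setOf_eq, hℓx] at hx
        apply pow_le_pow_left₀ (by positivity)
        linarith
      · have := rb_T_homot hK hconv ℓ 0 (x := l - W) hp (by rw [hℓx, hph, zero_add]) (t := 1/8) (by norm_num) (by norm_num)
        have e : rb_T K ℓ 0 (l - W) = v := by
          unfold rb_T; rw [hv]; congr 2
          ext y
          simp only [Set.mem_inter_iff, Set.mem_setOf_eq, and_iff_left_iff_imp, hℓx]
          intro hy; linarith [hl2 y hy]
        rw [e] at this
        exact this
    · apply cheb {y | 0 + ((1 - 1/8) * (-l) + 1/8 * (-h - W)) < (-ℓ) y}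
        (measurableSet_lt measurable_const (-ℓ).continuous.measurable)
      · intro x hx
        simp only [Set.mem_setOf_eq, ContinuousLinearMap.neg_apply, hℓx] at hx
        rw [← neg_sq (x 0 - μ)]
        apply pow_le_pow_left₀ (by positivity)
        linarith
      · have := rb_T_homot hK hconv (-ℓ) 0 (x := -h - W) hq (b := -l) (by
          rw [ContinuousLinearMap.neg_apply, hℓx, zero_add]) (t := 1/8) (by norm_num) (by norm_num)
        have e : rb_T K (-ℓ) 0 (-h - W) = v := by
          unfold rb_T; rw [hv]; congr 2
          ext y
          simp only [Set.mem_inter_iff, Set.mem_setOf_eq, and_iff_left_iff_imp, hℓx, ContinuousLinearMap.neg_apply]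
          intro hy; linarith [hh2 y hy]
        rw [e] at this
        exact this
  have p8 : (1:ℝ) ≤ 8 ^ (m + 1) := one_le_pow₀ (by norm_num)
  have V0 : 0 < V := by
    by_contra hneg
    push Not at hneg
    have : 16 * 8 ^ (m + 1) * V ≤ 0 := mul_nonpos_of_nonneg_of_nonpos (by positivity) hneg
    have := pow_pos hW0 2
    linarith
  have s0 : 0 < Real.sqrt V := Real.sqrt_pos.2 V0
  have ss : Real.sqrt V * Real.sqrt V = V := Real.mul_self_sqrt V0.le
  have WV : W ≤ 4 * 8 ^ (m + 1) * Real.sqrt V := by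
    apply le_of_sq_le_sq _ (by positivity)
    refine low.trans ?_
    rw [mul_pow, mul_pow, Real.sq_sqrt V0.le]
    have : (8:ℝ) ^ (m + 1) ≤ (8 ^ (m + 1)) ^ 2 := by
      rw [sq]; exact le_mul_of_one_le_left (by positivity) p8
    have := mul_le_mul_of_nonneg_right this V0.le
    linarith
  refine ⟨V0, ?_, ?_⟩
  · have h1 : Real.sqrt V * Real.sqrt V ≤ Real.sqrt V * (8 * 8 ^ (m + 1) * (h - μ)) := by
      rw [ss]; refine up.trans ?_
      have := mul_le_mul_of_nonneg_right WV (show 0 ≤ h - μ by linarith)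
      linarith
    exact le_of_mul_le_mul_left h1 s0
  · linarith

/-! part 17 -/

lemma rb_rot {m : ℕ} (v : EuclideanSpace ℝ (Fin (m + 1))) (hv : ‖v‖ = 1) :
    ∃ ψ : EuclideanSpace ℝ (Fin (m + 1)) ≃L[ℝ] (Fin (m + 1) → ℝ), MeasurePreserving ψ volume volume ∧
      (∀ x y, ψ x ⬝ᵥ ψ y = inner ℝ x y) ∧ ∀ x, ψ x 0 = inner ℝ v x := by
  set e : EuclideanSpace ℝ (Fin (m + 1)) := EuclideanSpace.single 0 1 with he
  have hee : ‖v‖ = ‖e‖ := by rw [hv, he]; simp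
  set R := (Submodule.span ℝ {v - e})ᗮ.reflection with hR
  have hRv : R v = e := Submodule.reflection_sub hee
  refine ⟨R.toContinuousLinearEquiv.trans (EuclideanSpace.equiv (Fin (m + 1)) ℝ), ?_, ?_, ?_⟩
  · exact (PiLp.volume_preserving_ofLp (Fin (m + 1))).comp R.measurePreserving
  · intro x y
    rw [← R.inner_map_map x y, EuclideanSpace.inner_eq_star_dotProduct, dotProduct_comm]
    rfl
  · intro x
    rw [← R.inner_map_map v x, hRv, he, EuclideanSpace.inner_single_left]
    simp
lemma rb_pol_tr {m : ℕ} (ψ : EuclideanSpace ℝ (Fin (m + 1)) ≃L[ℝ] (Fin (m + 1) → ℝ))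
    (hψ : MeasurePreserving ψ volume volume)
    (hi : ∀ x y, ψ x ⬝ᵥ ψ y = inner ℝ x y) (K : Set (EuclideanSpace ℝ (Fin (m + 1)))) (z) :
    volume (rb_pol (ψ '' K) (ψ z)) = volume (polarBody K z) := by
  have e1 : ψ ⁻¹' rb_pol (ψ '' K) (ψ z) = {u | ∀ y ∈ K, inner ℝ u (y - z) ≤ 1} := by
    ext u
    simp only [rb_pol, Set.mem_preimage, Set.mem_setOf_eq, Set.forall_mem_image, ← map_sub, hi]
  have e2 : polarBody K z = (fun x => x + (-z)) ⁻¹' {u | ∀ y ∈ K, inner ℝ u (y - z) ≤ 1} := by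
    ext u
    simp [polarBody, sub_eq_add_neg]
  rw [e2, measure_preimage_add_right, ← e1]
  exact (hψ.measure_preimage_emb ψ.toHomeomorph.measurableEmbedding _).symm
lemma rb_vol_tr {m : ℕ} (ψ : EuclideanSpace ℝ (Fin (m + 1)) ≃L[ℝ] (Fin (m + 1) → ℝ))
    (hψ : MeasurePreserving ψ volume volume) (K : Set (EuclideanSpace ℝ (Fin (m + 1)))) :
    volume (ψ '' K) = volume K := by
  rw [← hψ.measure_preimage_emb ψ.toHomeomorph.measurableEmbedding, ψ.injective.preimage_image]
lemma rb_int_tr {m : ℕ} (ψ : EuclideanSpace ℝ (Fin (m + 1)) ≃L[ℝ] (Fin (m + 1) → ℝ))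
    (hψ : MeasurePreserving ψ volume volume) (K : Set (EuclideanSpace ℝ (Fin (m + 1)))) (f : (Fin (m+1) → ℝ) → ℝ) :
    ∫ x in ψ '' K, f x = ∫ x in K, f (ψ x) := by
  rw [hψ.setIntegral_image_emb ψ.toHomeomorph.measurableEmbedding]
/-- centroid -/
def rb_cen {n : ℕ} (K : Set (EuclideanSpace ℝ (Fin n))) : EuclideanSpace ℝ (Fin n) :=
  (volume K).toReal⁻¹ • ∫ x in K, x
/-- covariance quadratic form -/
def rb_q {n : ℕ} (K : Set (EuclideanSpace ℝ (Fin n))) (v : EuclideanSpace ℝ (Fin n)) : ℝ :=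
  (volume K).toReal⁻¹ * ∫ x in K, (inner ℝ v (x - rb_cen K)) ^ 2
lemma rb_volpos {n : ℕ} {K : Set (EuclideanSpace ℝ (Fin n))} (hK : IsCompact K) (hne : (interior K).Nonempty) :
    0 < (volume K).toReal := by
  apply ENNReal.toReal_pos _ hK.measure_lt_top.ne
  exact (Measure.measure_pos_of_nonempty_interior volume hne).ne'
lemma rb_cen_inner {n : ℕ} {K : Set (EuclideanSpace ℝ (Fin n))} (hK : IsCompact K) (hne : (interior K).Nonempty) (v) :
    (volume K).toReal * inner ℝ v (rb_cen K) = ∫ x in K, inner ℝ v x := by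
  have h0 := rb_volpos hK hne
  rw [rb_cen, inner_smul_right, ← mul_assoc, mul_inv_cancel₀ h0.ne', one_mul]
  exact (integral_inner (continuous_id.continuousOn.integrableOn_compact hK) v).symm
lemma rb_univE {m : ℕ} {K : Set (EuclideanSpace ℝ (Fin (m + 1)))} (hK : IsCompact K) (hconv : Convex ℝ K)
    (hne : (interior K).Nonempty) (v : EuclideanSpace ℝ (Fin (m + 1))) (hv : ‖v‖ = 1) {h : ℝ}
    (hh : ∃ x ∈ K, inner ℝ v (x - rb_cen K) = h) (hh2 : ∀ x ∈ K, inner ℝ v (x - rb_cen K) ≤ h) :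
    (0 < rb_q K v ∧ Real.sqrt (rb_q K v) ≤ 8 * 8 ^ (m + 1) * h ∧ h ≤ 4 * 8 ^ (m + 1) * Real.sqrt (rb_q K v)) ∧
    ∀ τ : ℝ, 1 ≤ m → 0 < τ → rb_C2 m * τ ≤ 1 →
    (∀ z ∈ interior K, (1 - τ ^ (m + 2) / (72 * 4 ^ m)) * rb_om (m + 1) ^ 2 ≤
      (volume K).toReal * (volume (polarBody K z)).toReal) → 
    ∃ A, 0 < A ∧ |h - A| ≤ rb_C2 m * τ * A ∧ |rb_q K v - A ^ 2 * rb_M2 m| ≤ rb_C2 m * τ * A ^ 2 := by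
  obtain ⟨ψ, hψ, hi, h0⟩ := rb_rot v hv
  have v0 := rb_volpos hK hne
  have vol := rb_vol_tr ψ hψ K
  have cK : IsCompact (ψ '' K) := hK.image ψ.continuous
  have cC : Convex ℝ (ψ '' K) := hconv.linear_image ψ.toLinearEquiv.toLinearMap
  have iK : interior (ψ '' K) = ψ '' interior K := (ψ.toHomeomorph.image_interior K).symm
  have nK : (interior (ψ '' K)).Nonempty := by rw [iK]; exact hne.image _
  set μ := inner ℝ v (rb_cen K) with hμ
  have a1 : ∃ x ∈ ψ '' K, x 0 = h + μ := by
    obtain ⟨x, hx, rfl⟩ := hh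
    refine ⟨ψ x, ⟨x, hx, rfl⟩, ?_⟩
    rw [h0, inner_sub_right]; ring
  have a2 : ∀ x ∈ ψ '' K, x 0 ≤ h + μ := by
    rintro _ ⟨x, hx, rfl⟩
    have := hh2 x hx
    rw [inner_sub_right] at this
    rw [h0]; linarith
  have a3 : (volume (ψ '' K)).toReal * μ = ∫ x in ψ '' K, x 0 := by
    rw [vol, rb_int_tr ψ hψ, rb_cen_inner hK hne]
    simp only [h0]
  have a4 : (volume (ψ '' K)).toReal * rb_q K v = ∫ x in ψ '' K, (x 0 - μ) ^ 2 := by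
    rw [vol, rb_int_tr ψ hψ, rb_q, ← mul_assoc, mul_inv_cancel₀ v0.ne', one_mul]
    simp only [h0, inner_sub_right, hμ]
  constructor
  · have := rb_univ cK cC nK a1 a2 a3 a4
    simpa using this
  · intro τ hm hτ hτ1 hP
    have := rb_onedir hm cK cC nK hτ hτ1 (by
      rw [iK]
      rintro _ ⟨z, hz, rfl⟩
      rw [vol, rb_pol_tr ψ hψ hi]
      exact hP z hz) a1 a2 a3 a4
    simpa using this
lemma rb_BS {m : ℕ} (hm : 1 ≤ m) {K : Set (EuclideanSpace ℝ (Fin (m + 1)))} (hK : IsCompact K) (hconv : Convex ℝ K)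
    (hne : (interior K).Nonempty) : ∃ z ∈ interior K,
      (volume K).toReal * (volume (polarBody K z)).toReal ≤ rb_om (m + 1) ^ 2 := by
  obtain ⟨ψ, hψ, hi, h0⟩ := rb_rot (EuclideanSpace.single (0 : Fin (m+1)) (1:ℝ)) (by simp)
  have vol := rb_vol_tr ψ hψ K
  have cK : IsCompact (ψ '' K) := hK.image ψ.continuous
  have cC : Convex ℝ (ψ '' K) := hconv.linear_image ψ.toLinearEquiv.toLinearMap
  have iK : interior (ψ '' K) = ψ '' interior K := (ψ.toHomeomorph.image_interior K).symm
  have nK : (interior (ψ '' K)).Nonempty := by rw [iK]; exact hne.image _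
  obtain ⟨_, _, _, _, _, _, _, _, _, _, _, _, _, _, ⟨w, hw, hw2⟩, _⟩ := rb_dir hm cK cC nK
  rw [iK] at hw
  obtain ⟨z, hz, rfl⟩ := hw
  rw [vol, rb_pol_tr ψ hψ hi] at hw2
  exact ⟨z, hz, hw2⟩

/-! part 18 -/

lemma rb_S {n : ℕ} {K : Set (EuclideanSpace ℝ (Fin n))} (hK : IsCompact K)
    (hq : ∀ v, ‖v‖ = 1 → 0 < rb_q K v) :
    ∃ S Φ : EuclideanSpace ℝ (Fin n) ≃ₗ[ℝ] EuclideanSpace ℝ (Fin n),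
      (∀ v, ‖S v‖ ^ 2 = rb_q K v) ∧ ∀ v w, inner ℝ (S v) w = inner ℝ v (Φ w) := by
  set c := rb_cen K with hc
  set V := (volume K).toReal⁻¹ with hV
  have ci : ∀ f : EuclideanSpace ℝ (Fin n) → EuclideanSpace ℝ (Fin n), Continuous f → IntegrableOn f K := fun f hf =>
    hf.continuousOn.integrableOn_compact hK
  set T : EuclideanSpace ℝ (Fin n) →ₗ[ℝ] EuclideanSpace ℝ (Fin n) :=
    { toFun := fun v => V • ∫ x in K, (inner ℝ v (x - c) : ℝ) • (x - c)
      map_add' := by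
        intro v w
        rw [← smul_add, ← integral_add (ci _ (by fun_prop)) (ci _ (by fun_prop))]
        simp only [inner_add_left, add_smul]
      map_smul' := by
        intro a v
        rw [RingHom.id_apply, smul_comm a V, ← integral_smul a]
        simp only [inner_smul_left, smul_smul, RCLike.conj_to_real] } with hT
  have hT1 : ∀ v w, inner ℝ w (T v) = V * ∫ x in K, inner ℝ v (x - c) * inner ℝ w (x - c) := by
    intro v w
    change inner ℝ w (V • ∫ x in K, (inner ℝ v (x - c) : ℝ) • (x - c)) = _
    rw [inner_smul_right, ← integral_inner (ci _ (by fun_prop)) w]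
    simp only [inner_smul_right]
  have hTs : T.IsSymmetric := by
    intro v w
    rw [real_inner_comm, hT1, hT1]
    simp only [mul_comm]
  have hTq : ∀ v, inner ℝ v (T v) = rb_q K v := by
    intro v
    rw [hT1, rb_q]
    simp only [sq, hV, hc]
  have fr : Module.finrank ℝ (EuclideanSpace ℝ (Fin n)) = n := by simp
  set b := hTs.eigenvectorBasis fr with hb
  set ev := hTs.eigenvalues fr with hev
  have hbe : ∀ i, T (b i) = ev i • b i := fun i => hTs.apply_eigenvectorBasis fr i
  have evpos : ∀ i, 0 < ev i := by
    intro i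
    have h1 := hq (b i) (b.orthonormal.1 i)
    rw [← hTq, hbe, inner_smul_right, real_inner_self_eq_norm_sq, b.orthonormal.1 i] at h1
    simpa using h1
  set S0 : EuclideanSpace ℝ (Fin n) →ₗ[ℝ] EuclideanSpace ℝ (Fin n) :=
    { toFun := fun v => WithLp.toLp 2 (fun i => Real.sqrt (ev i) * inner ℝ (b i) v)
      map_add' := by
        intro v w
        ext i
        simp [inner_add_right, mul_add]
      map_smul' := by
        intro a v
        ext i
        simp [inner_smul_right]; ring } with hS0
  have hSn : ∀ v, ‖S0 v‖ ^ 2 = rb_q K v := by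
    intro v
    rw [← hTq, ← b.sum_inner_mul_inner, EuclideanSpace.norm_sq_eq]
    apply Finset.sum_congr rfl
    intro i _
    rw [← hTs (b i) v, hbe, inner_smul_left, real_inner_comm (b i) v]
    change ‖Real.sqrt (ev i) * inner ℝ (b i) v‖ ^ 2 = _
    rw [Real.norm_eq_abs, sq_abs, mul_pow, Real.sq_sqrt (evpos i).le]
    simp; ring
  have hq0 : ∀ v, rb_q K v = 0 → v = 0 := by
    intro v h
    by_contra hv
    have hn : ‖v‖ ≠ 0 := by simpa using hv
    have h1 := hq ((‖v‖)⁻¹ • v) (by rw [norm_smul, norm_inv, norm_norm, inv_mul_cancel₀ hn])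
    rw [← hSn, map_smul, norm_smul, mul_pow, hSn, h] at h1
    simp at h1
  have Sinj : Function.Injective S0 := by
    rw [injective_iff_map_eq_zero]
    intro v h
    apply hq0
    rw [← hSn, h]; simp
  have Ssurj : Function.Surjective S0 := LinearMap.surjective_of_injective Sinj
  have Ainj : Function.Injective (LinearMap.adjoint S0) := by
    rw [injective_iff_map_eq_zero]
    intro w h
    obtain ⟨v, rfl⟩ := Ssurj w
    have : inner ℝ (S0 v) (S0 v) = 0 := by
      rw [← LinearMap.adjoint_inner_right, h, inner_zero_right]
    exact inner_self_eq_zero.1 this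
  refine ⟨LinearEquiv.ofInjectiveEndo S0 Sinj, LinearEquiv.ofInjectiveEndo _ Ainj, hSn, ?_⟩
  intro v w
  exact (LinearMap.adjoint_inner_right S0 v w).symm
lemma rb_BM_le {n : ℕ} {K M : Set (EuclideanSpace ℝ (Fin n))} {lam : ℝ} (hl : 1 ≤ lam)
    (Φ : EuclideanSpace ℝ (Fin n) ≃ₗ[ℝ] EuclideanSpace ℝ (Fin n)) (x y : EuclideanSpace ℝ (Fin n))
    (h1 : (fun v => v - x) '' K ⊆ Φ '' ((fun v => v - y) '' M))
    (h2 : Φ '' ((fun v => v - y) '' M) ⊆ lam • ((fun v => v - x) '' K)) :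
    BMdist K M ≤ Real.log lam := by
  unfold BMdist
  have hmem : lam ∈ {lam : ℝ | 1 ≤ lam ∧
    ∃ Φ : EuclideanSpace ℝ (Fin n) ≃ₗ[ℝ] EuclideanSpace ℝ (Fin n),
    ∃ x y : EuclideanSpace ℝ (Fin n),
      (fun v => v - x) '' K ⊆ Φ '' ((fun v => v - y) '' M) ∧
      Φ '' ((fun v => v - y) '' M) ⊆ lam • ((fun v => v - x) '' K)} := ⟨hl, Φ, x, y, h1, h2⟩
  apply Real.log_le_log
  · exact lt_of_lt_of_le one_pos (le_csInf ⟨_, hmem⟩ fun a ha => ha.1)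
  · exact csInf_le ⟨1, fun a ha => ha.1⟩ hmem
lemma rb_BM_nonneg {n : ℕ} (K M : Set (EuclideanSpace ℝ (Fin n))) : 0 ≤ BMdist K M := by
  unfold BMdist
  set s := {lam : ℝ | 1 ≤ lam ∧
    ∃ Φ : EuclideanSpace ℝ (Fin n) ≃ₗ[ℝ] EuclideanSpace ℝ (Fin n),
    ∃ x y : EuclideanSpace ℝ (Fin n),
      (fun v => v - x) '' K ⊆ Φ '' ((fun v => v - y) '' M) ∧
      Φ '' ((fun v => v - y) '' M) ⊆ lam • ((fun v => v - x) '' K)} with hs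
  rcases s.eq_empty_or_nonempty with h | h
  · rw [h]; simp
  · exact Real.log_nonneg (le_csInf h fun a ha => ha.1)
lemma rb_sand {n : ℕ} {K : Set (EuclideanSpace ℝ (Fin n))} (hK : IsCompact K) (hconv : Convex ℝ K)
    (S Φ : EuclideanSpace ℝ (Fin n) ≃ₗ[ℝ] EuclideanSpace ℝ (Fin n))
    (hS : ∀ v w, inner ℝ (S v) w = inner ℝ v (Φ w)) (c : EuclideanSpace ℝ (Fin n)) {α β : ℝ} (hα : 0 < α) (hαβ : α ≤ β)
    (hu : ∀ v, ∀ x ∈ K, inner ℝ v (x - c) ≤ β * ‖S v‖) (hl : ∀ v, ∃ x ∈ K, α * ‖S v‖ ≤ inner ℝ v (x - c)) :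
    BMdist K (Metric.closedBall 0 1) ≤ Real.log (β / α) := by
  have hβ : 0 < β := by linarith
  set Φ' := Φ.trans (LinearEquiv.smulOfNeZero ℝ (EuclideanSpace ℝ (Fin n)) β hβ.ne') with hΦ'
  have e' : ∀ w, Φ' w = β • Φ w := fun w => rfl
  apply rb_BM_le (by rwa [le_div_iff₀ hα, one_mul]) Φ' c 0
  · rintro _ ⟨x, hx, rfl⟩
    set w := Φ.symm (x - c) with hw
    have hΦw : Φ w = x - c := by simp [hw]
    have h1 := hu (S.symm w) x hx
    rw [← hΦw, ← hS, S.apply_symm_apply, real_inner_self_eq_norm_sq] at h1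
    have h2 : ‖w‖ ≤ β := by
      by_contra hh
      push Not at hh
      have : 0 < ‖w‖ := hβ.trans hh
      nlinarith
    refine ⟨β⁻¹ • w, ⟨β⁻¹ • w, ?_, by simp⟩, ?_⟩
    · rw [mem_closedBall_zero_iff, norm_smul, Real.norm_eq_abs, abs_of_pos (by positivity), inv_mul_le_iff₀ hβ]
      linarith
    · rw [e', map_smul, hΦw, smul_smul, mul_inv_cancel₀ hβ.ne', one_smul]
  · rintro _ ⟨_, ⟨w, hw, rfl⟩, rfl⟩
    rw [mem_closedBall_zero_iff] at hw
    rw [Set.mem_smul_set]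
    refine ⟨α • Φ w, ⟨c + α • Φ w, ?_, by simp⟩, ?_⟩
    · by_contra hn
      obtain ⟨f, u, hf1, hf2⟩ := geometric_hahn_banach_closed_point hconv hK.isClosed hn
      set v := (InnerProductSpace.toDual ℝ _).symm f with hv
      have hfv : ∀ x, f x = inner ℝ v x := fun x => by simp [hv]
      obtain ⟨x, hx, hx2⟩ := hl v
      have h3 := hf1 x hx
      rw [hfv, inner_add_right, inner_smul_right, ← hS] at hf2
      rw [hfv] at h3
      rw [inner_sub_right] at hx2
      have h4 : inner ℝ (S v) w ≤ ‖S v‖ := (real_inner_le_norm _ _).trans (by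
        have := norm_nonneg (S v)
        nlinarith)
      have h5 := mul_le_mul_of_nonneg_left h4 hα.le
      linarith
    · simp only [sub_zero, e', smul_smul]
      congr 1
      field_simp

/-! part 19 -/

lemma rb_sand2 {m : ℕ} {K : Set (EuclideanSpace ℝ (Fin (m + 1)))} (hK : IsCompact K) (hconv : Convex ℝ K)
    (hne : (interior K).Nonempty) {α β : ℝ} (hα : 0 < α) (hαβ : α ≤ β)
    (H : ∀ v, ‖v‖ = 1 → ∀ h, (∃ x ∈ K, inner ℝ v (x - rb_cen K) = h) → (∀ x ∈ K, inner ℝ v (x - rb_cen K) ≤ h) →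
      α * Real.sqrt (rb_q K v) ≤ h ∧ h ≤ β * Real.sqrt (rb_q K v)) :
    BMdist K (Metric.closedBall 0 1) ≤ Real.log (β / α) := by
  have hKne : K.Nonempty := hne.mono interior_subset
  have hmax : ∀ v, ∃ x ∈ K, ∀ y ∈ K, inner ℝ v (y - rb_cen K) ≤ inner ℝ v (x - rb_cen K) := by
    intro v
    obtain ⟨x, hx, h⟩ := hK.exists_isMaxOn hKne (f := fun x => inner ℝ v (x - rb_cen K)) (by fun_prop)
    exact ⟨x, hx, fun y hy => h hy⟩
  have hq : ∀ v, ‖v‖ = 1 → 0 < rb_q K v := by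
    intro v hv
    obtain ⟨x, hx, h⟩ := hmax v
    exact (rb_univE hK hconv hne v hv ⟨x, hx, rfl⟩ h).1.1
  obtain ⟨S, Φ, hS1, hS2⟩ := rb_S hK hq
  have hsq : ∀ v, Real.sqrt (rb_q K v) = ‖S v‖ := by
    intro v
    rw [← hS1, Real.sqrt_sq (norm_nonneg _)]
  have key : ∀ v, ∃ x ∈ K, (∀ y ∈ K, inner ℝ v (y - rb_cen K) ≤ inner ℝ v (x - rb_cen K)) ∧
      α * ‖S v‖ ≤ inner ℝ v (x - rb_cen K) ∧ inner ℝ v (x - rb_cen K) ≤ β * ‖S v‖ := by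
    intro v
    obtain ⟨x, hx, h⟩ := hmax v
    refine ⟨x, hx, h, ?_⟩
    by_cases hv : v = 0
    · simp [hv]
    have hn : 0 < ‖v‖ := by simpa using hv
    set u := ‖v‖⁻¹ • v with hu
    have hu1 : ‖u‖ = 1 := by rw [hu, norm_smul, norm_inv, norm_norm, inv_mul_cancel₀ hn.ne']
    have hui : ∀ y, inner ℝ u y = ‖v‖⁻¹ * inner ℝ v y := fun y => by rw [hu, inner_smul_left]; simp
    have hSu : ‖S u‖ = ‖v‖⁻¹ * ‖S v‖ := by rw [hu, map_smul, norm_smul, norm_inv, norm_norm]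
    have := H u hu1 (inner ℝ u (x - rb_cen K)) ⟨x, hx, rfl⟩ (fun y hy => by
      rw [hui, hui]
      exact mul_le_mul_of_nonneg_left (h y hy) (by positivity))
    rw [hsq, hui, hSu] at this
    constructor
    · have h2 := this.1
      rw [mul_left_comm] at h2
      exact le_of_mul_le_mul_left h2 (by positivity)
    · have h2 := this.2
      rw [mul_left_comm] at h2
      exact le_of_mul_le_mul_left h2 (by positivity)
  apply rb_sand hK hconv S Φ hS2 (rb_cen K) hα hαβ
  · intro v x hx
    obtain ⟨y, hy, h1, h2, h3⟩ := key v
    exact (h1 x hx).trans h3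
  · intro v
    obtain ⟨y, hy, h1, h2, h3⟩ := key v
    exact ⟨y, hy, h2⟩
lemma rb_stab1 {m : ℕ} {K : Set (EuclideanSpace ℝ (Fin (m + 1)))} (hK : IsCompact K) (hconv : Convex ℝ K)
    (hne : (interior K).Nonempty) :
    BMdist K (Metric.closedBall 0 1) ≤ Real.log (4 * 8 ^ (m + 1) / (8 * 8 ^ (m + 1))⁻¹) := by
  have h8 : (1:ℝ) ≤ 8 ^ (m + 1) := one_le_pow₀ (by norm_num)
  apply rb_sand2 hK hconv hne (by positivity)
  · have : (8 * (8:ℝ) ^ (m + 1))⁻¹ ≤ 1 := inv_le_one_of_one_le₀ (by linarith)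
    linarith
  · intro v hv h h1 h2
    obtain ⟨a, b, c⟩ := (rb_univE hK hconv hne v hv h1 h2).1
    refine ⟨?_, c⟩
    rw [inv_mul_le_iff₀ (by positivity)]
    exact b
lemma rb_stab2 {m : ℕ} (hm : 1 ≤ m) {K : Set (EuclideanSpace ℝ (Fin (m + 1)))} (hK : IsCompact K) (hconv : Convex ℝ K)
    (hne : (interior K).Nonempty) {τ ε : ℝ} (hτ : 0 < τ) (hε : ε = rb_C2 m * τ / rb_M2 m) (hε0 : 0 < ε) (hε1 : ε ≤ 1 / 2)
    (hP : ∀ z ∈ interior K, (1 - τ ^ (m + 2) / (72 * 4 ^ m)) * rb_om (m + 1) ^ 2 ≤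
      (volume K).toReal * (volume (polarBody K z)).toReal) :
    BMdist K (Metric.closedBall 0 1) ≤ 8 * ε := by
  have M0 : 0 < rb_M2 m := rb_M2_pos
  have M1 := (rb_M1_bd hm).2.2
  set M := rb_M2 m with hM
  set δ := rb_C2 m * τ with hδ
  have hδε : δ = ε * M := by rw [hε]; field_simp
  have hδ1 : δ ≤ ε := by rw [hδε]; nlinarith
  set s := Real.sqrt M with hs
  have s0 : 0 < s := Real.sqrt_pos.2 M0
  have e1 : 0 < 1 - ε := by linarith
  have e2 : 0 < 1 + ε := by linarith
  have e3 : 0 < (1 + ε) / (1 - ε) := by positivity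
  have e4 : 1 ≤ (1 + ε) / (1 - ε) := by rw [le_div_iff₀ e1]; linarith
  have hle := rb_sand2 hK hconv hne (α := ((1 + ε) / (1 - ε))⁻¹ / s) (β := ((1 + ε) / (1 - ε)) / s) (by positivity)
    (by gcongr; exact (inv_le_one_of_one_le₀ e4).trans e4) (by
    intro v hv h h1 h2
    obtain ⟨A, A0, hA1, hA2⟩ := (rb_univE hK hconv hne v hv h1 h2).2 τ hm hτ (by linarith) hP
    rw [abs_le] at hA1 hA2
    have b1 : (1 - ε) * A ≤ h := by nlinarith [hA1.1]
    have b2 : h ≤ (1 + ε) * A := by nlinarith [hA1.2]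
    have sM : s ^ 2 = M := Real.sq_sqrt M0.le
    have A2 : 0 < A ^ 2 * M := by positivity
    have b3 : Real.sqrt (rb_q K v) ≤ (1 + ε) * A * s := by
      apply Real.sqrt_le_iff.2 ⟨by positivity, ?_⟩
      have : ((1 + ε) * A * s) ^ 2 = (1 + ε) ^ 2 * (A ^ 2 * M) := by rw [← sM]; ring
      rw [this]
      have : δ * A ^ 2 = ε * (A ^ 2 * M) := by rw [hδε]; ring
      nlinarith [hA2.2]
    have b4 : (1 - ε) * A * s ≤ Real.sqrt (rb_q K v) := by
      apply Real.le_sqrt_of_sq_le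
      have : ((1 - ε) * A * s) ^ 2 = (1 - ε) ^ 2 * (A ^ 2 * M) := by rw [← sM]; ring
      rw [this]
      have : δ * A ^ 2 = ε * (A ^ 2 * M) := by rw [hδε]; ring
      nlinarith [hA2.1]
    constructor
    · calc ((1 + ε) / (1 - ε))⁻¹ / s * Real.sqrt (rb_q K v) ≤ ((1 + ε) / (1 - ε))⁻¹ / s * ((1 + ε) * A * s) := by gcongr
        _ = (1 - ε) * A := by field_simp
        _ ≤ h := b1
    · calc h ≤ (1 + ε) * A := b2
        _ = ((1 + ε) / (1 - ε)) / s * ((1 - ε) * A * s) := by field_simp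
        _ ≤ _ := by gcongr)
  refine hle.trans ?_
  have : ((1 + ε) / (1 - ε)) / s / (((1 + ε) / (1 - ε))⁻¹ / s) = ((1 + ε) / (1 - ε)) ^ 2 := by
    field_simp
  rw [this, Real.log_pow]
  have h1 := Real.log_le_sub_one_of_pos e3
  have h2 : (1 + ε) / (1 - ε) - 1 ≤ 4 * ε := by
    rw [sub_le_iff_le_add, div_le_iff₀ e1]
    nlinarith
  push_cast
  linarith
lemma rb_stab {m : ℕ} (hm : 1 ≤ m) : ∃ c1 D0 : ℝ, 0 < c1 ∧ 0 < D0 ∧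
    ∀ K : Set (EuclideanSpace ℝ (Fin (m + 1))), IsCompact K → Convex ℝ K → (interior K).Nonempty →
    BMdist K (Metric.closedBall 0 1) ≤ D0 ∧ ∃ z ∈ interior K,
      (volume K).toReal * (volume (polarBody K z)).toReal ≤
        (1 - c1 * BMdist K (Metric.closedBall 0 1) ^ (m + 2)) * rb_om (m + 1) ^ 2 := by
  have M0 : 0 < rb_M2 m := rb_M2_pos
  set D0 := Real.log (4 * 8 ^ (m + 1) / (8 * 8 ^ (m + 1))⁻¹) with hD0
  have D0pos : 0 < D0 := by
    apply Real.log_pos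
    have h8 : (1:ℝ) ≤ 8 ^ (m + 1) := one_le_pow₀ (by norm_num)
    rw [div_inv_eq_mul]
    nlinarith
  have C0 : 0 < rb_C2 m := by
    obtain ⟨l1, l2, l3⟩ := rb_Lam_ge m
    have hC1 := rb_C_pos m
    have hmm : (0:ℝ) ≤ m := Nat.cast_nonneg m
    unfold rb_C2
    linarith
  set a := rb_C2 m / rb_M2 m with ha
  have a0 : 0 < a := by positivity
  set C3 := 8 * a + 1 + 2 * a * D0 with hC3
  have C30 : 0 < C3 := by positivity
  refine ⟨1 / (C3 ^ (m + 2) * (72 * 4 ^ m)), D0, by positivity, D0pos, ?_⟩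
  intro K hK hconv hne
  have hd := rb_stab1 hK hconv hne
  refine ⟨hd, ?_⟩
  set d := BMdist K (Metric.closedBall 0 1) with hdd
  have d0 : 0 ≤ d := rb_BM_nonneg _ _
  rcases d0.eq_or_lt with h | h
  · obtain ⟨z, hz, hz2⟩ := rb_BS hm hK hconv hne
    refine ⟨z, hz, ?_⟩
    rw [← h]; simpa using hz2
  · by_contra hcon
    push Not at hcon
    have := rb_stab2 hm hK hconv hne (τ := d / C3) (ε := a * (d / C3)) (by positivity) (by rw [ha]; ring) (by positivity)
      (by
        rw [mul_div_assoc', div_le_iff₀ C30]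
        have : a * d ≤ a * D0 := by gcongr
        rw [hC3]; nlinarith)
      (by
        intro z hz
        refine le_trans (le_of_eq ?_) (hcon z hz).le
        congr 2
        rw [div_pow]; field_simp)
    have h3 : 8 * (a * (d / C3)) < d := by
      rw [mul_div_assoc', mul_div_assoc', div_lt_iff₀ C30, hC3]
      have : 0 < d * (2 * a * D0) := by positivity
      nlinarith
    linarith

/-! part 20 -/

/-- truncated ball -/
def rb_tb (m : ℕ) (σ : ℝ) : Set (EuclideanSpace ℝ (Fin (m + 1))) := {x | ‖x‖ ≤ 1 ∧ |x 0| ≤ 1 - σ}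
lemma rb_tb_compact (m : ℕ) (σ : ℝ) : IsCompact (rb_tb m σ) := by
  apply (isCompact_closedBall (0 : EuclideanSpace ℝ (Fin (m + 1))) 1).of_isClosed_subset
  · apply IsClosed.inter (s₁ := {x : EuclideanSpace ℝ (Fin (m + 1)) | ‖x‖ ≤ 1}) (s₂ := {x | |x 0| ≤ 1 - σ})
    · exact isClosed_le (by fun_prop) (by fun_prop)
    · exact isClosed_le (by fun_prop) (by fun_prop)
  · intro x hx
    rw [mem_closedBall_zero_iff]; exact hx.1
lemma rb_tb_convex (m : ℕ) (σ : ℝ) : Convex ℝ (rb_tb m σ) := by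
  intro x hx y hy a b ha hb hab
  constructor
  · calc ‖a • x + b • y‖ ≤ ‖a • x‖ + ‖b • y‖ := norm_add_le _ _
      _ = a * ‖x‖ + b * ‖y‖ := by rw [norm_smul, norm_smul, Real.norm_of_nonneg ha, Real.norm_of_nonneg hb]
      _ ≤ a * 1 + b * 1 := by gcongr; exacts [hx.1, hy.1]
      _ = 1 := by linarith
  · calc |(a • x + b • y) 0| = |a * x 0 + b * y 0| := by simp
      _ ≤ |a * x 0| + |b * y 0| := abs_add_le _ _
      _ = a * |x 0| + b * |y 0| := by rw [abs_mul, abs_mul, abs_of_nonneg ha, abs_of_nonneg hb]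
      _ ≤ a * (1 - σ) + b * (1 - σ) := by gcongr; exacts [hx.2, hy.2]
      _ = 1 - σ := by rw [← add_mul, hab, one_mul]
lemma rb_tb_neg {m : ℕ} {σ : ℝ} {x} (hx : x ∈ rb_tb m σ) : -x ∈ rb_tb m σ := by
  refine ⟨by rw [norm_neg]; exact hx.1, ?_⟩
  have : (-x) 0 = - x 0 := rfl
  rw [this, abs_neg]; exact hx.2
lemma rb_tb_int (m : ℕ) {σ : ℝ} (hσ : σ ≤ 1 / 2) : (interior (rb_tb m σ)).Nonempty := by
  refine ⟨0, mem_interior.2 ⟨Metric.ball 0 (1 / 2), ?_, Metric.isOpen_ball, by simp⟩⟩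
  intro x hx
  rw [mem_ball_zero_iff] at hx
  have h2 : |x 0| ≤ ‖x‖ := by simpa using PiLp.norm_apply_le x 0
  exact ⟨by linarith, by linarith⟩
lemma rb_tb_rot (m : ℕ) (σ : ℝ) (ρ : EuclideanSpace ℝ (Fin (m + 1)) ≃ₗᵢ[ℝ] EuclideanSpace ℝ (Fin (m + 1)))
    (h : ρ (EuclideanSpace.single 0 1) = EuclideanSpace.single 0 1) : ρ '' rb_tb m σ = rb_tb m σ := by
  have key : ∀ x, (ρ x) 0 = x 0 := by
    intro x
    have := ρ.inner_map_map (EuclideanSpace.single 0 1) x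
    rw [h, EuclideanSpace.inner_single_left, EuclideanSpace.inner_single_left] at this
    simpa using this
  ext y
  constructor
  · rintro ⟨x, hx, rfl⟩
    refine ⟨by rw [ρ.norm_map]; exact hx.1, by rw [key]; exact hx.2⟩
  · intro hy
    refine ⟨ρ.symm y, ⟨by rw [ρ.symm.norm_map]; exact hy.1, ?_⟩, by simp⟩
    rw [← key, ρ.apply_symm_apply]; exact hy.2
lemma rb_tb_BM {m : ℕ} (hm : 1 ≤ m) {σ : ℝ} (h0 : 0 ≤ σ) (h1 : σ ≤ 1 / 2) :
    σ / 4 ≤ BMdist (rb_tb m σ) (Metric.closedBall 0 1) := by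
  set C := rb_tb m σ with hC
  have main : ∀ lam : ℝ, 1 ≤ lam → ∀ (Φ : EuclideanSpace ℝ (Fin (m + 1)) ≃ₗ[ℝ] EuclideanSpace ℝ (Fin (m + 1)))
      (x y : EuclideanSpace ℝ (Fin (m + 1))),
      (fun v => v - x) '' C ⊆ Φ '' ((fun v => v - y) '' (Metric.closedBall 0 1)) →
      Φ '' ((fun v => v - y) '' (Metric.closedBall 0 1)) ⊆ lam • ((fun v => v - x) '' C) → 1 + σ ≤ lam ^ 2 := by
    intro lam hl Φ x y i1 i2
    have l0 : 0 < lam := by linarith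
    have j1 : ∀ p ∈ C, ‖Φ.symm p‖ ≤ 1 := by
      intro p hp
      obtain ⟨_, ⟨b, hb, rfl⟩, e⟩ := i1 ⟨p, hp, rfl⟩
      obtain ⟨_, ⟨b', hb', rfl⟩, e'⟩ := i1 ⟨-p, rb_tb_neg hp, rfl⟩
      rw [mem_closedBall_zero_iff] at hb hb'
      have : Φ.symm p = (1 / 2 : ℝ) • (b - b') := by
        rw [LinearEquiv.symm_apply_eq, map_smul]
        have h3 : Φ (b - b') = Φ (b - y) - Φ (b' - y) := by rw [← map_sub]; congr 1; abel
        rw [h3, e, e']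
        simp only []
        module
      rw [this, norm_smul]
      have := norm_sub_le b b'
      rw [Real.norm_of_nonneg (by norm_num)]
      linarith
    have j2 : ∀ b, ‖b‖ ≤ 1 → lam⁻¹ • Φ b ∈ C := by
      intro b hb
      obtain ⟨_, ⟨p, hp, rfl⟩, e⟩ := i2 ⟨b - y, ⟨b, by simpa using hb, rfl⟩, rfl⟩
      obtain ⟨_, ⟨p', hp', rfl⟩, e'⟩ := i2 ⟨-b - y, ⟨-b, by simpa using hb, rfl⟩, rfl⟩
      have : lam⁻¹ • Φ b = (1 / 2 : ℝ) • p + (1 / 2 : ℝ) • (-p') := by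
        have h3 : Φ b = (1 / 2 : ℝ) • (Φ (b - y) - Φ (-b - y)) := by
          rw [← map_sub, ← map_smul]; congr 1; module
        rw [h3, ← e, ← e']
        simp only []
        rw [← smul_sub, smul_comm (1/2 : ℝ) lam, smul_smul, inv_mul_cancel₀ l0.ne', one_smul]
        module
      rw [this]
      exact rb_tb_convex m σ hp (rb_tb_neg hp') (by norm_num) (by norm_num) (by norm_num)
    obtain ⟨k, rfl⟩ : ∃ k, m = k + 1 := ⟨m - 1, by omega⟩
    set be := Real.sqrt (1 - (1 - σ) ^ 2) with hbe
    have be2 : be ^ 2 = 1 - (1 - σ) ^ 2 := Real.sq_sqrt (by nlinarith)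
    have be0 : 0 ≤ be := Real.sqrt_nonneg _
    set a : EuclideanSpace ℝ (Fin (k + 1 + 1)) := (1 - σ) • EuclideanSpace.single 0 1 with ha
    set b : EuclideanSpace ℝ (Fin (k + 1 + 1)) := be • EuclideanSpace.single 1 1 with hb
    have a0 : a 0 = 1 - σ := by simp [ha]
    have b0 : b 0 = 0 := by simp [hb]
    have nb : ‖b‖ = be := by simp [hb, norm_smul, abs_of_nonneg be0]
    have na : ‖a‖ = 1 - σ := by simp [ha, norm_smul]; linarith
    have iab : inner ℝ a b = 0 := by
      rw [ha, hb, inner_smul_left, inner_smul_right, EuclideanSpace.inner_single_left]; simp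
    have pC : a + b ∈ C := by
      constructor
      · rw [← sq_le_one_iff₀ (norm_nonneg _), norm_add_sq_real, iab, na, nb, be2]; linarith
      · have : (a + b) 0 = a 0 + b 0 := rfl
        rw [this, a0, b0, add_zero, abs_of_nonneg (by linarith)]
    have mC : a - b ∈ C := by
      constructor
      · rw [← sq_le_one_iff₀ (norm_nonneg _), norm_sub_sq_real, iab, na, nb, be2]; linarith
      · have : (a - b) 0 = a 0 - b 0 := rfl
        rw [this, a0, b0, sub_zero, abs_of_nonneg (by linarith)]
    have p1 := j1 _ pC
    have p2 := j1 _ mC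
    have par := parallelogram_law_with_norm ℝ (Φ.symm a) (Φ.symm b)
    rw [← map_add, ← map_sub] at par
    have low : ∀ w, w ≠ 0 → (lam * ‖Φ.symm w‖)⁻¹ • w ∈ C ∧ 0 < ‖Φ.symm w‖ := by
      intro w hw
      have hp : 0 < ‖Φ.symm w‖ := by simpa using hw
      refine ⟨?_, hp⟩
      have := j2 (‖Φ.symm w‖⁻¹ • Φ.symm w) (by rw [norm_smul, norm_inv, norm_norm, inv_mul_cancel₀ hp.ne'])
      rw [map_smul, Φ.apply_symm_apply, smul_smul, ← mul_inv] at this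
      exact this
    have la : 1 ≤ lam * ‖Φ.symm a‖ := by
      have ane : a ≠ 0 := by
        intro h; rw [h, norm_zero] at na; linarith
      obtain ⟨l1, l2⟩ := low a ane
      have l3 := l1.2
      have : ((lam * ‖Φ.symm a‖)⁻¹ • a) 0 = (lam * ‖Φ.symm a‖)⁻¹ * (1 - σ) := by rw [← a0]; rfl
      rw [this, abs_of_nonneg (by have : 0 ≤ 1 - σ := by linarith
                                  positivity), inv_mul_le_iff₀ (by positivity)] at l3
      by_contra hh
      push Not at hh
      nlinarith
    have lb : be ≤ lam * ‖Φ.symm b‖ := by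
      by_cases bne : b = 0
      · rw [← nb, bne]; simp
      obtain ⟨l1, l2⟩ := low b bne
      have l3 := l1.1
      rw [norm_smul, Real.norm_of_nonneg (by positivity), nb, inv_mul_le_iff₀ (by positivity), mul_one] at l3
      exact l3
    have q1 : ‖Φ.symm (a + b)‖ ^ 2 ≤ 1 := pow_le_one₀ (norm_nonneg _) p1
    have q2 : ‖Φ.symm (a - b)‖ ^ 2 ≤ 1 := pow_le_one₀ (norm_nonneg _) p2
    have q3 : 1 ≤ (lam * ‖Φ.symm a‖) ^ 2 := one_le_pow₀ la
    have q4 : be ^ 2 ≤ (lam * ‖Φ.symm b‖) ^ 2 := by gcongr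
    rw [mul_pow] at q3 q4
    have q5 : ‖Φ.symm a‖ ^ 2 + ‖Φ.symm b‖ ^ 2 ≤ 1 := by nlinarith
    have q6 := mul_le_mul_of_nonneg_left q5 (sq_nonneg lam)
    nlinarith
  unfold BMdist
  have hlow : Real.sqrt (1 + σ) ≤ sInf {lam : ℝ | 1 ≤ lam ∧
    ∃ Φ : EuclideanSpace ℝ (Fin (m + 1)) ≃ₗ[ℝ] EuclideanSpace ℝ (Fin (m + 1)),
    ∃ x y : EuclideanSpace ℝ (Fin (m + 1)),
      (fun v => v - x) '' C ⊆ Φ '' ((fun v => v - y) '' (Metric.closedBall 0 1)) ∧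
      Φ '' ((fun v => v - y) '' (Metric.closedBall 0 1)) ⊆ lam • ((fun v => v - x) '' C)} := by
    apply le_csInf
    · refine ⟨2, by norm_num, LinearEquiv.refl ℝ _, 0, 0, ?_, ?_⟩
      · rintro _ ⟨x, hx, rfl⟩
        exact ⟨x, ⟨x, by simpa using hx.1, by simp⟩, by simp⟩
      · rintro _ ⟨_, ⟨x, hx, rfl⟩, rfl⟩
        rw [mem_closedBall_zero_iff] at hx
        rw [Set.mem_smul_set]
        refine ⟨(1 / 2 : ℝ) • x, ⟨(1 / 2 : ℝ) • x, ⟨?_, ?_⟩, by simp⟩, ?_⟩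
        · rw [norm_smul, Real.norm_of_nonneg (by norm_num)]; linarith
        · have h2 : |x 0| ≤ ‖x‖ := by simpa using PiLp.norm_apply_le x 0
          have : ((1 / 2 : ℝ) • x) 0 = (1 / 2) * x 0 := rfl
          rw [this, abs_mul, abs_of_pos (by norm_num)]; linarith
        · simp [smul_smul]
    · rintro lam ⟨hl, Φ, x, y, i1, i2⟩
      exact Real.sqrt_le_iff.2 ⟨by linarith, main lam hl Φ x y i1 i2⟩
  have hs : 0 < Real.sqrt (1 + σ) := Real.sqrt_pos.2 (by linarith)
  refine le_trans ?_ (Real.log_le_log hs hlow)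
  rw [Real.log_sqrt (by linarith)]
  have h3 := Real.one_sub_inv_le_log_of_pos (show 0 < 1 + σ by linarith)
  have h4 : σ / 2 ≤ 1 - (1 + σ)⁻¹ := by
    have : (1 + σ)⁻¹ ≤ 1 - σ / 2 := by
      rw [inv_le_iff_one_le_mul₀ (by linarith)]
      nlinarith
    linarith
  linarith

/-! part 21 -/

lemma rb_pol_fin {n : ℕ} {K : Set (EuclideanSpace ℝ (Fin n))} {z} (hz : z ∈ interior K) :
    volume (polarBody K z) < ⊤ := by
  obtain ⟨r, hr, hb⟩ := Metric.isOpen_iff.1 isOpen_interior z hz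
  refine lt_of_le_of_lt (measure_mono (t := Metric.closedBall z (2 / r)) ?_) measure_closedBall_lt_top
  intro x hx
  rw [mem_closedBall_iff_norm]
  by_cases h0 : x - z = 0
  · rw [h0, norm_zero]; positivity
  have hn : 0 < ‖x - z‖ := by simpa using h0
  have h1 := hx (z + (r / 2 / ‖x - z‖) • (x - z)) (interior_subset (hb (by
    rw [mem_ball_iff_norm, add_sub_cancel_left, norm_smul, Real.norm_of_nonneg (by positivity),
      div_mul_cancel₀ _ hn.ne']
    linarith)))
  rw [add_sub_cancel_left, inner_smul_right, real_inner_self_eq_norm_sq] at h1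
  have h2 : r / 2 / ‖x - z‖ * ‖x - z‖ ^ 2 = r / 2 * ‖x - z‖ := by field_simp
  rw [h2] at h1
  rw [le_div_iff₀ hr]; linarith
lemma rb_vol_ballE (m : ℕ) :
    (volume (Metric.closedBall (0 : EuclideanSpace ℝ (Fin (m + 1))) 1)).toReal = rb_om (m + 1) := by
  have hP := PiLp.volume_preserving_ofLp (Fin (m + 1))
  have : Metric.closedBall (0 : EuclideanSpace ℝ (Fin (m + 1))) 1 = WithLp.ofLp ⁻¹' rb_ball (m + 1) 1 := by
    ext x
    simp only [mem_closedBall_zero_iff, rb_ball, Set.mem_preimage, Set.mem_setOf_eq]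
    rw [← sq_le_one_iff₀ (norm_nonneg _), EuclideanSpace.norm_sq_eq]
    simp [dotProduct, sq]
  rw [this, hP.measure_preimage (rb_ball_closed (m + 1) 1).measurableSet.nullMeasurableSet, rb_om]
lemma rb_box_vol (m : ℕ) (p s q : ℝ) (hs : 0 ≤ s) (hq : 0 ≤ q) :
    volume (WithLp.ofLp ⁻¹' (Set.Icc (Fin.cons p (fun _ => -q)) (Fin.cons (p + s) (fun _ => q)) : Set (Fin (m + 1) → ℝ)) :
      Set (EuclideanSpace ℝ (Fin (m + 1)))) = ENNReal.ofReal (s * (2 * q) ^ m) := by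
  have hP := PiLp.volume_preserving_ofLp (Fin (m + 1))
  rw [hP.measure_preimage measurableSet_Icc.nullMeasurableSet, Real.volume_Icc_pi, Fin.prod_univ_succ]
  simp only [Fin.cons_zero, Fin.cons_succ, Finset.prod_const, Finset.card_univ, Fintype.card_fin]
  rw [← ENNReal.ofReal_pow (by linarith), ← ENNReal.ofReal_mul (by linarith)]
  congr 2
  · ring
  · ring
lemma rb_tb_vol (m : ℕ) {s : ℝ} (hs0 : 0 ≤ s) (hs : s ^ 2 ≤ 1 / 2) :
    rb_om (m + 1) - 2 * 4 ^ m * s ^ (m + 2) ≤ (volume (rb_tb m (s ^ 2))).toReal := by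
  set C := rb_tb m (s ^ 2) with hC
  set B1 : Set (EuclideanSpace ℝ (Fin (m + 1))) :=
    WithLp.ofLp ⁻¹' (Set.Icc (Fin.cons (1 - s ^ 2) (fun _ => -(2 * s))) (Fin.cons (1 - s ^ 2 + s ^ 2) (fun _ => 2 * s))) with hB1
  set B2 : Set (EuclideanSpace ℝ (Fin (m + 1))) :=
    WithLp.ofLp ⁻¹' (Set.Icc (Fin.cons (-1) (fun _ => -(2 * s))) (Fin.cons (-1 + s ^ 2) (fun _ => 2 * s))) with hB2
  have v1 : volume B1 = _ := rb_box_vol m (1 - s ^ 2) (s ^ 2) (2 * s) (by positivity) (by positivity)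
  have v2 : volume B2 = _ := rb_box_vol m (-1) (s ^ 2) (2 * s) (by positivity) (by positivity)
  have e : s ^ 2 * (2 * (2 * s)) ^ m = 4 ^ m * s ^ (m + 2) := by
    rw [show 2 * (2 * s) = 4 * s by ring, mul_pow]; ring
  rw [e] at v1 v2
  have sub : Metric.closedBall (0 : EuclideanSpace ℝ (Fin (m + 1))) 1 ⊆ C ∪ (B1 ∪ B2) := by
    intro x hx
    rw [mem_closedBall_zero_iff] at hx
    by_cases h : |x 0| ≤ 1 - s ^ 2
    · exact Or.inl ⟨hx, h⟩
    right
    push Not at h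
    have hn : x 0 ^ 2 + ∑ i : Fin m, x i.succ ^ 2 ≤ 1 := by
      have h1 : ‖x‖ ^ 2 ≤ 1 := pow_le_one₀ (norm_nonneg _) hx
      rw [EuclideanSpace.norm_sq_eq, Fin.sum_univ_succ] at h1
      simpa using h1
    have h2 : (1 - s ^ 2) ^ 2 ≤ x 0 ^ 2 := by
      rw [← sq_abs (x 0)]
      apply pow_le_pow_left₀ (by linarith) h.le
    have hi : ∀ i : Fin m, |x i.succ| ≤ 2 * s := by
      intro i
      apply abs_le_of_sq_le_sq _ (by positivity)
      have := Finset.single_le_sum (f := fun i : Fin m => x i.succ ^ 2) (fun i _ => sq_nonneg _) (Finset.mem_univ i)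
      simp only [] at this
      nlinarith [sq_nonneg s, sq_nonneg (s ^ 2)]
    have h3 : |x 0| ≤ 1 := by
      apply abs_le_of_sq_le_sq _ (by norm_num)
      have : 0 ≤ ∑ i : Fin m, x i.succ ^ 2 := Finset.sum_nonneg fun i _ => sq_nonneg _
      linarith
    rw [abs_le] at h3
    rcases lt_abs.1 h with h4 | h4
    · left
      constructor
      · intro j
        refine Fin.cases ?_ (fun i => ?_) j
        · simpa using h4.le
        · simpa using (abs_le.1 (hi i)).1
      · intro j
        refine Fin.cases ?_ (fun i => ?_) j
        · simpa using h3.2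
        · simpa using (abs_le.1 (hi i)).2
    · right
      constructor
      · intro j
        refine Fin.cases ?_ (fun i => ?_) j
        · simpa using h3.1
        · simpa using (abs_le.1 (hi i)).1
      · intro j
        refine Fin.cases ?_ (fun i => ?_) j
        · simp only [Fin.cons_zero]; linarith
        · simpa using (abs_le.1 (hi i)).2
  have hvol : volume (Metric.closedBall (0 : EuclideanSpace ℝ (Fin (m + 1))) 1) ≤
      volume C + (ENNReal.ofReal (4 ^ m * s ^ (m + 2)) + ENNReal.ofReal (4 ^ m * s ^ (m + 2))) := by
    refine (measure_mono sub).trans ((measure_union_le _ _).trans ?_)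
    gcongr
    refine (measure_union_le _ _).trans ?_
    rw [v1, v2]
  have Cf : volume C ≠ ⊤ := (rb_tb_compact m (s ^ 2)).measure_lt_top.ne
  have p0 : 0 ≤ 4 ^ m * s ^ (m + 2) := by positivity
  have oT : ENNReal.ofReal (4 ^ m * s ^ (m + 2)) ≠ ⊤ := ENNReal.ofReal_ne_top
  have oT2 := ENNReal.add_ne_top.2 ⟨oT, oT⟩
  have := ENNReal.toReal_mono (ENNReal.add_ne_top.2 ⟨Cf, oT2⟩) hvol
  rw [rb_vol_ballE, ENNReal.toReal_add Cf oT2, ENNReal.toReal_add oT oT, ENNReal.toReal_ofReal p0] at this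
  linarith
lemma rb_tb_pol (m : ℕ) (σ : ℝ) :
    Metric.closedBall (0 : EuclideanSpace ℝ (Fin (m + 1))) 1 ⊆ polarBody (rb_tb m σ) 0 := by
  intro x hx y hy
  rw [mem_closedBall_zero_iff] at hx
  rw [sub_zero, sub_zero]
  exact (real_inner_le_norm _ _).trans (mul_le_one₀ hx (norm_nonneg _) hy.1)

/-- **Reduction to bodies of revolution** (Böröczky). For any `n ≥ 2` there exists
`γ̃ > 0` depending only on `n` such that for every convex body `K` in `ℝⁿ` with
Santaló point `z` there is an `o`-symmetric convex body `C` with axial rotational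
symmetry satisfying `δ_BM(C, Bⁿ) ≥ γ̃·δ_BM(K, Bⁿ)²` and `|C|·|C^o| ≥ |K|·|K^z|`. -/
theorem exists_revolution_body_rounding {n : ℕ} (hn : 2 ≤ n) :
    ∃ γ : ℝ, 0 < γ ∧
      ∀ (K : Set (EuclideanSpace ℝ (Fin n))) (z : EuclideanSpace ℝ (Fin n)),
        IsCompact K → Convex ℝ K → (interior K).Nonempty →
        z ∈ interior K →
        (∀ w ∈ interior K, volume (polarBody K z) ≤ volume (polarBody K w)) →
        ∃ C : Set (EuclideanSpace ℝ (Fin n)),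
          IsCompact C ∧ Convex ℝ C ∧ (interior C).Nonempty ∧ C = -C ∧
          (∃ u : EuclideanSpace ℝ (Fin n), u ≠ 0 ∧
            ∀ ρ : EuclideanSpace ℝ (Fin n) ≃ₗᵢ[ℝ] EuclideanSpace ℝ (Fin n),
              ρ u = u → ρ '' C = C) ∧
          γ * BMdist K (Metric.closedBall (0 : EuclideanSpace ℝ (Fin n)) 1) ^ 2 ≤
            BMdist C (Metric.closedBall (0 : EuclideanSpace ℝ (Fin n)) 1) ∧
          volume K * volume (polarBody K z) ≤ volume C * volume (polarBody C 0) := by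
  obtain ⟨m, rfl⟩ : ∃ m, n = m + 1 := ⟨n - 1, by omega⟩
  have hm : 1 ≤ m := by omega
  obtain ⟨c1, D0, hc1, hD0, H⟩ := rb_stab hm
  have om0 : 0 < rb_om (m + 1) := rb_om_pos (m + 1)
  set om := rb_om (m + 1) with hom
  set g := min (min 1 (1 / (2 * D0))) (om * c1 / (2 * 4 ^ m)) with hg
  have g0 : 0 < g := by rw [hg]; positivity
  have g1 : g ≤ 1 := (min_le_left _ _).trans (min_le_left _ _)
  have g2 : g ≤ 1 / (2 * D0) := (min_le_left _ _).trans (min_le_right _ _)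
  have g3 : g ≤ om * c1 / (2 * 4 ^ m) := min_le_right _ _
  refine ⟨g ^ 2 / 4, by positivity, ?_⟩
  intro K z hK hconv hne hz hsant
  obtain ⟨hd, w, hw, hw2⟩ := H K hK hconv hne
  set d := BMdist K (Metric.closedBall (0 : EuclideanSpace ℝ (Fin (m + 1))) 1) with hdd
  have d0 : 0 ≤ d := rb_BM_nonneg _ _
  set s := g * d with hs
  have s0 : 0 ≤ s := by positivity
  have s1 : s ≤ 1 / 2 := by
    rw [le_div_iff₀ (by positivity)] at g2
    have : g * d ≤ g * D0 := by gcongr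
    linarith
  have s2 : s ^ 2 ≤ 1 / 2 := by nlinarith
  refine ⟨rb_tb m (s ^ 2), rb_tb_compact _ _, rb_tb_convex _ _, rb_tb_int _ s2, ?_,
    ⟨EuclideanSpace.single 0 1, ?_, fun ρ hρ => rb_tb_rot m _ ρ hρ⟩, ?_, ?_⟩
  · ext x
    rw [Set.mem_neg]
    refine ⟨rb_tb_neg, fun h => ?_⟩
    have := rb_tb_neg h
    rwa [neg_neg] at this
  · intro h
    have : ‖(EuclideanSpace.single 0 1 : EuclideanSpace ℝ (Fin (m + 1)))‖ = 0 := by rw [h, norm_zero]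
    simp at this
  · have := rb_tb_BM hm (sq_nonneg s) s2
    refine le_trans (le_of_eq ?_) this
    rw [hs]; ring
  · have vb := rb_tb_vol m s0 s2
    have Cf : volume (rb_tb m (s ^ 2)) ≠ ⊤ := (rb_tb_compact m (s ^ 2)).measure_lt_top.ne
    have Bf : volume (Metric.closedBall (0 : EuclideanSpace ℝ (Fin (m + 1))) 1) ≠ ⊤ := measure_closedBall_lt_top.ne
    calc volume K * volume (polarBody K z) ≤ volume K * volume (polarBody K w) := by
          exact mul_le_mul_right (hsant w hw) _
      _ ≤ volume (rb_tb m (s ^ 2)) * volume (Metric.closedBall (0 : EuclideanSpace ℝ (Fin (m + 1))) 1) := by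
          rw [← ENNReal.toReal_le_toReal (ENNReal.mul_ne_top hK.measure_lt_top.ne (rb_pol_fin hw).ne)
            (ENNReal.mul_ne_top Cf Bf), ENNReal.toReal_mul, ENNReal.toReal_mul, rb_vol_ballE]
          refine hw2.trans ?_
          have h1 : 2 * 4 ^ m * s ^ (m + 2) ≤ om * (c1 * d ^ (m + 2)) := by
            rw [hs, mul_pow]
            have h2 : g ^ (m + 2) ≤ g := by
              calc g ^ (m + 2) ≤ g ^ 1 := pow_le_pow_of_le_one g0.le g1 (by omega)
                _ = g := pow_one g
            have h3 : 2 * 4 ^ m * g ^ (m + 2) ≤ om * c1 := by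
              have : g * (2 * 4 ^ m) ≤ om * c1 := by
                rwa [le_div_iff₀ (by positivity)] at g3
              have h5 : 2 * 4 ^ m * g ^ (m + 2) ≤ 2 * 4 ^ m * g := by gcongr
              linarith
            have := mul_le_mul_of_nonneg_right h3 (pow_nonneg d0 (m + 2))
            linarith
          calc (1 - c1 * d ^ (m + 2)) * om ^ 2 = (om - om * (c1 * d ^ (m + 2))) * om := by ring
            _ ≤ _ := by gcongr; linarith
      _ ≤ _ := by gcongr; exact rb_tb_pol m _
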